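/- Every (2)-bipancyclic graph on v vertices with at most v + 5 edges satisfies v ∈ {14, 22}. -/

import Mathlib

open SimpleGraph

/-- The number of cycles of length `k` in `G`, counted as subgraphs of `G`
isomorphic to the cycle graph `C_k`. -/
noncomputable def cycleCount {V : Type*} (G : SimpleGraph V) (k : ℕ) : ℕ :=
  {H : G.Subgraph | Nonempty (H.coe ≃g cycleGraph k)}.ncard

/-- A bipartite graph on an even number `v ≥ 4` of vertices is `(r)`-bipancyclic if
it contains precisely `r` cycles of each even length from `4` to `v`. -/
def IsRBipancyclic {V : Type*} [Fintype V] (G : SimpleGraph V) (r : ℕ) : Prop :=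
  G.Colorable 2 ∧ Even (Fintype.card V) ∧ 4 ≤ Fintype.card V ∧
    ∀ k : ℕ, 4 ≤ k → k ≤ Fintype.card V → Even k → cycleCount G k = r

namespace BP

/-- Pack a list of small numbers into 16-bit lanes of one number. -/
def pack (l : List ℕ) : ℕ :=
  List.rec (nat_lit 0) (fun a _ ih => Nat.add a (Nat.mul (nat_lit 65536) ih)) l

/-- Number of lanes with value at least `x`. `one` has `1` in every lane. -/
def cGE (one F x : ℕ) : ℕ :=
  Nat.mod (Nat.div (Nat.land (Nat.add F (Nat.mul one (Nat.sub (nat_lit 32768) x)))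
    (Nat.mul one (nat_lit 32768))) (nat_lit 32768)) (nat_lit 65535)

def mapL {α β : Type} (f : α → β) (l : List α) : List β :=
  List.rec [] (fun a _ ih => f a :: ih) l

/-- `xorApp g l r`: the list `l.map (g xor ·) ++ r`. -/
def xorApp (g : ℕ) (l r : List ℕ) : List ℕ :=
  List.rec r (fun a _ ih => Nat.xor g a :: ih) l

/-- All combinations of the generators. -/
def spanL (gs : List ℕ) : List ℕ :=
  List.rec [nat_lit 0] (fun g _ ih => xorApp g ih ih) gs

def gensAux (D : List (ℕ × ℕ)) : ℕ → List ℕ :=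
  List.rec (fun _ => []) (fun c _ ih k =>
    Nat.xor (Nat.xor (Nat.sub (Nat.pow (nat_lit 2) c.2) (nat_lit 1))
      (Nat.sub (Nat.pow (nat_lit 2) c.1) (nat_lit 1))) (Nat.pow (nat_lit 2) k) ::
      ih (Nat.succ k)) D

def code (w : ℕ) (D : List (ℕ × ℕ)) : List ℕ :=
  spanL (Nat.sub (Nat.pow (nat_lit 2) w) (nat_lit 1) :: gensAux D w)

def minsOf (C : List ℕ) (one A len : ℕ) : List ℕ :=
  List.rec [] (fun c _ ih =>
    bif Nat.beq (Nat.add (cGE one (Nat.land A (Nat.mul one (Nat.xor (nat_lit 32767) c)))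
      (nat_lit 1)) (nat_lit 2)) len then c :: ih else ih) C

def lenL {α : Type} (l : List α) : ℕ := List.rec (nat_lit 0) (fun _ _ ih => Nat.succ ih) l

/-- the number with `n` lanes equal to one -/
def ones (n : ℕ) : ℕ :=
  Nat.div (Nat.sub (Nat.pow (nat_lit 65536) n) (nat_lit 1)) (nat_lit 65535)

def mins (w : ℕ) (D : List (ℕ × ℕ)) : List ℕ :=
  (fun C => minsOf C (ones (lenL C)) (pack C) (lenL C)) (code w D)

def needs (N : ℕ) : Bool := bif Nat.beq (Nat.mod N (nat_lit 2)) (nat_lit 0) then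
  (bif Nat.beq N (nat_lit 12) then false else bif Nat.beq N (nat_lit 20) then false else true)
  else false

def rangeAux (f : ℕ → ℕ × ℕ) (n : ℕ) : ℕ → List (ℕ × ℕ) → List (ℕ × ℕ) :=
  Nat.rec (fun _ r => r) (fun _ ih y r => f y :: ih (Nat.succ y) r) n

/-- sorted list of the pairs `(x, y)`, `x < y < w`, with `x ≥ w - k` -/
def pairsAux (w k : ℕ) : List (ℕ × ℕ) :=
  Nat.rec [] (fun k ih =>
    rangeAux (fun y => (Nat.sub w (Nat.succ k), y)) k (Nat.sub w k) ih) k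

def pairs (w : ℕ) : List (ℕ × ℕ) := pairsAux w w

def kk (x y : ℕ) : ℕ := Nat.pow (nat_lit 2) (bif Nat.ble x y
  then Nat.add (Nat.mul (nat_lit 10) x) y else Nat.add (Nat.mul (nat_lit 10) y) x)

def key (f : ℕ → ℕ) (D : List (ℕ × ℕ)) : ℕ :=
  List.rec (nat_lit 0) (fun c _ ih => Nat.add (kk (f c.1) (f c.2)) ih) D

def canonAux (w k : ℕ) (D : List (ℕ × ℕ)) (r : ℕ) : Bool :=
  Nat.rec true (fun r ih =>
    bif Nat.ble k (key (fun x => Nat.mod (Nat.add x r) w) D) then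
      bif Nat.ble k (key (fun x => Nat.mod (Nat.sub (Nat.add w r) x) w) D) then ih else false
    else false) r

def canon (w : ℕ) (D : List (ℕ × ℕ)) : Bool := canonAux w (key (fun x => x) D) D w

/-- Enumeration of the diagrams: `m` chords remaining, `u` the uncovered points (a bit mask),
`s` the number of endpoints which may still be wasted, `acc` the chosen chords. -/
def gen (test : List (ℕ × ℕ) → Bool) (ps : List (ℕ × ℕ)) :
    ℕ → ℕ → ℕ → List (ℕ × ℕ) → List (List (ℕ × ℕ)) → List (List (ℕ × ℕ)) :=
  List.rec
    (fun m _ _ acc r => bif Nat.beq m (nat_lit 0) then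
      (bif test acc then acc :: r else r) else r)
    (fun c _ ih m u s acc r =>
      bif Nat.beq m (nat_lit 0) then (bif test acc then acc :: r else r)
      else bif Nat.beq (Nat.mod u (Nat.pow (nat_lit 2) c.1)) (nat_lit 0) then
        (fun a b =>
          (fun t r' => bif Nat.ble (nat_lit 2) (Nat.add s t) then
            ih (Nat.sub m (nat_lit 1))
              (Nat.sub u (Nat.add (Nat.mul a (Nat.pow (nat_lit 2) c.1))
                (Nat.mul b (Nat.pow (nat_lit 2) c.2))))
              (Nat.sub (Nat.add s t) (nat_lit 2)) (c :: acc) r'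
            else r') (Nat.add a b) (ih m u s acc r))
          (Nat.mod (Nat.div u (Nat.pow (nat_lit 2) c.1)) (nat_lit 2))
          (Nat.mod (Nat.div u (Nat.pow (nat_lit 2) c.2)) (nat_lit 2))
      else r) ps

def gen0 (test : List (ℕ × ℕ) → Bool) (w m : ℕ) : List (List (ℕ × ℕ)) :=
  gen test (pairs w) m (Nat.sub (Nat.pow (nat_lit 2) w) (nat_lit 1))
    (Nat.sub (Nat.mul (nat_lit 2) m) w) [] []

def test (w : ℕ) (D : List (ℕ × ℕ)) : Bool :=
  bif canon w D then needs (lenL (mins w D)) else false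


/-- Evaluate the argument `x` before substituting it. -/
def force {α : Type} (x : ℕ) (f : ℕ → α) : α :=
  Nat.rec (f (nat_lit 0)) (fun k _ => f (Nat.succ k)) x

/-- Pick the entry with index `d` of a list; continue with it and the list of the others. -/
def pick (us : List ℕ) : ℕ → (ℕ → List ℕ → Bool) → Bool :=
  List.rec (fun _ _ => false) (fun M us ih d k =>
    bif Nat.beq d (nat_lit 0) then k M us
    else ih (Nat.sub d (nat_lit 1)) (fun M' r => k M' (M :: r))) us

def landL (one : ℕ) (us : List ℕ) : ℕ := List.rec one (fun M _ ih => Nat.land M ih) us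

def lorL (us : List ℕ) : ℕ := List.rec (nat_lit 0) (fun M _ ih => Nat.lor M ih) us

/-- The test that too many lengths are larger than `L`. -/
def lowT (n one L F : ℕ) : Bool :=
  bif Nat.ble (nat_lit 2) L then bif Nat.ble L n then
    Nat.ble (Nat.succ n) (Nat.add L (cGE one F (Nat.succ L))) else false else false

/-- The test that too few lengths are larger than `L`. -/
def highT (n one L F : ℕ) : Bool :=
  bif Nat.ble (nat_lit 2) L then bif Nat.ble L n then
    Nat.ble (Nat.succ (Nat.add L (cGE one F (Nat.succ L)))) n else false else false

/-- Certificate driven search. -/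
def chk (n one fuel : ℕ) : List ℕ → ℕ → ℕ → ℕ → (ℕ → Bool) → Bool :=
  Nat.rec (fun _ _ _ _ _ => false) (fun _ ih us FL R c K =>
    force (Nat.mod c (nat_lit 128)) fun d => force (Nat.div c (nat_lit 128)) fun c' =>
    bif Nat.ble (nat_lit 64) d then
      bif highT n one (Nat.mul (nat_lit 2) (Nat.sub d (nat_lit 64)))
        (Nat.add FL (Nat.mul R (lorL us))) then K c' else false
    else bif Nat.ble (nat_lit 16) d then
      bif lowT n one (Nat.mul (nat_lit 2) (Nat.sub d (nat_lit 16)))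
        (Nat.add FL (Nat.mul R (landL one us))) then K c' else false
    else pick us d fun M us' => ih us' FL R c' fun c'' =>
      bif Nat.ble (nat_lit 2) R then
        force (Nat.add FL (Nat.mul (nat_lit 2) M)) fun FL' =>
        force (Nat.sub R (nat_lit 2)) fun R' => ih us FL' R' c'' K
      else K c'') fuel

def bitN (c i : ℕ) : ℕ := Nat.mod (Nat.div c (Nat.pow (nat_lit 2) i)) (nat_lit 2)

/-- Chords ending in `i` join points of different colors. -/
def okc (D : List (ℕ × ℕ)) (c i : ℕ) : Bool :=
  List.rec true (fun p _ ih => bif Nat.beq p.2 i then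
    (bif Nat.beq (bitN c p.1) (bitN c i) then false else ih) else ih) D

/-- There is a chord joining the points `i` and `i + 1`. -/
def adjc (w : ℕ) (D : List (ℕ × ℕ)) (i : ℕ) : Bool :=
  List.rec false (fun p _ ih =>
    bif Nat.beq p.1 i then (bif Nat.beq p.2 (Nat.succ i) then true else ih)
    else bif Nat.beq p.1 (nat_lit 0) then
      (bif Nat.beq p.2 i then (bif Nat.beq (Nat.succ i) w then true else ih) else ih)
    else ih) D

def lo1 (w : ℕ) (D : List (ℕ × ℕ)) (c i : ℕ) : ℕ :=
  bif Nat.beq (bitN c i) (bitN c (Nat.mod (Nat.succ i) w)) then (nat_lit 2)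
  else bif adjc w D i then (nat_lit 3) else (nat_lit 1)

/-- Add up the lower bounds. -/
def addLo (lo : ℕ → ℕ) (us : List ℕ) : ℕ → ℕ → ℕ → (ℕ → ℕ → Bool) → Bool :=
  List.rec (fun _ FL S K => K FL S) (fun M _ ih i FL S K =>
    force (lo i) fun l => force (Nat.add FL (Nat.mul l M)) fun FL' =>
    force (Nat.add S l) fun S' => ih (Nat.succ i) FL' S' K) us

def chkCol (n one w : ℕ) (D : List (ℕ × ℕ)) (us : List ℕ) (S c cert : ℕ) (K : ℕ → Bool) : Bool :=
  addLo (lo1 w D c) us (nat_lit 0) S (nat_lit 0) fun FL s =>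
    bif Nat.ble s n then chk n one (nat_lit 100) us FL (Nat.sub n s) cert K else K cert

def chkCols (F : ℕ → ℕ → (ℕ → Bool) → Bool) (D : List (ℕ × ℕ)) (k : ℕ) :
    ℕ → ℕ → ℕ → (ℕ → Bool) → Bool :=
  Nat.rec (fun _ c cert K => F c cert K) (fun _ ih i c cert K =>
    (fun K' => bif okc D c i then ih (Nat.succ i) c cert K' else K' cert) fun cert' =>
      force (Nat.add c (Nat.pow (nat_lit 2) i)) fun c' =>
      bif okc D c' i then ih (Nat.succ i) c' cert' K else K cert') k

def bitLanes (one A i : ℕ) : ℕ :=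
  Nat.div (Nat.land A (Nat.mul one (Nat.pow (nat_lit 2) i))) (Nat.pow (nat_lit 2) i)

def lanesL (one A k : ℕ) : ℕ → List ℕ :=
  Nat.rec (fun _ => []) (fun _ ih i => force (bitLanes one A i) fun x => x :: ih (Nat.succ i)) k

def lanesS (one A k : ℕ) : ℕ → ℕ :=
  Nat.rec (fun _ => nat_lit 0) (fun _ ih i => Nat.add (bitLanes one A i) (ih (Nat.succ i))) k

def chkDiag (w : ℕ) (D : List (ℕ × ℕ)) (cert : ℕ) : Bool :=
  (fun C => force (lenL C) fun N => force (ones N) fun one => force (pack C) fun A =>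
    force (lanesS one A (lenL D) w) fun S =>
    (fun us => chkCols (chkCol (Nat.add N (nat_lit 2)) one w D us S) D
      (Nat.sub w (nat_lit 1)) (nat_lit 1) (nat_lit 0) cert fun _ => true)
      (lanesL one A w (nat_lit 0)))
    (mins w D)

def checkList (w : ℕ) (Ds : List (List (ℕ × ℕ))) : List ℕ → Bool :=
  List.rec (fun _ => true) (fun D _ ih cs =>
    List.rec false (fun c cs _ => bif chkDiag w D c then ih cs else false) cs) Ds

def checkAll (w m : ℕ) (cs : List ℕ) : Bool := checkList w (gen0 (test w) w m) cs

end BP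

namespace BP

theorem pack_cons (a : ℕ) (l : List ℕ) : pack (a :: l) = a + 65536 * pack l := rfl
theorem pack_nil : pack [] = 0 := rfl

theorem force_eq {α : Type} (x : ℕ) (f : ℕ → α) : force x f = f x := by
  cases x <;> rfl

theorem lenL_eq {α : Type} (l : List α) : lenL l = l.length := by
  induction l with
  | nil => rfl
  | cons a l ih => show Nat.succ (lenL l) = _; rw [ih]; rfl

/-- lanes with values given by a function -/
def lanes (C : List ℕ) (f : ℕ → ℕ) : ℕ := pack (C.map f)

theorem lanes_cons (a : ℕ) (C : List ℕ) (f : ℕ → ℕ) :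
    lanes (a :: C) f = f a + 65536 * lanes C f := rfl
theorem lanes_nil (f : ℕ → ℕ) : lanes [] f = 0 := rfl

theorem lanes_id (C : List ℕ) : lanes C (fun c => c) = pack C := by simp [lanes]

theorem lanes_add (C : List ℕ) (f g : ℕ → ℕ) :
    lanes C f + lanes C g = lanes C (fun c => f c + g c) := by
  induction C with
  | nil => rfl
  | cons a C ih => simp only [lanes_cons]; rw [← ih]; ring

theorem lanes_mul (C : List ℕ) (k : ℕ) (f : ℕ → ℕ) :
    k * lanes C f = lanes C (fun c => k * f c) := by
  induction C with
  | nil => simp [lanes_nil]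
  | cons a C ih => simp only [lanes_cons]; rw [← ih]; ring

theorem lanes_congr {C : List ℕ} {f g : ℕ → ℕ} (h : ∀ c ∈ C, f c = g c) :
    lanes C f = lanes C g := by
  unfold lanes; rw [List.map_congr_left h]

theorem ones_eq (C : List ℕ) : ones C.length = lanes C (fun _ => 1) := by
  have h : 65535 * lanes C (fun _ => 1) + 1 = 65536 ^ C.length := by
    induction C with
    | nil => simp [lanes_nil]
    | cons a C ih => rw [lanes_cons, List.length_cons, pow_succ, ← ih]; ring
  show (65536 ^ C.length - 1) / 65535 = _
  rw [← h]; simp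

theorem split_land (a b x y : ℕ) (ha : a < 65536) (hb : b < 65536) :
    (a + 65536 * x) &&& (b + 65536 * y) = (a &&& b) + 65536 * (x &&& y) := by
  have h1 : ((a + 65536 * x) &&& (b + 65536 * y)) % 2 ^ 16 = a &&& b := by
    rw [Nat.and_mod_two_pow]; congr 1 <;> omega
  have h2 : ((a + 65536 * x) &&& (b + 65536 * y)) / 2 ^ 16 = x &&& y := by
    rw [Nat.and_div_two_pow]; congr 1 <;> omega
  omega

theorem split_lor (a b x y : ℕ) (ha : a < 65536) (hb : b < 65536) :
    (a + 65536 * x) ||| (b + 65536 * y) = (a ||| b) + 65536 * (x ||| y) := by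
  have h1 : ((a + 65536 * x) ||| (b + 65536 * y)) % 2 ^ 16 = a ||| b := by
    rw [Nat.or_mod_two_pow]; congr 1 <;> omega
  have h2 : ((a + 65536 * x) ||| (b + 65536 * y)) / 2 ^ 16 = x ||| y := by
    rw [Nat.or_div_two_pow]; congr 1 <;> omega
  omega

theorem lanes_land (C : List ℕ) (f g : ℕ → ℕ) (hf : ∀ c ∈ C, f c < 65536)
    (hg : ∀ c ∈ C, g c < 65536) : lanes C f &&& lanes C g = lanes C (fun c => f c &&& g c) := by
  induction C with
  | nil => simp [lanes_nil]
  | cons a C ih =>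
    simp only [lanes_cons]
    rw [split_land _ _ _ _ (hf a (by simp)) (hg a (by simp)),
      ih (fun c hc => hf c (by simp [hc])) (fun c hc => hg c (by simp [hc]))]

theorem lanes_lor (C : List ℕ) (f g : ℕ → ℕ) (hf : ∀ c ∈ C, f c < 65536)
    (hg : ∀ c ∈ C, g c < 65536) : lanes C f ||| lanes C g = lanes C (fun c => f c ||| g c) := by
  induction C with
  | nil => simp [lanes_nil]
  | cons a C ih =>
    simp only [lanes_cons]
    rw [split_lor _ _ _ _ (hf a (by simp)) (hg a (by simp)),
      ih (fun c hc => hf c (by simp [hc])) (fun c hc => hg c (by simp [hc]))]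

theorem lanes_mod (C : List ℕ) (p : ℕ → Bool) :
    lanes C (fun c => if p c then 1 else 0) % 65535 = C.countP p % 65535 := by
  induction C with
  | nil => rfl
  | cons a C ih =>
    rw [lanes_cons, List.countP_cons]
    omega

theorem and_pow_eq (a i : ℕ) : a &&& 2 ^ i = 2 ^ i * (a / 2 ^ i % 2) := by
  rw [Nat.and_two_pow, Nat.testBit_eq_decide_div_mod_eq]
  rcases Nat.mod_two_eq_zero_or_one (a / 2 ^ i) with h | h <;> simp [h]

theorem cGE_eq (C : List ℕ) (f : ℕ → ℕ) (x : ℕ) (hf : ∀ c ∈ C, f c < 32768)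
    (hx1 : 1 ≤ x) (hx : x ≤ 32768) (hC : C.length < 65535) :
    cGE (lanes C fun _ => 1) (lanes C f) x = C.countP (fun c => decide (x ≤ f c)) := by
  have h0 : cGE (lanes C fun _ => 1) (lanes C f) x =
      (lanes C f + (lanes C fun _ => 1) * (32768 - x) &&& (lanes C fun _ => 1) * 32768) /
        32768 % 65535 := rfl
  rw [h0, mul_comm _ (32768 - x), mul_comm _ 32768, lanes_mul, lanes_mul, lanes_add, lanes_land]
  · have : (lanes C fun c => f c + (32768 - x) * 1 &&& 32768 * 1) =
        32768 * lanes C (fun c => if decide (x ≤ f c) then 1 else 0) := by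
      rw [lanes_mul]
      apply lanes_congr
      intro c hc
      have := hf c hc
      have h2 := and_pow_eq (f c + (32768 - x)) 15
      norm_num at h2 ⊢
      rw [h2]
      split_ifs <;> omega
    rw [this, Nat.mul_div_cancel_left _ (by norm_num), lanes_mod, Nat.mod_eq_of_lt]
    exact lt_of_le_of_lt List.countP_le_length hC
  · intro c hc; have := hf c hc; omega
  · intro c hc; norm_num

theorem bitLanes_eq (C : List ℕ) (i : ℕ) (hC : ∀ c ∈ C, c < 65536) (hi : i < 16) :
    bitLanes (lanes C fun _ => 1) (pack C) i = lanes C (fun c => bitN c i) := by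
  have h0 : bitLanes (lanes C fun _ => 1) (pack C) i =
      (pack C &&& (lanes C fun _ => 1) * 2 ^ i) / 2 ^ i := rfl
  rw [h0, ← lanes_id, mul_comm, lanes_mul, lanes_land _ _ _ hC]
  · rw [show (lanes C fun c => c &&& 2 ^ i * 1) = 2 ^ i * lanes C (fun c => bitN c i) from ?_]
    · rw [Nat.mul_div_cancel_left _ (by positivity)]
    · rw [lanes_mul]
      apply lanes_congr
      intro c _
      rw [mul_one, and_pow_eq]; rfl
  · intro c _
    rw [mul_one]
    exact lt_of_lt_of_le (Nat.pow_lt_pow_right (by norm_num) hi) (by norm_num)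

end BP

namespace BP

theorem pick_sound (us : List ℕ) : ∀ (d : ℕ) (k : ℕ → List ℕ → Bool), pick us d k = true →
    ∃ l1 M l2, us = l1 ++ M :: l2 ∧ k M (l1 ++ l2) = true := by
  induction us with
  | nil => intro d k h; exact absurd h (by simp [pick])
  | cons M us ih =>
    intro d k h
    change (bif Nat.beq d 0 then k M us
      else pick us (d - 1) (fun M' r => k M' (M :: r))) = true at h
    cases hd : Nat.beq d 0 with
    | true => rw [hd] at h; exact ⟨[], M, us, rfl, h⟩
    | false =>
      rw [hd] at h
      obtain ⟨l1, M', l2, h1, h2⟩ := ih _ _ h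
      exact ⟨M :: l1, M', l2, by simp [h1], h2⟩

/-- A solution of the search problem in the given state. -/
def Sol (C : List ℕ) (len : ℕ → ℕ) (us : List ℕ) (FL R : ℕ) : Prop :=
  ∃ (fl : ℕ → ℕ) (hx : List ((ℕ → ℕ) × ℕ)),
    FL = lanes C fl ∧ us = hx.map (fun p => lanes C p.1) ∧
    (∀ c ∈ C, fl c + R < 32768) ∧ (∀ p ∈ hx, ∀ c ∈ C, p.1 c ≤ 1) ∧
    (∀ p ∈ hx, Even p.2) ∧ (hx.map (fun p => p.2)).sum = R ∧
    ∀ c ∈ C, len c = fl c + (hx.map (fun p => p.2 * p.1 c)).sum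

def andF (hx : List ((ℕ → ℕ) × ℕ)) (c : ℕ) : ℕ := hx.foldr (fun p r => p.1 c &&& r) 1
def orF (hx : List ((ℕ → ℕ) × ℕ)) (c : ℕ) : ℕ := hx.foldr (fun p r => p.1 c ||| r) 0

theorem andF_le (hx : List ((ℕ → ℕ) × ℕ)) (c : ℕ) : andF hx c ≤ 1 := by
  induction hx with
  | nil => simp [andF]
  | cons p hx ih => exact le_trans Nat.and_le_right ih

theorem landL_eq (C : List ℕ) (hx : List ((ℕ → ℕ) × ℕ)) (h : ∀ p ∈ hx, ∀ c ∈ C, p.1 c ≤ 1) :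
    landL (lanes C fun _ => 1) (hx.map (fun p => lanes C p.1)) = lanes C (andF hx) := by
  induction hx with
  | nil => rfl
  | cons p hx ih =>
    show lanes C p.1 &&& landL (lanes C fun _ => 1) (hx.map (fun p => lanes C p.1)) = _
    rw [ih (fun q hq => h q (by simp [hq])), lanes_land]
    · rfl
    · intro c hc; have := h p (by simp) c hc; omega
    · intro c hc; have := andF_le hx c; omega

theorem orF_le (C : List ℕ) (hx : List ((ℕ → ℕ) × ℕ)) (h : ∀ p ∈ hx, ∀ c ∈ C, p.1 c ≤ 1)
    (c : ℕ) (hc : c ∈ C) : orF hx c ≤ 1 := by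
  induction hx with
  | nil => simp [orF]
  | cons p hx ih =>
    have h1 := ih (fun q hq => h q (by simp [hq]))
    have h2 := h p (by simp) c hc
    show p.1 c ||| orF hx c ≤ 1
    generalize p.1 c = a at *
    generalize orF hx c = b at *
    interval_cases a <;> interval_cases b <;> simp

theorem lorL_eq (C : List ℕ) (hx : List ((ℕ → ℕ) × ℕ)) (h : ∀ p ∈ hx, ∀ c ∈ C, p.1 c ≤ 1) :
    lorL (hx.map (fun p => lanes C p.1)) = lanes C (orF hx) := by
  induction hx with
  | nil =>
    show 0 = _
    rw [← Nat.zero_mul (lanes C (orF [])), lanes_mul]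
    exact lanes_congr (fun c _ => by simp [orF])
  | cons p hx ih =>
    show lanes C p.1 ||| lorL (hx.map (fun p => lanes C p.1)) = _
    rw [ih (fun q hq => h q (by simp [hq])), lanes_lor]
    · rfl
    · intro c hc; have := h p (by simp) c hc; omega
    · intro c hc; have := orF_le C hx (fun q hq => h q (by simp [hq])) c hc; omega

theorem and_sum (hx : List ((ℕ → ℕ) × ℕ)) (c : ℕ) :
    (hx.map (fun p => p.2)).sum * andF hx c ≤ (hx.map (fun p => p.2 * p.1 c)).sum := by
  induction hx with
  | nil => simp
  | cons p hx ih =>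
    simp only [List.map_cons, List.sum_cons]
    have h1 : andF (p :: hx) c ≤ p.1 c := Nat.and_le_left
    have h2 : andF (p :: hx) c ≤ andF hx c := Nat.and_le_right
    calc _ = p.2 * andF (p :: hx) c + (hx.map (fun p => p.2)).sum * andF (p :: hx) c := by ring
      _ ≤ _ := add_le_add (Nat.mul_le_mul_left _ h1) (le_trans (Nat.mul_le_mul_left _ h2) ih)

theorem or_sum (hx : List ((ℕ → ℕ) × ℕ)) (c : ℕ) :
    (hx.map (fun p => p.2 * p.1 c)).sum ≤ (hx.map (fun p => p.2)).sum * orF hx c := by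
  induction hx with
  | nil => simp
  | cons p hx ih =>
    simp only [List.map_cons, List.sum_cons]
    have h1 : p.1 c ≤ orF (p :: hx) c := Nat.left_le_or
    have h2 : orF hx c ≤ orF (p :: hx) c := Nat.right_le_or
    calc _ ≤ p.2 * orF (p :: hx) c + (hx.map (fun p => p.2)).sum * orF (p :: hx) c :=
        add_le_add (Nat.mul_le_mul_left _ h1) (le_trans ih (Nat.mul_le_mul_left _ h2))
      _ = _ := by ring

theorem low_sound {C : List ℕ} {len : ℕ → ℕ} {n : ℕ}
    (hlen : ∀ L, 2 ≤ L → L ≤ n → Even L → L + C.countP (fun c => decide (L + 1 ≤ len c)) = n)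
    (hn : n < 32768) (hC : C.length < 32768) {us : List ℕ} {FL R L : ℕ} (hL : Even L)
    (h : lowT n (lanes C fun _ => 1) L (FL + R * landL (lanes C fun _ => 1) us) = true) :
    ¬ Sol C len us FL R := by
  rintro ⟨fl, hx, rfl, rfl, hb, h1, -, hR, hl⟩
  rw [landL_eq C hx h1, lanes_mul, lanes_add] at h
  change (bif Nat.ble 2 L then bif Nat.ble L n then
    Nat.ble (n + 1) (L + cGE _ _ (L + 1)) else false else false) = true at h
  simp only [Bool.cond_false_right, Bool.and_eq_true,
    Nat.ble_eq] at h
  obtain ⟨h2, h3, h4⟩ := h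
  rw [cGE_eq] at h4
  · have := hlen L h2 h3 hL
    have h5 : C.countP (fun c => decide (L + 1 ≤ fl c + R * andF hx c)) ≤
        C.countP (fun c => decide (L + 1 ≤ len c)) := by
      apply List.countP_mono_left
      intro c hc h
      have := and_sum hx c
      rw [hR] at this
      have := hl c hc
      simp only [decide_eq_true_eq] at *
      omega
    omega
  · intro c hc
    have := hb c hc
    have := andF_le hx c
    have : R * andF hx c ≤ R * 1 := Nat.mul_le_mul_left _ this
    omega
  · omega
  · omega
  · omega

theorem high_sound {C : List ℕ} {len : ℕ → ℕ} {n : ℕ}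
    (hlen : ∀ L, 2 ≤ L → L ≤ n → Even L → L + C.countP (fun c => decide (L + 1 ≤ len c)) = n)
    (hn : n < 32768) (hC : C.length < 32768) {us : List ℕ} {FL R L : ℕ} (hL : Even L)
    (h : highT n (lanes C fun _ => 1) L (FL + R * lorL us) = true) :
    ¬ Sol C len us FL R := by
  rintro ⟨fl, hx, rfl, rfl, hb, h1, -, hR, hl⟩
  rw [lorL_eq C hx h1, lanes_mul, lanes_add] at h
  change (bif Nat.ble 2 L then bif Nat.ble L n then
    Nat.ble (L + cGE _ _ (L + 1) + 1) n else false else false) = true at h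
  simp only [Bool.cond_false_right, Bool.and_eq_true,
    Nat.ble_eq] at h
  obtain ⟨h2, h3, h4⟩ := h
  rw [cGE_eq] at h4
  · have := hlen L h2 h3 hL
    have h5 : C.countP (fun c => decide (L + 1 ≤ len c)) ≤
        C.countP (fun c => decide (L + 1 ≤ fl c + R * orF hx c)) := by
      apply List.countP_mono_left
      intro c hc h
      have := or_sum hx c
      rw [hR] at this
      have := hl c hc
      simp only [decide_eq_true_eq] at *
      omega
    omega
  · intro c hc
    have := hb c hc
    have := orF_le C hx h1 c hc
    have : R * orF hx c ≤ R * 1 := Nat.mul_le_mul_left _ this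
    omega
  · omega
  · omega
  · omega

theorem chk_sound {C : List ℕ} {len : ℕ → ℕ} {n : ℕ}
    (hlen : ∀ L, 2 ≤ L → L ≤ n → Even L → L + C.countP (fun c => decide (L + 1 ≤ len c)) = n)
    (hn : n < 32768) (hC : C.length < 32768) (fuel : ℕ) : ∀ (us : List ℕ) (FL R c : ℕ) (K : ℕ → Bool),
    chk n (lanes C fun _ => 1) fuel us FL R c K = true →
    ¬ Sol C len us FL R ∧ ∃ c', K c' = true := by
  induction fuel with
  | zero => intro us FL R c K h; exact absurd h (by simp [chk])
  | succ fuel ih =>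
    intro us FL R c K h
    change (force (c % 128) fun d => force (c / 128) fun c' =>
      bif Nat.ble 64 d then
        bif highT n (lanes C fun _ => 1) (2 * (d - 64)) (FL + R * lorL us) then K c' else false
      else bif Nat.ble 16 d then
        bif lowT n (lanes C fun _ => 1) (2 * (d - 16)) (FL + R * landL (lanes C fun _ => 1) us)
        then K c' else false
      else pick us d fun M us' => chk n (lanes C fun _ => 1) fuel us' FL R c' fun c'' =>
        bif Nat.ble 2 R then
          force (FL + 2 * M) fun FL' =>
          force (R - 2) fun R' => chk n (lanes C fun _ => 1) fuel us FL' R' c'' K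
        else K c'') = true at h
    rw [force_eq, force_eq] at h
    generalize c % 128 = d at h
    generalize c / 128 = c' at h
    cases h1 : Nat.ble 64 d with
    | true =>
      rw [h1, cond_true] at h
      cases h2 : highT n (lanes C fun _ => 1) (2 * (d - 64)) (FL + R * lorL us) with
      | true => rw [h2] at h; exact ⟨high_sound hlen hn hC (even_two_mul _) h2, c', h⟩
      | false => rw [h2] at h; exact absurd h (by simp)
    | false =>
    rw [h1, cond_false] at h
    cases h1 : Nat.ble 16 d with
    | true =>
      rw [h1, cond_true] at h
      cases h2 : lowT n (lanes C fun _ => 1) (2 * (d - 16))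
        (FL + R * landL (lanes C fun _ => 1) us) with
      | true => rw [h2] at h; exact ⟨low_sound hlen hn hC (even_two_mul _) h2, c', h⟩
      | false => rw [h2] at h; exact absurd h (by simp)
    | false =>
    rw [h1, cond_false] at h
    obtain ⟨l1, M, l2, rfl, h⟩ := pick_sound _ _ _ h
    obtain ⟨hs1, c'', h⟩ := ih _ _ _ _ _ h
    have key : Sol C len (l1 ++ M :: l2) FL R →
        2 ≤ R ∧ Sol C len (l1 ++ M :: l2) (FL + 2 * M) (R - 2) := by
      rintro ⟨fl, hx, rfl, hus, hb, h1, hev, hR, hl⟩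
      obtain ⟨a1, a2, rfl, rfl, ha2⟩ := List.append_eq_map_iff.1 hus
      obtain ⟨p, b2, rfl, rfl, rfl⟩ := List.map_eq_cons_iff.1 ha2
      have hp := hev p (by simp)
      rcases Nat.eq_zero_or_pos p.2 with h0 | h0
      · exfalso
        apply hs1
        refine ⟨fl, a1 ++ b2, rfl, by simp, hb, ?_, ?_, ?_, ?_⟩
        · intro q hq; apply h1; simp at hq ⊢; tauto
        · intro q hq; apply hev; simp at hq ⊢; tauto
        · simpa [h0] using hR
        · intro c hc; simpa [h0] using hl c hc
      · have h2 : 2 ≤ p.2 := by obtain ⟨k, hk⟩ := hp; omega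
        simp at hR
        refine ⟨by omega, fun c => fl c + 2 * p.1 c, a1 ++ (p.1, p.2 - 2) :: b2, ?_, by simp, ?_,
          ?_, ?_, ?_, ?_⟩
        · rw [lanes_mul, lanes_add]
        · intro c hc
          have := h1 p (by simp) c hc
          have := hb c hc
          show fl c + 2 * p.1 c + (R - 2) < 32768
          omega
        · intro q hq
          simp at hq
          rcases hq with hq | rfl | hq
          · exact h1 q (by simp [hq])
          · exact h1 p (by simp)
          · exact h1 q (by simp [hq])
        · intro q hq
          simp at hq
          rcases hq with hq | rfl | hq
          · exact hev q (by simp [hq])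
          · obtain ⟨k, hk⟩ := hp; exact ⟨k - 1, by simp only; omega⟩
          · exact hev q (by simp [hq])
        · simp; omega
        · intro c hc
          rw [hl c hc]
          have : p.2 * p.1 c = (p.2 - 2) * p.1 c + 2 * p.1 c := by
            rw [← add_mul]; congr 1; omega
          simp
          omega
    cases h3 : Nat.ble 2 R with
    | false =>
      rw [h3] at h
      refine ⟨fun hs => ?_, c'', h⟩
      have := (key hs).1
      rw [← Nat.ble_eq, h3] at this
      exact absurd this (by simp)
    | true =>
      rw [h3, cond_true, force_eq, force_eq] at h
      obtain ⟨h4, h5⟩ := ih _ _ _ _ _ h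
      exact ⟨fun hs => h4 (key hs).2, h5⟩
end BP

namespace BP

theorem xorApp_eq (g : ℕ) (l r : List ℕ) : xorApp g l r = l.map (fun a => g ^^^ a) ++ r := by
  induction l with
  | nil => rfl
  | cons a l ih =>
    show (g ^^^ a) :: xorApp g l r = _
    rw [ih]; rfl

theorem mem_spanL_cons (g : ℕ) (gs : List ℕ) (e : ℕ) :
    e ∈ spanL (g :: gs) ↔ e ∈ spanL gs ∨ g ^^^ e ∈ spanL gs := by
  change e ∈ xorApp g (spanL gs) (spanL gs) ↔ _
  rw [xorApp_eq]
  simp only [List.mem_append, List.mem_map]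
  constructor
  · rintro (⟨a, ha, rfl⟩ | h)
    · right; simpa using ha
    · left; exact h
  · rintro (h | h)
    · right; exact h
    · left; exact ⟨_, h, by simp⟩

theorem nodup_spanL_cons (g : ℕ) (gs : List ℕ) (b : ℕ) (hg : g.testBit b = true)
    (h0 : ∀ e ∈ spanL gs, e.testBit b = false) (hn : (spanL gs).Nodup) :
    (spanL (g :: gs)).Nodup := by
  change (xorApp g (spanL gs) (spanL gs)).Nodup
  rw [xorApp_eq, List.nodup_append]
  refine ⟨hn.map ?_, hn, ?_⟩
  · intro x y hxy
    simpa using congrArg (fun z => g ^^^ z) hxy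
  · intro x hx y hy hxy
    obtain ⟨a, ha, rfl⟩ := List.mem_map.1 hx
    have h1 := h0 _ hy
    rw [← hxy, Nat.testBit_xor, hg, h0 a ha] at h1
    exact absurd h1 (by simp)

/-- parity contributed to the gap `i` by the chosen chords -/
def par (D : List (ℕ × ℕ)) (e i : ℕ) : ℕ → Bool :=
  match D with
  | [] => fun _ => false
  | p :: D => fun k => (e.testBit k && (decide (p.1 ≤ i) && decide (i < p.2))) ^^ par D e i (k + 1)

theorem par_congr (D : List (ℕ × ℕ)) (e e' i : ℕ) : ∀ k, (∀ j, k ≤ j → e.testBit j = e'.testBit j) →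
    par D e i k = par D e' i k := by
  induction D with
  | nil => intro k _; rfl
  | cons p D ih =>
    intro k h
    show (_ ^^ par D e i (k + 1)) = (_ ^^ par D e' i (k + 1))
    rw [ih (k + 1) (fun j hj => h j (by omega)), h k le_rfl]

theorem par_false (D : List (ℕ × ℕ)) (e i : ℕ) (h : ∀ p ∈ D, p.2 ≤ i) : ∀ k,
    par D e i k = false := by
  induction D with
  | nil => intro k; rfl
  | cons p D ih =>
    intro k
    show (_ ^^ par D e i (k + 1)) = false
    rw [ih (fun q hq => h q (by simp [hq]))]
    have := h p (by simp)
    simp; intros; omega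

def ivl (p : ℕ × ℕ) : ℕ := (2 ^ p.2 - 1) ^^^ (2 ^ p.1 - 1)

theorem testBit_ivl (p : ℕ × ℕ) (hp : p.1 < p.2) (i : ℕ) :
    (ivl p).testBit i = (decide (p.1 ≤ i) && decide (i < p.2)) := by
  unfold ivl
  rw [Nat.testBit_xor, Nat.testBit_two_pow_sub_one, Nat.testBit_two_pow_sub_one]
  by_cases h1 : i < p.2 <;> by_cases h2 : i < p.1 <;> simp [h1, h2] <;> omega

theorem gens_spec (D : List (ℕ × ℕ)) : ∀ k, (∀ p ∈ D, p.1 < p.2 ∧ p.2 ≤ k) →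
    (∀ e, e ∈ spanL (gensAux D k) ↔
      e < 2 ^ (k + D.length) ∧ ∀ i < k, e.testBit i = par D e i k) ∧
    (spanL (gensAux D k)).Nodup := by
  induction D with
  | nil =>
    intro k _
    refine ⟨fun e => ?_, by show [0].Nodup; simp⟩
    show e ∈ [0] ↔ _
    simp only [List.mem_singleton, List.length_nil, add_zero]
    constructor
    · rintro rfl
      exact ⟨by positivity, fun i _ => by simp [par]⟩
    · rintro ⟨h1, h2⟩
      apply Nat.eq_of_testBit_eq
      intro i
      rw [Nat.zero_testBit]
      by_cases hi : i < k
      · rw [h2 i hi]; rfl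
      · exact Nat.testBit_lt_two_pow (lt_of_lt_of_le h1 (Nat.pow_le_pow_right (by norm_num) (by omega)))
  | cons p D ih =>
    intro k h
    obtain ⟨ih1, ih2⟩ := ih (k + 1) (fun q hq => ⟨(h q (by simp [hq])).1,
      Nat.le_succ_of_le (h q (by simp [hq])).2⟩)
    obtain ⟨hp1, hp2⟩ := h p (by simp)
    have hgen : gensAux (p :: D) k = (ivl p ^^^ 2 ^ k) :: gensAux D (k + 1) := rfl
    set g := ivl p ^^^ 2 ^ k with hg
    have hgbit : ∀ i, g.testBit i = ((decide (p.1 ≤ i) && decide (i < p.2)) ^^ decide (i = k)) := by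
      intro i
      rw [hg, Nat.testBit_xor, testBit_ivl p hp1, Nat.testBit_two_pow]
      simp [eq_comm]
    have hgk : g.testBit k = true := by
      rw [hgbit]; simp; omega
    have hghi : ∀ i, k < i → g.testBit i = false := by
      intro i hi
      rw [hgbit]
      have h1 : ¬ i < p.2 := by omega
      have h2 : ¬ i = k := by omega
      simp [h1, h2]
    have hglt : g < 2 ^ (k + 1 + D.length) := by
      apply Nat.lt_pow_two_of_testBit
      intro i hi
      exact hghi i (by omega)
    have hparF : ∀ e, par D e k (k + 1) = false := fun e =>
      par_false D e k (fun q hq => (h q (by simp [hq])).2) _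
    have hpc : ∀ e i, par D (g ^^^ e) i (k + 1) = par D e i (k + 1) := by
      intro e i
      apply par_congr
      intro j hj
      rw [Nat.testBit_xor, hghi j (by omega)]; simp
    have hz : ∀ e ∈ spanL (gensAux D (k + 1)), e.testBit k = false := by
      intro e he
      rw [((ih1 e).1 he).2 k (by omega), hparF]
    rw [hgen]
    refine ⟨fun e => ?_, nodup_spanL_cons _ _ k hgk hz ih2⟩
    rw [mem_spanL_cons, ih1, ih1, List.length_cons, show k + (D.length + 1) = k + 1 + D.length by ring]
    have hlt : g ^^^ e < 2 ^ (k + 1 + D.length) ↔ e < 2 ^ (k + 1 + D.length) := by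
      constructor
      · intro h
        have := Nat.xor_lt_two_pow hglt h
        simpa using this
      · exact fun h => Nat.xor_lt_two_pow hglt h
    rw [hlt, ← and_or_left]
    apply and_congr_right
    intro _
    simp only [hpc]
    show _ ↔ ∀ i < k, e.testBit i = ((e.testBit k && (decide (p.1 ≤ i) && decide (i < p.2))) ^^ par D e i (k + 1))
    cases hk : e.testBit k with
    | false =>
      constructor
      · rintro (h1 | h1)
        · intro i hi; rw [h1 i (by omega)]; simp
        · have := h1 k (by omega)
          rw [Nat.testBit_xor, hgk, hk, hparF] at this
          exact absurd this (by simp)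
      · intro h1
        left
        intro i hi
        rcases Nat.lt_succ_iff_lt_or_eq.1 hi with hi | rfl
        · rw [h1 i hi]; simp
        · rw [hk, hparF]
    | true =>
      constructor
      · rintro (h1 | h1)
        · have := h1 k (by omega)
          rw [hk, hparF] at this
          exact absurd this (by simp)
        · intro i hi
          have h2 := h1 i (by omega)
          rw [Nat.testBit_xor, hgbit] at h2
          have h3 : ¬ i = k := by omega
          rw [← h2]; simp [h3]
      · intro h1
        right
        intro i hi
        rw [Nat.testBit_xor]
        rcases Nat.lt_succ_iff_lt_or_eq.1 hi with hi | rfl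
        · rw [h1 i hi, hgbit]
          have h3 : ¬ i = k := by omega
          simp [h3]
        · rw [hk, hparF, hgk]; rfl

theorem code_spec (w : ℕ) (D : List (ℕ × ℕ)) (hw : 1 ≤ w) (h : ∀ p ∈ D, p.1 < p.2 ∧ p.2 < w) :
    (∀ e, e ∈ code w D ↔ e < 2 ^ (w + D.length) ∧
      ∃ t : Bool, ∀ i < w, e.testBit i = (t ^^ par D e i w)) ∧ (code w D).Nodup := by
  obtain ⟨h1, h2⟩ := gens_spec D w (fun p hp => ⟨(h p hp).1, (h p hp).2.le⟩)
  have hc : code w D = spanL ((2 ^ w - 1) :: gensAux D w) := rfl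
  set g := 2 ^ w - 1 with hg
  have hgb : ∀ i, g.testBit i = decide (i < w) := fun i => by
    rw [hg, Nat.testBit_two_pow_sub_one]
  have hpf : ∀ e, par D e (w - 1) w = false := fun e =>
    par_false D e _ (fun q hq => by have := (h q hq).2; omega) _
  constructor
  · intro e
    rw [hc, mem_spanL_cons, h1, h1]
    have hglt : g < 2 ^ (w + D.length) := by
      apply Nat.lt_pow_two_of_testBit
      intro i hi
      rw [hgb]; simp; omega
    have hlt : g ^^^ e < 2 ^ (w + D.length) ↔ e < 2 ^ (w + D.length) := by
      constructor
      · intro h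
        have := Nat.xor_lt_two_pow hglt h
        simpa using this
      · exact fun h => Nat.xor_lt_two_pow hglt h
    rw [hlt, ← and_or_left]
    apply and_congr_right
    intro _
    have hpc : ∀ i, par D (g ^^^ e) i w = par D e i w := by
      intro i
      apply par_congr
      intro j hj
      rw [Nat.testBit_xor, hgb]; have hjw : ¬ j < w := by omega
      simp [hjw]
    simp only [hpc, Nat.testBit_xor, hgb]
    constructor
    · rintro (h | h)
      · exact ⟨false, fun i hi => by rw [h i hi]; simp⟩
      · refine ⟨true, fun i hi => ?_⟩
        have := h i hi
        rw [← this]; simp [hi]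
    · rintro ⟨t, h⟩
      cases t with
      | false => left; intro i hi; rw [h i hi]; simp
      | true => right; intro i hi; rw [h i hi]; simp [hi]
  · rw [hc]
    apply nodup_spanL_cons _ _ (w - 1) _ _ h2
    · rw [hgb]; simp; omega
    · intro e he
      rw [((h1 e).1 he).2 _ (by omega), hpf]

theorem minsOf_eq (C : List ℕ) (one A len : ℕ) : minsOf C one A len = C.filter (fun c =>
    Nat.beq (cGE one (A &&& (one * (32767 ^^^ c))) 1 + 2) len) := by
  induction C with
  | nil => rfl
  | cons a C ih =>
    rw [List.filter_cons, ← ih]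
    change (bif Nat.beq (cGE one (A &&& (one * (32767 ^^^ a))) 1 + 2) len then
      a :: minsOf C one A len else minsOf C one A len) = _
    rw [Bool.cond_eq_ite]

theorem land_compl (a c : ℕ) (ha : a < 2 ^ 15) :
    a &&& (32767 ^^^ c) = 0 ↔ a &&& c = a := by
  have h15 : ∀ i, (32767 : ℕ).testBit i = decide (i < 15) := fun i => by
    rw [← Nat.testBit_two_pow_sub_one]
  constructor
  · intro h
    apply Nat.eq_of_testBit_eq
    intro i
    have h1 := congrArg (fun z => z.testBit i) h
    simp only [Nat.testBit_and, Nat.testBit_xor, h15, Nat.zero_testBit] at h1 ⊢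
    by_cases hi : i < 15
    · simp only [hi, decide_true] at h1
      cases h2 : a.testBit i <;> cases h3 : c.testBit i <;> simp_all
    · rw [Nat.testBit_lt_two_pow (lt_of_lt_of_le ha (Nat.pow_le_pow_right (by norm_num) (by omega)))]
      simp
  · intro h
    apply Nat.eq_of_testBit_eq
    intro i
    have h1 := congrArg (fun z => z.testBit i) h
    simp only [Nat.testBit_and, Nat.testBit_xor, h15, Nat.zero_testBit] at h1 ⊢
    by_cases hi : i < 15
    · cases h2 : a.testBit i <;> cases h3 : c.testBit i <;> simp_all
    · rw [Nat.testBit_lt_two_pow (lt_of_lt_of_le ha (Nat.pow_le_pow_right (by norm_num) (by omega)))]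
      simp

theorem xorApp_length (g : ℕ) (l r : List ℕ) : (xorApp g l r).length = l.length + r.length := by
  rw [xorApp_eq]; simp

theorem spanL_length (gs : List ℕ) : (spanL gs).length = 2 ^ gs.length := by
  induction gs with
  | nil => rfl
  | cons g gs ih =>
    show (xorApp g (spanL gs) (spanL gs)).length = _
    rw [xorApp_length, ih, List.length_cons, pow_succ]; ring

theorem gensAux_length (D : List (ℕ × ℕ)) : ∀ k, (gensAux D k).length = D.length := by
  induction D with
  | nil => intro k; rfl
  | cons p D ih => intro k; show (gensAux D (k+1)).length + 1 = _; rw [ih]; rfl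

theorem code_length (w : ℕ) (D : List (ℕ × ℕ)) : (code w D).length = 2 ^ (D.length + 1) := by
  show (spanL ((2 ^ w - 1) :: gensAux D w)).length = _
  rw [spanL_length, List.length_cons, gensAux_length]

theorem mins_spec (w : ℕ) (D : List (ℕ × ℕ)) (hw : 1 ≤ w) (h : ∀ p ∈ D, p.1 < p.2 ∧ p.2 < w)
    (hwD : w + D.length ≤ 15) :
    mins w D = (code w D).filter (fun c =>
      decide ((code w D).countP (fun a => decide (a &&& c = a)) = 2)) := by
  have hlt : ∀ c ∈ code w D, c < 2 ^ 15 := fun c hc =>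
    lt_of_lt_of_le (((code_spec w D hw h).1 c).1 hc).1 (Nat.pow_le_pow_right (by norm_num) hwD)
  have hlen : (code w D).length < 65535 := by
    rw [code_length]
    calc 2 ^ (D.length + 1) ≤ 2 ^ 15 := Nat.pow_le_pow_right (by norm_num) (by omega)
      _ < _ := by norm_num
  have h0 : mins w D = minsOf (code w D) (ones (lenL (code w D))) (pack (code w D))
    (lenL (code w D)) := rfl
  rw [h0, minsOf_eq, lenL_eq, ones_eq]
  apply List.filter_congr
  intro c hc
  have hx : 32767 ^^^ c < 2 ^ 15 := Nat.xor_lt_two_pow (by norm_num) (hlt c hc)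
  rw [mul_comm, lanes_mul, ← lanes_id, lanes_land, cGE_eq]
  · have h1 : (code w D).countP (fun a => decide (1 ≤ a &&& (32767 ^^^ c) * 1)) =
        (code w D).countP (fun a => decide ¬ (decide (a &&& c = a) = true)) := by
      apply List.countP_congr
      intro a ha
      rw [mul_one]
      have := land_compl a c (hlt a ha)
      simp only [decide_eq_true_eq, Nat.one_le_iff_ne_zero, ne_eq, this]
    rw [h1]
    have h2 := List.length_eq_countP_add_countP (l := code w D) (fun a => decide (a &&& c = a))
    rw [Bool.eq_iff_iff, Nat.beq_eq, decide_eq_true_eq]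
    omega
  · intro a ha
    exact lt_of_le_of_lt Nat.and_le_left (lt_of_lt_of_le (hlt a ha) (by norm_num))
  · norm_num
  · norm_num
  · exact hlen
  · exact fun a ha => lt_of_lt_of_le (hlt a ha) (by norm_num)
  · intro a ha
    rw [mul_one]
    exact lt_of_lt_of_le hx (by norm_num)

end BP

namespace BP

theorem bitN_eq (c i : ℕ) : bitN c i = c / 2 ^ i % 2 := rfl

theorem bitN_le (c i : ℕ) : bitN c i ≤ 1 := by
  rw [bitN_eq]; omega

theorem bitN_testBit (c i : ℕ) : bitN c i = if c.testBit i then 1 else 0 := by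
  rw [bitN_eq, Nat.testBit_eq_decide_div_mod_eq]
  rcases Nat.mod_two_eq_zero_or_one (c / 2 ^ i) with h | h <;> simp [h]

theorem addLo_eq (lo f : ℕ → ℕ) (k : ℕ) : ∀ (i FL S : ℕ) (K : ℕ → ℕ → Bool),
    addLo lo ((List.range' i k).map f) i FL S K =
    K (FL + ((List.range' i k).map (fun j => lo j * f j)).sum)
      (S + ((List.range' i k).map lo).sum) := by
  induction k with
  | zero => intro i FL S K; rfl
  | succ k ih =>
    intro i FL S K
    change (force (lo i) fun l => force (FL + l * f i) fun FL' =>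
      force (S + l) fun S' => addLo lo ((List.range' (i + 1) k).map f) (i + 1) FL' S' K) = _
    rw [force_eq, force_eq, force_eq, ih]
    simp only [List.range'_succ, List.map_cons, List.sum_cons, add_assoc]

theorem lanesL_eq (one A k : ℕ) : ∀ i, lanesL one A k i = (List.range' i k).map (bitLanes one A) := by
  induction k with
  | zero => intro i; rfl
  | succ k ih =>
    intro i
    change (force (bitLanes one A i) fun x => x :: lanesL one A k (i + 1)) = _
    rw [force_eq, ih]; rfl

theorem lanesS_eq (one A k : ℕ) : ∀ i, lanesS one A k i =
    ((List.range' i k).map (bitLanes one A)).sum := by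
  induction k with
  | zero => intro i; rfl
  | succ k ih =>
    intro i
    change bitLanes one A i + lanesS one A k (i + 1) = _
    rw [ih]; rfl

theorem lanes_sum (C : List ℕ) (l : List ℕ) (f : ℕ → ℕ → ℕ) :
    (l.map (fun j => lanes C (f j))).sum = lanes C (fun c => (l.map (fun j => f j c)).sum) := by
  induction l with
  | nil =>
    show 0 = _
    rw [← Nat.zero_mul (lanes C (fun _ => 0)), lanes_mul]
    exact lanes_congr (fun c _ => by simp)
  | cons a l ih =>
    simp only [List.map_cons, List.sum_cons]
    rw [ih, lanes_add]

theorem okc_true (D : List (ℕ × ℕ)) (c i : ℕ) (h : ∀ p ∈ D, p.2 = i → bitN c p.1 ≠ bitN c i) :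
    okc D c i = true := by
  induction D with
  | nil => rfl
  | cons p D ih =>
    change (bif Nat.beq p.2 i then
      (bif Nat.beq (bitN c p.1) (bitN c i) then false else okc D c i) else okc D c i) = true
    rw [ih (fun q hq => h q (by simp [hq]))]
    cases h1 : Nat.beq p.2 i with
    | false => rfl
    | true =>
      have := h p (by simp) (Nat.beq_eq.mp h1)
      cases h2 : Nat.beq (bitN c p.1) (bitN c i) with
      | false => rfl
      | true => exact absurd (Nat.beq_eq.mp h2) this

theorem chkCols_succ (F : ℕ → ℕ → (ℕ → Bool) → Bool) (D : List (ℕ × ℕ)) (k i c cert : ℕ)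
    (K : ℕ → Bool) : chkCols F D (k + 1) i c cert K =
    (fun K' => bif okc D c i then chkCols F D k (i + 1) c cert K' else K' cert) fun cert' =>
      bif okc D (c + 2 ^ i) i then chkCols F D k (i + 1) (c + 2 ^ i) cert' K else K cert' := by
  change ((fun K' => bif okc D c i then chkCols F D k (i + 1) c cert K' else K' cert) fun cert' =>
      force (c + 2 ^ i) fun c' =>
      bif okc D c' i then chkCols F D k (i + 1) c' cert' K else K cert') = _
  simp only [force_eq]

theorem chkCols_pass (F : ℕ → ℕ → (ℕ → Bool) → Bool) (D : List (ℕ × ℕ))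
    (hF : ∀ c cert K, F c cert K = true → ∃ c', K c' = true) (k : ℕ) :
    ∀ i c cert K, chkCols F D k i c cert K = true → ∃ c', K c' = true := by
  induction k with
  | zero => intro i c cert K h; exact hF _ _ _ h
  | succ k ih =>
    intro i c cert K h
    rw [chkCols_succ] at h
    have h1 : ∃ cert', (bif okc D (c + 2 ^ i) i then chkCols F D k (i + 1) (c + 2 ^ i) cert' K
        else K cert') = true := by
      cases h2 : okc D c i with
      | true => simp only [h2] at h; exact ih _ _ _ _ h
      | false => simp only [h2] at h; exact ⟨_, h⟩
    obtain ⟨cert', h1⟩ := h1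
    cases h2 : okc D (c + 2 ^ i) i with
    | true => rw [h2] at h1; exact ih _ _ _ _ h1
    | false => rw [h2] at h1; exact ⟨_, h1⟩

theorem bitN_add (c i j : ℕ) (hc : c < 2 ^ i) :
    bitN (c + 2 ^ i) j = if j = i then 1 else if j < i then bitN c j else 0 := by
  rw [bitN_testBit, bitN_testBit]
  have : c + 2 ^ i = 2 ^ i ||| c := by
    rw [add_comm]
    have := Nat.two_pow_add_eq_or_of_lt hc 1
    simpa using this
  rw [this, Nat.testBit_or, Nat.testBit_two_pow]
  by_cases h1 : j = i
  · simp [h1]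
  · by_cases h2 : j < i
    · have h3 : ¬ i = j := fun h => h1 h.symm
      simp [h1, h2, h3]
    · have h3 : ¬ i = j := fun h => h1 h.symm
      have : c.testBit j = false := Nat.testBit_lt_two_pow
        (lt_of_lt_of_le hc (Nat.pow_le_pow_right (by norm_num) (by omega)))
      simp [h1, h2, h3, this]

theorem chkCols_hit (F : ℕ → ℕ → (ℕ → Bool) → Bool) (D : List (ℕ × ℕ))
    (hF : ∀ c cert K, F c cert K = true → ∃ c', K c' = true) (col : ℕ → ℕ)
    (hcol : ∀ i, col i ≤ 1) (hD : ∀ p ∈ D, p.1 < p.2 ∧ col p.1 ≠ col p.2) (k : ℕ) :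
    ∀ i c cert K, c < 2 ^ i → (∀ j < i, bitN c j = col j) → chkCols F D k i c cert K = true →
    ∃ c' cert' K', (∀ j < i + k, bitN c' j = col j) ∧ F c' cert' K' = true := by
  induction k with
  | zero => intro i c cert K hc hb h; exact ⟨c, cert, K, hb, h⟩
  | succ k ih =>
    intro i c cert K hc hb h
    rw [chkCols_succ] at h
    have hok : ∀ c', (∀ j < i + 1, bitN c' j = col j) → okc D c' i = true := by
      intro c' hc'
      apply okc_true
      intro p hp hpi
      have := hD p hp
      rw [hc' _ (by omega), hc' i (by omega), ← hpi]
      exact this.2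
    have hc1 : c < 2 ^ (i + 1) := lt_of_lt_of_le hc (Nat.pow_le_pow_right (by norm_num) (by omega))
    have hi := hcol i
    have : col i = 0 ∨ col i = 1 := by omega
    rcases this with h0 | h0
    · have h1 : ∀ j < i + 1, bitN c j = col j := by
        intro j hj
        rcases Nat.lt_succ_iff_lt_or_eq.1 hj with hj | rfl
        · exact hb j hj
        · rw [h0, bitN_testBit, Nat.testBit_lt_two_pow hc]; rfl
      simp only [hok c h1, cond_true] at h
      have := ih (i + 1) c cert _ hc1 h1 h
      rwa [show i + 1 + k = i + (k + 1) by ring] at this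
    · have h1 : ∀ j < i + 1, bitN (c + 2 ^ i) j = col j := by
        intro j hj
        rw [bitN_add c i j hc]
        rcases Nat.lt_succ_iff_lt_or_eq.1 hj with hj | rfl
        · rw [if_neg (by omega), if_pos hj]; exact hb j hj
        · rw [if_pos rfl, h0]
      have h1' : ∃ cert', (bif okc D (c + 2 ^ i) i then
          chkCols F D k (i + 1) (c + 2 ^ i) cert' K else K cert') = true := by
        cases h2 : okc D c i with
        | true => simp only [h2] at h; exact chkCols_pass F D hF k _ _ _ _ h
        | false => simp only [h2] at h; exact ⟨_, h⟩
      obtain ⟨cert', h2⟩ := h1'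
      rw [hok _ h1, cond_true] at h2
      have := ih (i + 1) (c + 2 ^ i) cert' _ (by rw [pow_succ]; omega) h1 h2
      rwa [show i + 1 + k = i + (k + 1) by ring] at this

theorem adjc_spec (w : ℕ) (D : List (ℕ × ℕ)) (i : ℕ) (h : adjc w D i = true) :
    (i, i + 1) ∈ D ∨ (0, i) ∈ D ∧ i + 1 = w := by
  induction D with
  | nil => exact absurd h (by simp [adjc])
  | cons p D ih =>
    have ih' : adjc w D i = true → (i, i + 1) ∈ p :: D ∨ (0, i) ∈ p :: D ∧ i + 1 = w := by
      intro h; have := ih h; simp only [List.mem_cons]; tauto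
    change (bif Nat.beq p.1 i then (bif Nat.beq p.2 (i + 1) then true else adjc w D i)
      else bif Nat.beq p.1 0 then
        (bif Nat.beq p.2 i then (bif Nat.beq (i + 1) w then true else adjc w D i) else adjc w D i)
      else adjc w D i) = true at h
    rcases h1 : Nat.beq p.1 i with _ | _ <;> rw [h1] at h
    · rcases h2 : Nat.beq p.1 0 with _ | _ <;> rw [h2] at h
      · exact ih' h
      · rcases h3 : Nat.beq p.2 i with _ | _ <;> rw [h3] at h
        · exact ih' h
        · rcases h4 : Nat.beq (i + 1) w with _ | _ <;> rw [h4] at h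
          · exact ih' h
          · right
            rw [Nat.beq_eq] at h2 h3 h4
            refine ⟨?_, h4⟩
            rw [← h2, ← h3]; simp
    · rcases h3 : Nat.beq p.2 (i + 1) with _ | _ <;> rw [h3] at h
      · exact ih' h
      · left
        rw [Nat.beq_eq] at h1 h3
        have : (i, i + 1) = p := by rw [← h3, ← h1]
        simp [this]

/-- positions of the points -/
def pos (g : ℕ → ℕ) (k : ℕ) : ℕ := ((List.range' 0 k).map g).sum

/-- length of a codeword -/
def wlen (w m : ℕ) (g : ℕ → ℕ) (c : ℕ) : ℕ :=
  ((List.range' 0 w).map (fun i => g i * bitN c i)).sum + ((List.range' w m).map (bitN c)).sum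

theorem pos_succ (g : ℕ → ℕ) (k : ℕ) : pos g (k + 1) = pos g k + g k := by
  simp [pos, List.range'_concat]

theorem sum_bit_le (l : List ℕ) (c : ℕ) : (l.map (bitN c)).sum ≤ l.length := by
  induction l with
  | nil => simp
  | cons a l ih =>
    simp only [List.map_cons, List.sum_cons, List.length_cons]
    have := bitN_le c a; omega

theorem sum_mul_bit_le (l : List ℕ) (f : ℕ → ℕ) (c : ℕ) :
    (l.map (fun j => f j * bitN c j)).sum ≤ (l.map f).sum := by
  induction l with
  | nil => simp
  | cons a l ih =>
    simp only [List.map_cons, List.sum_cons]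
    have := Nat.mul_le_mul_left (f a) (bitN_le c a); omega

theorem sum_split (l : List ℕ) (f g h : ℕ → ℕ) (hl : ∀ i ∈ l, f i ≤ g i) :
    (l.map (fun i => g i * h i)).sum =
      (l.map (fun i => f i * h i)).sum + (l.map (fun i => (g i - f i) * h i)).sum := by
  induction l with
  | nil => simp
  | cons a l ih =>
    simp only [List.map_cons, List.sum_cons]
    rw [ih (fun i hi => hl i (by simp [hi]))]
    have := hl a (by simp)
    have : g a * h a = f a * h a + (g a - f a) * h a := by rw [← add_mul]; congr 1; omega
    omega

theorem chkDiag_sound (w : ℕ) (D : List (ℕ × ℕ)) (cert : ℕ) (hw : 1 ≤ w)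
    (hD : ∀ p ∈ D, p.1 < p.2 ∧ p.2 < w) (hwD : w + D.length ≤ 15) (hD5 : D.length ≤ 5) (g : ℕ → ℕ) (n : ℕ)
    (hn : n = (mins w D).length + 2) (hev : Even n) (hpos : pos g w = n) (hg : ∀ i < w, 1 ≤ g i)
    (hodd : ∀ p ∈ D, pos g p.1 % 2 ≠ pos g p.2 % 2)
    (hadj : ∀ i < w, (i, i + 1) ∈ D ∨ (0, i) ∈ D ∧ i + 1 = w → g i ≠ 1)
    (hlen : ∀ L, 2 ≤ L → L ≤ n → Even L →
      L + (mins w D).countP (fun c => decide (L + 1 ≤ wlen w D.length g c)) = n)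
    (h : chkDiag w D cert = true) : False := by
  have hlt : ∀ c ∈ mins w D, c < 2 ^ 15 := by
    intro c hc
    rw [mins_spec w D hw hD hwD] at hc
    exact lt_of_lt_of_le (((code_spec w D hw hD).1 c).1 (List.mem_of_mem_filter hc)).1
      (Nat.pow_le_pow_right (by norm_num) hwD)
  have hll : (mins w D).length ≤ 2 ^ (D.length + 1) := by
    rw [mins_spec w D hw hD hwD, ← code_length w D]
    exact List.length_filter_le _ _
  have hll2 : (mins w D).length ≤ 2 ^ 14 + 2 ^ 13 := by
    exact le_trans hll (le_trans (Nat.pow_le_pow_right (by norm_num) (show D.length + 1 ≤ 14 by omega)) (by norm_num))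
  set C := mins w D with hCdef
  change (force (lenL C) fun N => force (ones N) fun one => force (pack C) fun A =>
    force (lanesS one A (lenL D) w) fun S =>
    (fun us => chkCols (chkCol (N + 2) one w D us S) D (w - 1) 1 0 cert fun _ => true)
      (lanesL one A w 0)) = true at h
  rw [force_eq, force_eq, force_eq, force_eq, lenL_eq, lenL_eq, ones_eq, ← hn] at h
  dsimp only at h
  have hus : lanesL (lanes C fun _ => 1) (pack C) w 0 =
      (List.range' 0 w).map (fun i => lanes C (fun c => bitN c i)) := by
    rw [lanesL_eq]
    apply List.map_congr_left
    intro i hi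
    rw [List.mem_range'_1] at hi
    exact bitLanes_eq C i (fun c hc => lt_of_lt_of_le (hlt c hc) (by norm_num)) (by omega)
  have hS : lanesS (lanes C fun _ => 1) (pack C) D.length w =
      lanes C (fun c => ((List.range' w D.length).map (bitN c)).sum) := by
    rw [lanesS_eq, ← lanes_sum C (List.range' w D.length) (fun i c => bitN c i)]
    congr 1
    apply List.map_congr_left
    intro i hi
    rw [List.mem_range'_1] at hi
    exact bitLanes_eq C i (fun c hc => lt_of_lt_of_le (hlt c hc) (by norm_num)) (by omega)
  rw [hus, hS] at h
  set us := (List.range' 0 w).map (fun i => lanes C (fun c => bitN c i)) with husdef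
  set S := lanes C (fun c => ((List.range' w D.length).map (bitN c)).sum) with hSdef
  have hcc : ∀ c cert K, chkCol n (lanes C fun _ => 1) w D us S c cert K =
      (bif Nat.ble (((List.range' 0 w).map (lo1 w D c)).sum) n then
        chk n (lanes C fun _ => 1) 100 us
          (S + ((List.range' 0 w).map (fun j => lo1 w D c j * lanes C (fun c => bitN c j))).sum)
          (n - ((List.range' 0 w).map (lo1 w D c)).sum) cert K else K cert) := by
    intro c cert K
    change addLo (lo1 w D c) us 0 S 0 (fun FL s =>
      bif Nat.ble s n then chk n (lanes C fun _ => 1) 100 us FL (n - s) cert K else K cert) = _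
    rw [husdef, addLo_eq]
    simp only [zero_add]
  have hchk := chk_sound (C := C) (len := wlen w D.length g) (n := n) hlen (by omega) (by omega)
  have hF : ∀ c cert K, chkCol n (lanes C fun _ => 1) w D us S c cert K = true →
      ∃ c', K c' = true := by
    intro c cert K h
    rw [hcc] at h
    cases hb : Nat.ble (((List.range' 0 w).map (lo1 w D c)).sum) n with
    | true => rw [hb, cond_true] at h; exact (hchk _ _ _ _ _ _ h).2
    | false => rw [hb] at h; exact ⟨_, h⟩
  obtain ⟨c, cert', K', hbits, hc⟩ := chkCols_hit _ D hF (fun i => pos g i % 2)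
    (fun i => by show pos g i % 2 ≤ 1; omega) (fun p hp => ⟨(hD p hp).1, hodd p hp⟩) (w - 1) 1 0 cert _
    (by norm_num) (by intro j hj; have : j = 0 := by omega
                      subst this; rfl) h
  rw [show 1 + (w - 1) = w by omega] at hbits
  have hlo : ∀ i < w, lo1 w D c i ≤ g i ∧ Even (g i - lo1 w D c i) := by
    intro i hi
    have h1 : bitN c ((i + 1) % w) = pos g (i + 1) % 2 := by
      by_cases hiw : i + 1 = w
      · rw [hiw, Nat.mod_self, hbits 0 (by omega), hpos]
        show 0 = _
        obtain ⟨k, hk⟩ := hev; omega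
      · rw [Nat.mod_eq_of_lt (by omega), hbits _ (by omega)]
    have h2 := hbits i hi
    have h3 := hg i hi
    rw [pos_succ] at h1
    have h4 : lo1 w D c i = (bif Nat.beq (bitN c i) (bitN c ((i + 1) % w)) then 2
      else bif adjc w D i then 3 else 1) := rfl
    rw [h4, h1, h2]
    cases h5 : Nat.beq (pos g i % 2) ((pos g i + g i) % 2) with
    | true =>
      rw [Nat.beq_eq] at h5
      simp only [cond_true]
      rw [Nat.even_iff]
      omega
    | false =>
      have h5 : pos g i % 2 ≠ (pos g i + g i) % 2 := fun h => by
        rw [← Nat.beq_eq, h5] at h; exact absurd h (by simp)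
      simp only [cond_false]
      rw [Nat.even_iff]
      cases h6 : adjc w D i with
      | false => simp only [cond_false]; omega
      | true =>
        have := hadj i hi (adjc_spec w D i h6)
        simp only [cond_true]; omega
  have hlo' : ∀ i ∈ List.range' 0 w, lo1 w D c i ≤ g i := by
    intro i hi
    rw [List.mem_range'_1] at hi
    exact (hlo i (by omega)).1
  have hsum := sum_split (List.range' 0 w) (lo1 w D c) g (fun _ => 1) hlo'
  simp only [mul_one] at hsum
  change ((List.range' 0 w).map g).sum = ((List.range' 0 w).map (lo1 w D c)).sum +
    ((List.range' 0 w).map (fun i => g i - lo1 w D c i)).sum at hsum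
  have hposd : pos g w = ((List.range' 0 w).map g).sum := rfl
  rw [hcc] at hc
  cases hb : Nat.ble (((List.range' 0 w).map (lo1 w D c)).sum) n with
  | false =>
    have : ((List.range' 0 w).map (lo1 w D c)).sum ≤ n := by omega
    rw [← Nat.ble_eq, hb] at this
    exact absurd this (by simp)
  | true =>
    rw [hb, cond_true] at hc
    refine (hchk _ _ _ _ _ _ hc).1 ⟨fun c' => ((List.range' w D.length).map (bitN c')).sum +
      ((List.range' 0 w).map (fun j => lo1 w D c j * bitN c' j)).sum,
      (List.range' 0 w).map (fun i => ((fun c' => bitN c' i), g i - lo1 w D c i)),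
      ?_, ?_, ?_, ?_, ?_, ?_, ?_⟩
    · rw [← lanes_add, ← lanes_sum C (List.range' 0 w) (fun j c' => lo1 w D c j * bitN c' j)]
      simp only [lanes_mul]
      rfl
    · rw [List.map_map]; rfl
    · intro c' hc'
      have h1 := sum_bit_le (List.range' w D.length) c'
      have h2 := sum_mul_bit_le (List.range' 0 w) (lo1 w D c) c'
      rw [List.length_range'] at h1
      show _ + _ + (n - ((List.range' 0 w).map (lo1 w D c)).sum) < 32768
      omega
    · intro p hp c' _
      obtain ⟨i, _, rfl⟩ := List.mem_map.1 hp
      exact bitN_le _ _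
    · intro p hp
      obtain ⟨i, hi, rfl⟩ := List.mem_map.1 hp
      rw [List.mem_range'_1] at hi
      exact (hlo i (by omega)).2
    · rw [List.map_map]
      show ((List.range' 0 w).map (fun i => g i - lo1 w D c i)).sum = _
      omega
    · intro c' _
      rw [List.map_map]
      have := sum_split (List.range' 0 w) (lo1 w D c) g (bitN c') hlo'
      unfold wlen
      rw [this]
      show _ = _ + _ + ((List.range' 0 w).map (fun i => (g i - lo1 w D c i) * bitN c' i)).sum
      omega

end BP

namespace BP

set_option linter.unusedVariables false

theorem bit_sum (U : Finset ℕ) (x : ℕ) :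
    (∑ i ∈ U, 2 ^ i) / 2 ^ x % 2 = if x ∈ U then 1 else 0 := by
  have h := Finset.toFinset_bitIndices_sum_two_pow U
  have h2 : x ∈ U ↔ (∑ i ∈ U, 2 ^ i).testBit x = true := by
    rw [← Nat.mem_bitIndices, ← List.mem_toFinset, h]
  have h3 := bitN_testBit (∑ i ∈ U, 2 ^ i) x
  rw [bitN_eq] at h3
  rw [h3]
  simp only [h2]

theorem mod_sum (U : Finset ℕ) (x : ℕ) (h : ∀ i ∈ U, x ≤ i) : (∑ i ∈ U, 2 ^ i) % 2 ^ x = 0 :=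
  Nat.mod_eq_zero_of_dvd (Finset.dvd_sum fun i hi => pow_dvd_pow 2 (h i hi))

theorem sub_sum (U : Finset ℕ) (x y : ℕ) (hxy : x ≠ y) :
    (∑ i ∈ U, 2 ^ i) - ((if x ∈ U then 1 else 0) * 2 ^ x + (if y ∈ U then 1 else 0) * 2 ^ y) =
    ∑ i ∈ (U.erase x).erase y, 2 ^ i := by
  have h1 : ∀ (U : Finset ℕ) (z : ℕ), ∑ i ∈ U, 2 ^ i =
      ∑ i ∈ U.erase z, 2 ^ i + (if z ∈ U then 1 else 0) * 2 ^ z := by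
    intro U z
    split_ifs with h
    · rw [Finset.sum_erase_add _ _ h |>.symm]; simp
    · simp [Finset.erase_eq_of_notMem h]
  have h2 := h1 U x
  have h3 := h1 (U.erase x) y
  have h4 : y ∈ U.erase x ↔ y ∈ U := by simp [hxy.symm]
  simp only [h4] at h3
  omega

theorem card_erase2 (U : Finset ℕ) (x y : ℕ) (hxy : x ≠ y) :
    ((U.erase x).erase y).card + ((if x ∈ U then 1 else 0) + (if y ∈ U then 1 else 0)) = U.card := by
  have h4 : y ∈ U.erase x ↔ y ∈ U := by simp [hxy.symm]
  rw [Finset.card_erase_eq_ite, Finset.card_erase_eq_ite]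
  simp only [h4]
  have h5 : x ∈ U → 1 ≤ U.card := fun h => Finset.card_pos.2 ⟨x, h⟩
  have h6 : x ∈ U → y ∈ U → 2 ≤ U.card := fun h h' => by
    rw [← Finset.card_pair hxy]
    apply Finset.card_le_card
    intro z; simp; rintro (rfl | rfl) <;> assumption
  have h7 : y ∈ U → 1 ≤ U.card := fun h => Finset.card_pos.2 ⟨y, h⟩
  split_ifs with h1 h2 h2
  · have := h6 h2 h1; omega
  · have := h7 h1; omega
  · have := h5 h2; omega
  · omega

theorem card_cover (l : List (ℕ × ℕ)) : ∀ U : Finset ℕ,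
    (∀ i ∈ U, ∃ p ∈ l, p.1 = i ∨ p.2 = i) → U.card ≤ 2 * l.length := by
  induction l with
  | nil =>
    intro U h
    have : U = ∅ := Finset.eq_empty_of_forall_notMem (fun i hi => by simpa using h i hi)
    simp [this]
  | cons p l ih =>
    intro U h
    have h1 := ih ((U.erase p.1).erase p.2) (by
      intro i hi
      simp only [Finset.mem_erase] at hi
      obtain ⟨q, hq, hqi⟩ := h i hi.2.2
      rcases List.mem_cons.1 hq with rfl | hq
      · rcases hqi with rfl | rfl
        · exact absurd rfl hi.2.1
        · exact absurd rfl hi.1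
      · exact ⟨q, hq, hqi⟩)
    have h2 : U.card - 1 ≤ (U.erase p.1).card := Finset.pred_card_le_card_erase
    have h3 : (U.erase p.1).card - 1 ≤ ((U.erase p.1).erase p.2).card :=
      Finset.pred_card_le_card_erase
    rw [List.length_cons]; omega

variable (test : List (ℕ × ℕ) → Bool)

theorem gen_nil (m u s : ℕ) (acc : List (ℕ × ℕ)) (r : List (List (ℕ × ℕ))) :
    gen test [] m u s acc r = bif Nat.beq m 0 then (bif test acc then acc :: r else r) else r := rfl

theorem gen_cons (c : ℕ × ℕ) (ps : List (ℕ × ℕ)) (m u s : ℕ) (acc : List (ℕ × ℕ))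
    (r : List (List (ℕ × ℕ))) :
    gen test (c :: ps) m u s acc r = bif Nat.beq m 0 then (bif test acc then acc :: r else r)
      else bif Nat.beq (u % 2 ^ c.1) 0 then
        (bif Nat.ble 2 (s + (u / 2 ^ c.1 % 2 + u / 2 ^ c.2 % 2)) then
          gen test ps (m - 1) (u - (u / 2 ^ c.1 % 2 * 2 ^ c.1 + u / 2 ^ c.2 % 2 * 2 ^ c.2))
            (s + (u / 2 ^ c.1 % 2 + u / 2 ^ c.2 % 2) - 2) (c :: acc) (gen test ps m u s acc r)
          else gen test ps m u s acc r) else r := rfl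

theorem gen_mono (ps : List (ℕ × ℕ)) : ∀ (m u s : ℕ) (acc : List (ℕ × ℕ))
    (r : List (List (ℕ × ℕ))) (x : List (ℕ × ℕ)), x ∈ r → x ∈ gen test ps m u s acc r := by
  induction ps with
  | nil =>
    intro m u s acc r x hx
    rw [gen_nil]
    cases Nat.beq m 0 <;> cases test acc <;> simp [hx]
  | cons c ps ih =>
    intro m u s acc r x hx
    rw [gen_cons]
    cases Nat.beq m 0
    · cases Nat.beq (u % 2 ^ c.1) 0
      · exact hx
      · cases Nat.ble 2 (s + (u / 2 ^ c.1 % 2 + u / 2 ^ c.2 % 2))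
        · exact ih _ _ _ _ _ _ hx
        · exact ih _ _ _ _ _ _ (ih _ _ _ _ _ _ hx)
    · cases test acc <;> simp [hx]

theorem gen_mem (ps : List (ℕ × ℕ)) : ∀ (hs : ps.Pairwise (fun p q => p.1 ≤ q.1))
    (hp : ∀ p ∈ ps, p.1 < p.2) (l : List (ℕ × ℕ)) (hl : l.Sublist ps) (m s : ℕ)
    (acc : List (ℕ × ℕ)) (r : List (List (ℕ × ℕ))) (U : Finset ℕ) (hm : m = l.length)
    (hU : s + U.card = 2 * m) (hc : ∀ i ∈ U, ∃ p ∈ l, p.1 = i ∨ p.2 = i)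
    (ht : test (l.reverse ++ acc) = true),
    l.reverse ++ acc ∈ gen test ps m (∑ i ∈ U, 2 ^ i) s acc r := by
  induction ps with
  | nil =>
    intro hs hp l hl m s acc r U hm hU hc ht
    obtain rfl := List.sublist_nil.1 hl
    simp only [List.length_nil] at hm
    subst hm
    rw [gen_nil]
    simp only [List.reverse_nil, List.nil_append] at ht ⊢
    rw [ht]
    exact List.mem_cons_self
  | cons c ps ih =>
    intro hs hp l hl m s acc r U hm hU hc ht
    rw [gen_cons]
    have hcp := hp c (by simp)
    rw [List.pairwise_cons] at hs
    cases l with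
    | nil =>
      simp only [List.length_nil] at hm
      subst hm
      simp only [List.reverse_nil, List.nil_append] at ht ⊢
      rw [ht]
      exact List.mem_cons_self
    | cons d l =>
      have hm0 : Nat.beq m 0 = false := by
        cases h : Nat.beq m 0 with
        | false => rfl
        | true =>
          rw [Nat.beq_eq] at h
          rw [h, List.length_cons] at hm; omega
      have hge : ∀ i ∈ U, c.1 ≤ i := by
        intro i hi
        obtain ⟨p, hpl, hpi⟩ := hc i hi
        have hpp := hl.subset hpl
        have h1 := hp p hpp
        have h2 : c.1 ≤ p.1 := by
          rcases List.mem_cons.1 hpp with rfl | h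
          · exact le_rfl
          · exact hs.1 p h
        omega
      have hmod : Nat.beq ((∑ i ∈ U, 2 ^ i) % 2 ^ c.1) 0 = true := by
        rw [mod_sum U _ hge]; rfl
      rw [hm0, hmod, cond_false, cond_true, bit_sum, bit_sum, sub_sum _ _ _ (by omega)]
      by_cases hin : (d :: l).Sublist ps
      · have h1 := ih hs.2 (fun p hp' => hp p (by simp [hp'])) (d :: l) hin m s acc r U hm hU hc ht
        cases Nat.ble 2 (s + ((if c.1 ∈ U then 1 else 0) + (if c.2 ∈ U then 1 else 0)))
        · exact h1
        · exact gen_mono _ _ _ _ _ _ _ _ h1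
      · have hdl : d = c ∧ l.Sublist ps := by
          cases hl with
          | cons _ h => exact absurd h hin
          | cons_cons _ h => exact ⟨rfl, h⟩
        obtain ⟨rfl, hl'⟩ := hdl
        have hc' : ∀ i ∈ (U.erase d.1).erase d.2, ∃ p ∈ l, p.1 = i ∨ p.2 = i := by
          intro i hi
          simp only [Finset.mem_erase] at hi
          obtain ⟨q, hq, hqi⟩ := hc i hi.2.2
          rcases List.mem_cons.1 hq with rfl | hq
          · rcases hqi with rfl | rfl
            · exact absurd rfl hi.2.1
            · exact absurd rfl hi.1
          · exact ⟨q, hq, hqi⟩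
        have hcard := card_cover l _ hc'
        have he := card_erase2 U d.1 d.2 (by omega)
        rw [List.length_cons] at hm
        have hble : Nat.ble 2 (s + ((if d.1 ∈ U then 1 else 0) + (if d.2 ∈ U then 1 else 0))) =
            true := by
          rw [Nat.ble_eq]; omega
        rw [hble, cond_true]
        have := ih hs.2 (fun p hp' => hp p (by simp [hp'])) l hl' (m - 1)
          (s + ((if d.1 ∈ U then 1 else 0) + (if d.2 ∈ U then 1 else 0)) - 2) (d :: acc)
          (gen test ps m (∑ i ∈ U, 2 ^ i) s acc r) ((U.erase d.1).erase d.2) (by omega) (by omega)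
          hc' (by simpa using ht)
        simpa using this

theorem pairs_sorted : ∀ w < 11, (pairs w).Pairwise (fun p q => p.1 ≤ q.1) := by decide +kernel
theorem pairs_lt : ∀ w < 11, ∀ p ∈ pairs w, p.1 < p.2 ∧ p.2 < w := by decide +kernel
theorem pairs_mem' : ∀ w ∈ List.range 11, (List.range w).all (fun y => (List.range y).all
    (fun x => (pairs w).contains (x, y))) = true := by decide +kernel
theorem pairs_mem (w : ℕ) (hw : w < 11) (x y : ℕ) (hy : y < w) (hx : x < y) :
    (x, y) ∈ pairs w := by
  have h := pairs_mem' w (by simpa using hw)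
  simp only [List.all_eq_true, List.mem_range, List.contains_iff_mem] at h
  exact h y hy x hx
theorem pairs_nodup : ∀ w < 11, (pairs w).Nodup := by decide +kernel

theorem gen0_mem (w m : ℕ) (hw : w < 11) (l : List (ℕ × ℕ)) (hl : l.Sublist (pairs w))
    (hm : l.length = m) (hc : ∀ i < w, ∃ p ∈ l, p.1 = i ∨ p.2 = i) (ht : test l.reverse = true) :
    l.reverse ∈ gen0 test w m := by
  change l.reverse ∈ gen test (pairs w) m (2 ^ w - 1) (2 * m - w) [] []
  have h1 : 2 ^ w - 1 = ∑ i ∈ Finset.range w, 2 ^ i := by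
    rw [Nat.geomSum_eq le_rfl]; simp
  have hc' : ∀ i ∈ Finset.range w, ∃ p ∈ l, p.1 = i ∨ p.2 = i := by simpa using hc
  have h2 := card_cover l (Finset.range w) hc'
  rw [h1]
  have := gen_mem test (pairs w) (pairs_sorted w hw) (fun p hp => (pairs_lt w hw p hp).1) l hl m
    (2 * m - w) [] [] (Finset.range w) hm.symm (by simp at h2 ⊢; omega) hc' (by simpa using ht)
  simpa using this

theorem checkList_mem (w : ℕ) (Ds : List (List (ℕ × ℕ))) : ∀ cs, checkList w Ds cs = true →
    ∀ D ∈ Ds, ∃ c, chkDiag w D c = true := by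
  induction Ds with
  | nil => intro cs _ D hD; simp at hD
  | cons D Ds ih =>
    intro cs h E hE
    cases cs with
    | nil => exact absurd h (by simp [checkList])
    | cons c cs =>
      change (bif chkDiag w D c then checkList w Ds cs else false) = true at h
      cases h1 : chkDiag w D c with
      | false => rw [h1] at h; exact absurd h (by simp)
      | true =>
        rw [h1] at h
        rcases List.mem_cons.1 hE with rfl | hE
        · exact ⟨c, h1⟩
        · exact ih cs h E hE

theorem key_eq (f : ℕ → ℕ) (D : List (ℕ × ℕ)) :
    key f D = (D.map (fun c => kk (f c.1) (f c.2))).sum := by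
  induction D with
  | nil => rfl
  | cons c D ih =>
    change kk (f c.1) (f c.2) + key f D = _
    rw [ih]; rfl

theorem canonAux_true (w k : ℕ) (D : List (ℕ × ℕ)) (r : ℕ)
    (h : ∀ r' < r, k ≤ key (fun x => (x + r') % w) D ∧ k ≤ key (fun x => (w + r' - x) % w) D) :
    canonAux w k D r = true := by
  induction r with
  | zero => rfl
  | succ r ih =>
    change (bif Nat.ble k (key (fun x => (x + r) % w) D) then
      bif Nat.ble k (key (fun x => (w + r - x) % w) D) then canonAux w k D r else false
      else false) = true
    have h1 := h r (by omega)
    rw [← Nat.ble_eq, ← Nat.ble_eq] at h1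
    rw [h1.1, h1.2, cond_true, cond_true]
    exact ih (fun r' hr' => h r' (by omega))

theorem canon_true (w : ℕ) (D : List (ℕ × ℕ))
    (h : ∀ r < w, key (fun x => x) D ≤ key (fun x => (x + r) % w) D ∧
      key (fun x => x) D ≤ key (fun x => (w + r - x) % w) D) : canon w D = true :=
  canonAux_true w _ D w h

theorem test_true (w : ℕ) (D : List (ℕ × ℕ)) (h : canon w D = true) (hN : Even (mins w D).length)
    (h12 : (mins w D).length ≠ 12) (h20 : (mins w D).length ≠ 20) : BP.test w D = true := by
  change (bif canon w D then needs (lenL (mins w D)) else false) = true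
  rw [h, cond_true, lenL_eq]
  generalize (mins w D).length = N at *
  change (bif Nat.beq (N % 2) 0 then
    (bif Nat.beq N 12 then false else bif Nat.beq N 20 then false else true) else false) = true
  rw [Nat.even_iff] at hN
  have h1 : Nat.beq N 12 = false := by
    cases h : Nat.beq N 12 with
    | false => rfl
    | true => exact absurd (Nat.beq_eq.mp h) h12
  have h2 : Nat.beq N 20 = false := by
    cases h : Nat.beq N 20 with
    | false => rfl
    | true => exact absurd (Nat.beq_eq.mp h) h20
  rw [hN, h1, h2]; rfl

end BP

namespace BP

def certs_3_2 : List ℕ := [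
  0x42]

def certs_4_2 : List ℕ := [
  0x42]

def certs_4_3 : List ℕ := [
  0x44,
  0x44]

def certs_5_3 : List ℕ := [
  0x2242]

def certs_6_3 : List ℕ := [
  0x8f1e3c7244a181031a101840000202023c78e489430002342030800206080c7,
  0x10a242]

def certs_5_4 : List ℕ := [
  0x49,
  0x4b9708181]

def certs_6_4 : List ℕ := [
  0x264c992c99388040ca8606180010810097081420008202992e51386040938606200010808097080c200041cc970c0c2000a1038404201,
  0x25cb,
  0x264c972e10286040cb840a1818400002013264b970c142020e5c303080420400181,
  0x932644787100c3030800084081c20004049,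
  0x24c9911e1c4010c00284000c2060c049,
  0x972c9420308102032c94207081039708142020004b,
  0x24c9]

def certs_7_4 : List ℕ := [
  0x244894c2652201880218104049948806280026c14400001030048912264ca45031000088081132910044020a18086040840408912264c9c4020011327100808604082033494c8806180064e5c500062023602102040894c9910081047419d020428524489932914044020a200024ca440310000860a18104081122474102253264400001139714081360a20084040819b32201860a100027410001349139714081360a1800274181244e5c50004d80860811d03081839a7414201081800a00912244c9938804083984e181024e18188000000410092244a61329140c4010c082024ca440310001360a1800008282,
  0x9930912970c0022650b80860411b010808105082040132612244ca17030c00236040cb86061000006104080264c992c91b050c081250c143030c00008080cc,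
  0x2448913272a200860410226522812c021810068080080804c984899328500430204d00041091328500430204d0007080810606612264ca14010c0803404084244ca14010c08034041c20000112244e544010c082340019c020891395100430208d00067009c0000180244891326522812c0218102049ca88021810468000080c092,
  0x972e5cb944a1828400192320a181840008202025cb,
  0x244894c2652281880218102049948806200046c0c3000020201349129a74083064899329140c40002202064ca4401100818602182021091397140018808d8007322018602102047408204026922508081840c1cd244e5c50208d81860019d040491397100430208d8006740c2040a6cc8606180840811d030800000066cd24489cb8806200046c09b000c042060c092,
  0x993264c244a2020448d8236040cb840a1018400002020264c992c91b050c081250c143030c00008080cc,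
  0x972e5ca250c142020c919050c0c20000101012e5cb,
  0x93264c88f0e20286080c2061210104064c9911e1c4050c101840c24202080c9,
  0x25cb244a494880618104640019252201860411901080000308204012e5922524a47030c08127100950000c80060e10104065cb25249c40208a15031c0430000c8207080010048949291c0c30208995031000032000812524a47030c08226540c40000c80006c0808410200972c91292522018604099000e49488021800064142040024202080cb,
  0x932634787101430508103030820401264c88f1e100010e202860a102060610408024c9]

def certs_8_4 : List ℕ := [
  0x244a712244891286000020a0c14e244891e060018224489cc984c0803808e000250e013808e0106081122450e003804e00020610400043122538912250c102040c10025389123c0c0030448913273228088062000204a1c047009c040c1022448a1c02700013c080c208002812448912264ca450310002004e64403100430204e0004081050248912244c9948a0220104009cc8806200860409c00041020a04912,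
  0x9b366cd9b349123808112360a201024a2028604e00000c10101366cd9b366922470102250c1440204944046c09c000020304066cd,
  0x24489129a4ca450314043020409329140c50008e01880000206080122448913264e201020899388041138806200000018202027129c489cd98500430200e010736614010c08138021020410284044a7122736614010c082380014d98500c30000e02840408108089122478182044894d98500c30004e0286081832536614030c0023806102064a182860408102180ce24489cd98500430200e010736614010c0813802102040818224489932710080064c9c40002182020c1122536614030c0023804193271008184081032536614030c001380a101027818106067122736614010c08038041cd98500430204e008408104044891e040894d98500c30004e0286081cd98500c30008e01840a18102040ce244a10206089132710080860414d98500c30008e01840a181060674d98500430200e018408112860a181033a10284061000000000004891225349948a06280860408126522818a0011c03100000014181244891225349948a0628004700839a522818a021810070080021010124489129a4ca450314043020409329140c50008e0188000040a10112,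
  0x24489132650a450204b0086001830410012244899328522810258043000c182080264c244c994290c081280019a00101122650a430204a000668002841020401309132650a430000a0200681840448994290c000280819a040610400149129528982006819a0008e04084a54a260811a06681013810e0300100cc98489932850043000c202244ca14010c00305082040802612264ca14050c10008089132850143040c0c20800292244cd000470204244cd02027021c060020124489132650a450000b0286081800414092244899328522800058143040c0020a04912,
  0x972e5cb972e592246408095081420010284032e5cb2448c81012a102840020508065cb,
  0x26cd9a48912246c10106080809b366cd2448d820448e0288040928808e01860000406080cd9b366cd,
  0x972c912271ca01280618106089c72804a0186041c202041420a1404b96489132852381025400232002048408182972c91328523800054101320c2420208092244ca148e04015020cc81040891328523810054083320409b04061050a025cb244a4c38e00a00280011327100802a040190010242040c14b964a4932710080070e3822808a022a0809906121010404912930e3812804a01064c9c40000a820264082044a4c38e04a01280419327100002a080990204d820308285012e592244e39402500c3020c1138e50094030c08384040828414280972e592244e394005004300082138e50114050c101840c0058408182972c912271ca00280218004109c72808a0286080c206002c2040c14b,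
  0x9324947870e201030e2018604084050828501264c88f1e101030e1c404021c4050c100080a1050a024c9911e3c202061c38808043880a18200101420a14049924a3c3871008187100c30204202841428093264c9]

def certs_4_5 : List ℕ := [
  0x0]

def certs_5_5 : List ℕ := [
  0x0,
  0x0,
  0x0,
  0x4f,
  0x50,
  0x0,
  0x0,
  0x0,
  0x0]

def certs_6_5 : List ℕ := [
  0x4f,
  0x52,
  0x51,
  0x0,
  0x50,
  0x4f,
  0x4c,
  0x4c,
  0x0,
  0x51,
  0x50,
  0x4e,
  0x4e,
  0x0,
  0x51,
  0x4f,
  0x4f,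
  0x50,
  0x2952,
  0x50,
  0x4e,
  0x4c,
  0x4e,
  0x0,
  0x4e,
  0x52a508181,
  0x4c,
  0x50a108100,
  0x53a708100,
  0x4f,
  0x51,
  0x0,
  0x0,
  0x2952a3081420308183014a951840a1018400201,
  0x50,
  0x50,
  0x50,
  0x4c,
  0x14a9518406100840c180,
  0x4f,
  0x53,
  0x50,
  0x50a108100,
  0x4e,
  0x0,
  0x4c,
  0x50,
  0x4f,
  0x53,
  0x4f,
  0x0,
  0x27cf]

def certs_7_5 : List ℕ := [
  0x27cf,
  0x274e,
  0xa74e9d2a34620001081c202029420308001840c181,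
  0x264c,
  0x2850,
  0x27cf,
  0x27cf,
  0x2850,
  0x2850,
  0x2952,
  0x2850,
  0x2850,
  0x274e,
  0x27cf,
  0x264c,
  0x27cf,
  0x274e,
  0x274f9d3a10101366cb8806180860610002021028402103080c04f,
  0xa34a8d184081518406102014610384061028400203014a951a3081818400281,
  0x29d3a54a10384040d284061038608003014e9d2a50c1c2021294305080420600201,
  0x9b3a6cd840004c9916281880618100021038406100080804e,
  0xa54a8d1840005184021010508204014a951a10c004a3081c302061004408281,
  0xa54a8d0a10c081a05a28188061818404c808a02200010c0800946181840c0d186061038400002014a951a14218101081c202128c303080420600181,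
  0x28d1,
  0x2556a54880a181840c0d4860a181840e1000008055aa4a9c3030c00184121000b52a43070c0c20001284840c181,
  0x2952a3421830746102860004208128d1860e10208881c20308001014a951a3081818400281,
  0x28d1253c9c3050c0804004250860210301081c2040e84f9a54a01027809d030c0430402103400824203080210404051,
  0xa34684f9a54a01027809d030c0430508000840d00209080210404051,
  0x2ad5254e183860022505080420204055aa4a9c3030c0014a0e1008410281,
  0x2a54a94e100840a10306089538608253860618207080420204054a94e9c302069c3030c1038400281,
  0xa54a8d0a10c08084061030546103860a101000c052a5468c3061285086081d02d1404400640c3010804503100828604042060a8c2070c1420200201,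
  0xa3468d09e566940000f013a06182860210201080a0040a100420c281,
  0x9f3e74d9728a008404143046804300021038404242000404f,
  0x27cf9d365ca2802101050c11a010c000840e1010908001013e7ce9b2e51401080828608d0086000c207080048404101,
  0x28d1,
  0x285084100d0a108201,
  0x2952a340a43047401c030c003273a2818802201027804304061000540a43047401c030c003273a28188022010278043040610084040c20810052a5468139d100c501100013c080943a08e0086021828604042060a8139d100c501100013c080943a08e008602182860404203081818400281,
  0x2952a340a43047401c030c003273a2818802201027804304061000740a43027401c050c003273a28188022010278043040a10084080c20810052a5468139d100c501100013c080943a08e0086021828604042060e8139d100c501100013c081143a08e018606182860004205081818400281,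
  0x27cf9d365ca2802101030c09a010c00384061000508204013e7ce9b2e5140308000340a180860804203081828400281,
  0x0,
  0x2850,
  0x2850,
  0x2850,
  0x2850,
  0x2850,
  0x2850,
  0x2952a346101014610284040c20810052,
  0x28d1,
  0xa54a8d0a10c000840e10209461018602103000c0d2,
  0x28d1a142181033e7938606180020610340061020908021020c051,
  0xa9529d386081538606182004c9c4040694305100808405182840c08505529d3880409327101022710144020694405100808406103014e2018402103060ea53880a10184001d3860e10184001420804054,
  0x2ad5a9521838604254860e10184000040356ad4a90c1c40508081a90c1c305080c20000282,
  0x2ad5a952181860c254860e10184080040356ad4a90c1c30206a4205080c30000282,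
  0x2ad5a95218384061800094242060c0d5,
  0x2a54a74e181860c253840a10186000030352a53a70c1c3020e9c2070c0c20008282,
  0x29d3254a8c30204252a30c1430206103074a1028606103048c0c2000c053,
  0x29d4a74e10386041d3840e102054e101840e102000c054,
  0x2ad52552181095218086041548602201840c1830156a54840a181095210186021030012ad4840a180860424207080030356ad4a90c1008408181250802504021028414155ab08282,
  0x0,
  0xa952a12860e18284061000604054,
  0x0,
  0x9f3e74d9728a00840414304680430006103840024202080cf,
  0x9d366cd840004c9916281880618100021038406100080804e,
  0x28d1a13e7c300021038408250840e101020c0d1a13e7c3000a1038404250840e100000a8d086021030308142000c051,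
  0x2a54a74e101014e180860c1c202080d4a94e9c2060a9c2070c14202069c207080c20000282,
  0x28d1a13ca152a0220004740c3050c003400610003082420610950860c24f270c0c3000d002840c0a107080420408051,
  0xa74e9420708204254a183094a8c3050c002840c0d2a30c1028402103008c1c20408053,
  0x2ad52552180055218084040c2060c0d52552183095218188080d486061828400002ab5218186021820308142000c92504940c209081c20010055,
  0xa950952a50c003a50c04304080d3840e10109081020152a12860e1818400203a94e2028602102840424200080d4,
  0x2a54a74e100014e18186002538606180860c1820152a53a70c1c3000e9c207080c30008282,
  0x2a54a950942010c1c3040c0d3a70c003a70814200029c203081c20012913880a201024e202880620001081c205080c20008106,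
  0x0,
  0x29d3a74a103860610008080d3,
  0xa54a8d02852280007c143030c043040e10084040c20810052,
  0xa74e942088c0c20010053,
  0xa54a8d02852281027c043030c143000e10284041420810052,
  0x274e,
  0xa54a8d0a10c082840e100094618184021030408052,
  0xa950952a510002a5100430204253a70c000840c042060c0d4,
  0x28d1,
  0x2952,
  0xa74e95284040d2840a101094a1018402103000c0d3,
  0x2952a3461838408022090814202080d2,
  0x274f9d3a10305366cb8606200840618004061038406100020804f,
  0x2952a346103054610384040d1840a100840e1010008052,
  0xa54e952840e100074a10386061000408053,
  0x2a54a74a943020e943010c10084080c2040c0d4254e180084c9c40406944030c000840d182034e1028602101040aa53840e18184001420200054,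
  0x2952,
  0x264c,
  0x264c,
  0x2952a340a1d0470043050c083273a281880220100780c304021020340a1d0470043050c083273a281880220100780c3040210084080420810052,
  0x2952a340a1d0470043050c083273a281880220100780c304021020540a1d04700c3050c003273a281880220100780c3040610184080420810052,
  0x9f3e74d9728a01840001a050c043040e10084080c2081004f,
  0xa95095386041d3860218105082420010054,
  0x27cf,
  0x9f3e74d9728a01840009a050c0c3040e10184080c2081004f,
  0x2952a340a1d04700c3050c003273a281880220100780c304061020540a1d04700c3050c003273a281880220100780c3040610184080c20810052,
  0x2850,
  0x285025389c3050c0812668043050c08009389c3050c0832668143030c000840c0ce270c143020c99a050c0c300021038400042060c050,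
  0x285025389c3050c08226680c3050c00009389c3050c0832668143030c000840c14e270c143000c99a050c0c300061038404042060c050,
  0x2850,
  0x274e,
  0xa34494f270c14302010010942180840c0420708121020c051,
  0x29d3,
  0x29d3,
  0x285025389c3050c00226680c3050c00109389c3050c0032668143030c001840c14e270c143000c99a050c0c3000610384040c2060c050,
  0x2a54,
  0x9b3a6cd840c1cc99162808802180040a1038402102020c04e,
  0x28d1a10814202080d1a1421030708103a3081420200051,
  0xa952a53840610384081820152a54250c14301080c20610181,
  0x274e,
  0x9b3a6cd840c1cc99162818806181040a1038406102020c04e,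
  0x264c,
  0x264c,
  0x264c,
  0x2850,
  0x27cf,
  0x27cf,
  0x264c,
  0x264c,
  0x2850,
  0xa74c951293e2818a022010474043040c9c3050c0812674043050c0800544a4f8a06280880411d010c103270c143020499d010c14302021010344a4f8a06280880411d010c103270c143020499d010c143020210184000420810053,
  0xa74c951293e2818a022010474043040c9c3050c0812674043050c0800744a4f8a06280880409d010c083270c143020899d030c14300021020344a4f8a06280880409d010c083270c143020899d030c143000210284000420810053,
  0x2850,
  0x27cf9d3a101033a1018400042081004f,
  0x0,
  0x264c,
  0x264c,
  0x27cf,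
  0x264c,
  0x2850840c0d0a108181,
  0x0]

def certs_8_5 : List ℕ := [
  0xad5ab56ad56ac40412ac405081818400283035ab56ab56201075620384081420014181,
  0x9e567cf,
  0xa54a952,
  0xa142850,
  0xa142850,
  0xa142850,
  0xa54a952,
  0xa142850,
  0xa142850253899386040c30608993860401a030c1800b3899386040c30610993860001a070c100841014e9850982860809a0210993860001a070c101841210100100d0a04a713270c081860c113270c08034061830016713270c081860c213270c000340e18201082029d30a13050c1013404213270c000340e18203082420200201,
  0x9d3a74e,
  0x993264c,
  0x9d3a74e,
  0x9d3a74e,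
  0x2448956269418126522028806200065294603180450314044000a20186081440002182000c012244ab5688041c30414303ae48956860e181084eac4010c1004a05302840c0050448956ab0c0c3010c101089c105ac4ca44031404304080564a0e202035aac5010c1440201281840e101090c1000600957255aac30110102860e181024ead38c062818a022000510083285228005100c3040a20086061000008012ad5a181030c202255a202860c093ab10143000d3014a0a100009c1000a4aba7040210584083022448956265294601180c501140c402022018608181ac52202880620086001a504021820010092244ab56860c0430414303ae48956880a181084eac305100004c09281840c0050448956ab0c044020a181860c22704149d629100c5050c003024ca148a040440206ad38c022808a0620101100c3000220384042564a02201840c1c30400201255c956ab0c143010c083035aac505100c3000d2828606100000c092ad5a200070c202255a1838604093ab100c3000d2824c06100009c1810a4aba706061058408302,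
  0x2ad5ab54912a70c0c3010c103044a1838604092a710143010c0c3040d20186000030402ad5244a9938606182064cb47025c04501140c4011008286021810008154a84e2028604182a94e20286040c3070810388002d4a84e2018600101a94e20186000430508082881210400140d5aa4aa13a710103a65a2808c06281880218005100808404102a9529c3050c08203509c4031010384061020510005a9529c3030c00101509c40110082840210103102420800281,
  0xa952a5424489d28c081953e010018608f80008c12302081420b080060352a12254e944030c043020818125489c30404aa0027c043050c0004608153a50c082860e18084040a4060a1058400301,
  0x2b56ac4aac4050c000ab080430208182015ab56ad56ac3020610384001820202b56ad58912880c055840e1000210101,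
  0xa54a8d0a10c100841015184121838404004014a951a1421820108202a3082430708080080295225461840b4284306128452c08b022c08b02320a28288081c304021040546104860e10100140d2a44a8c30816850860c2508a581160458116046414505101038608042080a8c2090c1c20200281,
  0x2ad5ab56a92a70c0c30110143040e20186001820202ad5a84a9c3010c084a9081c3020c212a90c1822651001860220201080c3060528305080060356ad42552182054c9c40408a518c062008a04120030c043040120284040818400301,
  0xa3468d1253ca4d2a081942b10002860001e04741430601003048424201082810f468929e52695040ca1588001430000f023a0a183008018242121008414087,
  0xa3468d1,
  0xa548950264e745020409c067c01e0004a14860811c030c09d010c00407409939d14081027019f00780022852182027014304740430012102034610284021840108285014a9512650e013a02180084cf00860c0c2000c9943808e8086002133c02183050804204061050a02952a3409939d14044011008102781812852181027419c010c043060210407409939d14044011008102781822852181007419c030c0c3060210284100c200043d2a5449933c0c0943a0ce0086021830108203264cf030450e833806181860c04205082018400301,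
  0x9f3e74d952a1810264043070819a010c00484001420a1404f9f3a6cd84040c32c00b803200d00860218309081c2000a1050a027cf9d3654a8600019070c14204681c306021040508006033e7ce9b36101030cb032e0cc83340e183860804207082028400301,
  0xa54a893287011d010c0042678043060a100064ca1c0474043001099e010c18284021020508285014a912a04c9ce8a04081380cf803c00114290c101380a1823a02180080e813273a2810204e033e00f000450a430404e028608e808600242040a8c205080c308021050a02952a24c99e0608a1d06700c3030c18084101932678182287419c030c0c30602102841014200180d2a546813273a28088022010204f030450a430200e833806181860c042080e813273a28088022010204f030450a430200e833806181860c04205082028400087,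
  0x9e567cf,
  0xa74c913267410128527c50314044030c08202740430000293267418128527c50314044030c08102740430002104064c99d0608a149f140c501100c3020401d030c08084121020308001014e992264ce820250a4f8a0628088061810404e808600005264ce830250a4f8a0628088061810204e808600042080c9933a0c114293e2818a0220186040803a061810108242040610002029d3,
  0xa142850,
  0xa142850,
  0xa142850,
  0xa950953a549080064e2018608101a74a2028a021800488180074e9938608101a74e182054e182880400084081040152a53a74e942031404304040d3440620000169d3a51014202040d3a50c14202049440310000014e10288061800810302a950912a70c143030c00206129d32510103074a9450510103840618002901810d4e9d3860c085a74e203074e2038608000a74c944051008302902240214281a9529d325100c400080420810054a74c944040c1d3a5080c300091030308005244a9c3050c0c300040a40090204024a9d2a5140440002183074a9c305100808608083274e9c400001d3a71010248080c2040a9d3880c1d3a514142030c002440c1538406183880802406029d3a5080c304080d32510000440802402900420814200a9529d3a7101810b4e9c3060e9c3071010000140d4a84a9d32710102034e9c3040a9c3050c080000e9d2a514144000c9c4030c102034a945000910386000420408302,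
  0xad58955ab5218146001938a061820406ad4880a1818a0218004901800756ad48a0a18188001938a061820406ad4860628004901c40002102040c056ac4aad5270c1020356ac304089c405100800012a94a9140c5000c9c4030c1010356a440514044000520301081820c0ab12aa509c4040ea4505140430404255a91414401101024800004aa4eac30204213ab10101ab10143000004206082d62552a44020ea4505101018600255ab10081840c10524489c405100c30008126080c955ab101020752a45020ea440510101840a18002981260804301ac489554a061800812ad5a90c0c3040520009549c50206a4303180440002203840c183ab56a430314043040520009549c40514081a918045010c100840c1c204081d62556ac404081d5a91c142030c001480c08524489c4030c14300080a60810955a90c0c3000c9c505140c40008155a918143020c9c40514082880210102981a608080d62556a47010c10248001d5ab1000084080c20810955a914143030c002480c155a90c0c3000920384040a60898182ad56100860d28284040c208981800002b562556a1388081d48a0a2008808084ab522028a021820490000084c9d58804084ab5618203561828800000840c105035ab1227549c404080d5ab10102ab0c1430200004ab52a450310003271014402040d4a914144000520386000420608302,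
  0x2448956269418026522028806200065294603180450314044000a20186081440006182040c057244895788042040648956ab0c0c30006183089c0052758a4501100c304041d64a0e202015aac5010c1440205280840e100090c1020012bd7244ca538c062818a0014501100832852281010c144020a2008604093ab1010288021838606100009c1820048993291014403100008608113ab100828602181030c202244eac50205302860e180029c14200021050c08957ae4ab13ab10044030c000044eac403100018609300070c2028414302,
  0x2ad5ab54912880c1922710143010c082480c0d48402102840e181000c080ab56ad4a94e20188021020608943050c081250c1c3048c0800a0c0d5,
  0x255ab12ab56ac402042022556ac400000c208021040a06b562556ac404000c206100d62556100860e182860400324981a600100122556181880022600149d5a91404304052000954a44030c10127101440002103064e180480e182840c0430408913a5140c40284044000ca440288043040a18186000a608981c20004302ad58955ab561810212ad586080d5860a18000001420814092244aa93a910144000ea518c062818c022018a00145010c102024d20386000430408302,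
  0x2b56ad56ad5880c085ab549c3050c0c30004242040ead58808055270c143030c00084041420800281ac48993a914144020ea44030c10286000c30408955a9100c3000920386040c200013030d5aad5880c055270c143020c9c4050c0c300021010404955a9100c5010c101860920004980a6061492608981260000282ad58955ab56182000ea938606182064e180860a18100041d5ab561820212ad58608155860a181000210204140d6ac4aa9329101440310003a9100c4010c102024ea440310002480e180010c1024c0c302,
  0x2ad5ab54912480c1922710143030c002460c0d48606100840a1030010080ab56a92250c183a84e2028802102050c082250c1a4048c0800a0c0d5,
  0x2ad5ab54912860c192a70c043050c082460c0d4a70c0430508081840e10000941040202ad5,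
  0x29d325468d18808101a3462020454a46000a2823e061808608f8100002d2a50c000a3449c5000004206880a200101c20408053a64a8d1a27c00007468c40408a9f031811f030c04304011020214951a3101022a7c0c6047c0c3010c100440824200021020402992,
  0x2b922508184249c1c20408057ae4895688061800810956880618005589c40206ac3050c0c50110000840e102060c302ae48927040c927049c0810c489270810956880e18007589c4020eac5050c0c301101008408127080c9128608156840620386000a70804281ae48913860e182860618008089270508204015c9270508005249c2270010092255a180860e202009c180249c0a70108205840c212255a1838806180089c085249c22707080004e0e1020400912,
  0x255c9562756200880a18000109d5880a200030c1a6000e1820b08102015ebd7af5aac3050c04402061038608100244a183055aac4031004304061018602182840c0010a48993ab101028600093ab101450110000860e181090c105255aac30314143000d302089c1c200021020402bd7244ab44050c1c303080040a10092,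
  0xaf5c9270708102015ebd7af5aa460518043050c003a9180c6010c0c3010c101840a1000608080af5c912840c1d6840a1818600003024892705080004e12105041ebd7244a102055a101860e18002100d7255a1828806180049c1c20808927089c1270204312255a1838606200089c005249c22707080014e0e102000c957ae493848414302,
  0xa950953a68c1010b4e9d2860a18086041018410212a68c004a7081a3000e9c205081c300089932c6c04503100c50110002044e20288040c2068c04205080810410054a84a9d34604005a74d1810108204254d182094e943050c0c3000a103064c99630062808a062018800102271014402021034606102034e181840a10384000010802a54a94c923070c081250c1c3030c0000a080d4,
  0x2b56244aac300089a500941c202041040048912255620186002042756a45010c1004804255271010129100c30510000840c1c304083022448954a910103a918144020120348000810a4892608109138606180480c0a606982010c0491225082040848913a5140c40284044000ca440288043040a18186000a608149134a0d28102981a6080c09225082042498226060eb558606183880a10005082260600000ad58912ab561820756182860400226901c202900010414092244aa93480c093a910144000ea518c062818c022018a00145010c10286000430408302,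
  0x2a54254e9c400029d386000430610193264e200008810026510013c02182068c0a200121020410054a848953880618008129d3a70c000094e9c40002103060c9932710102460019327101024405100840c2420408302a84a9d3a70c101084e9c4040a9c4050c080000c993440d100064e9200480002440d10003081020b50953a710101064ca1e047804302011034406102041491229101450310043030c14300081240810953a710102044ca1e05100c3000110384040a406902010c06a12a74e9c30000203264ca200278043040d18144002420408953a710000064ca1e010c144020d10084081420810254254e9c304081132878120030c000440d18284040852448a4405140c4010c0c3050c0010290204254e9c404081132710000460e10102901a4080c0d4254e9c40200113287811e010c083440910084040c20810953a70c102044c9c40001103440a1010290224060ea53860e202840014208901800002a54244e9d38808084a74e182054e1828804000064c9a206880842650f028604f000688122000210204140d4a84a9d3880c253a70c1028600003264c9c40409101084ca2002781430001182440c0420408302,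
  0x2ad5ab54912480c0d4860a100840c0040202ad5aa4894304009c407081c4010c0c20010254250c1c30204943070c0c3000128304180d5,
  0x2b56ad5ab12250c182250c1c30204943070c0c300013030a080d6,
  0xab56a92250c183250c1c3050c082080c055ab56a92250c000250c143030c0020a080d5,
  0xa74e9d3244a8c3050c0c3000c112a3100c3010c1430205083034a18284021030010080a74e992254618288061808604102254618286061800484080a50814303080040a100d3,
  0xa346850a10c000053e7cd990c0940008d808608d8036000009f3cd80007c09f000a1040a08051a3409cf985c01b010c11b006c0013e00142081684f985c01b010c11b006c001840cf80090808106068d0273e617006c043046c01b0000f810308205a13e617006c043046c01b00021033e042420000151a142200013e79b00021033e04f8008089129d38a00010c11d02740033e04f800884081a142200013e79b00021033e04f8008840a10000180a346850a10c000013e7cd990c0940008d808608d8036000819f3cd80007c09f00021040a0c0d1,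
  0x24489420a1495527522018800114880a201880218102049d4880620004900c300021840a98202015ab12244ea440310003480128208109124a0c1c202041812558913a910044050c0824801203089800200489554a06180860802604021050a4892602049d5a910145010c0814800113a914082a910145030c0818602101030c2052556a44030c002860d20108980c200013040402b5624489a400940c306109c206900a4010c1000a0c0d6,
  0xad58912264e20204900240210255ab5220086080d488021828600004ab0c0c4010818388081d5ab5220086080240212ad4880218200940c2060e2028408102015ab55244ea44020aa44030c081880e1800956a430508144030c001880818125552014a08255a90c144030c042040618207080000c0ab552556a430310143000e18205552034a080812556a430310143000e202044ea44040ea44050c102880618084040c200000562556a43051404302052000956a430314001a90c0c4010c000880e103064c9c404092014802103840810224489c4050c0c3000c1260698081244c9c404092014800255a90c1440006a4305140430002202840c1d5a90c0c5010c1420202103480412602980000c0eb56ad54955a90c144010c0814a002558806180060c955a90c144010c0814800255a9100430206a44010c0c30002203840c1932710102840d20148021020408302,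
  0xa9509122654f804004f80074a1828c04123028c00103082c20814054a9509128608212460e181034e94305080c3000a10384000020248953a510043050c001040095228563018800143040c9c3050c08046040d3a50c1430006100009010184161040a02a54a94c923070c081250c1c3030c0000a080d4,
  0xa952a542449103054e10186021030010092a74e944030c003034e9440110081a51404303100008604205264c9c40409180064c9c40404a46010c144030c00046080c20808953a50c0c3000c21327101014608a1f0518043050c000840c0a40708000041ea54244a9d32710081a510043030c000880c205264c9c404089c40510081044c9c40404a20030c145010c00046080420808302,
  0x2a54254e9d286021828604101094c9943c0500086081a2028c04204089943c061823e001a20308123010808105082850152a53244ca20027804304091814400253a50c043030c100840c1848408182a9509132710080287c01e050c0c30005103094e943010c0c3040a103054d182840c04202080d3254e943010c143020419328780a0010c10384091804404103254e943010c14302081932710080287c04304780c3000e10244040d3460610000901018414280a952a53a74a2018800182254a1818600123070c081254a1828600143068c0c300002820352a12a74e943010c0c30408003a748a200278043050c0824402103084ca21030c09f0005103840d18084080058408182,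
  0x29522540a4e2a500003e0404e2a500818608e8186001943a08e803a0808427422010050e823a0218186001a104041420a14052a44a814287400128562018c0001d020ca148a0409f010c0c304082502a54a00007c09d010c143020c9c3030c0430400002a24e8138800080287411d010c0c3000d08284040d1860a10000061050a02952,
  0x9f3e7cf,
  0x2a54244c9938808113880a201021099388080943e022828602182008c1000b4e99388080d288021828600044040a1040408054a8489538600081264c9968a0230188022818804081460011327101022658b008a0628088022010310101440210102169d384040d3a50c143000510001082030806a5424491830404952271010127101004605100094e945010c101440210304900000848993271010246001932710101287c04301100c3040118202169d3a51014300040d327101440206945010c14400021810508202244c9c40405182291811f010c0430400253a50c143000610302901420000100a950913264e202044cb17011404401140c4020620202049d28806200068c0a200002d3a74a20086080a2000210406100d4,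
  0x954244c993880812202089944004f00860802304880800b4e9c4040a9d386040c300021040808054a8489420206952a478000014a9440400ac6047801e010c0c30405100054a9440400ac6047801e010c0c304051008404085840c181a9529d38800052a478000840d10144002420408054244a183094e1038606180000c91229141440310043050c0c3000c1a40490002034e9d32510080000e9d3250c0810290100a74e200014e2018600124000899327101024600193288009e010c100460a1024404042084c9c4040a1038409101440210004169d32510081024ca1e010c100840d182440422405080240204100a950952a450ac603180018a0a1813c00081a548f0000880a200002c2060c092,
  0xa952a542449103034e10386061000008080a950912460c0a40404012274a94302041d2a47c00046051000014952a5141002680143020510009489a0050c083840d1000290001840c085a950952a548f8000029528808013880a181028c0020a4a9528808013880a1810288004a44e1828604193880620001081a200040c206100d4,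
  0x2952a54a8d18804092860d0824204251840e10184000030202952,
  0x954254e91388081528a062008604081a54a28004880c300002d3274e20102069d386040d3860618000021040808054a94e9d3440c002a74d1030108081840c181a9529d38800052a518000840d10144002420408054244a203074e103840a1818600003244a9c3050c0c3000c2240490002024a9d2a7100c300081d2a5140c402061808608085274e9c400001d3a71008148080c208129d3a508145010c083034d1038800053840e2018600124020a9d3a508143000c1532510081440c0a404900c20000100a9529d3a70c0810a48994a1100c60114001a1100c60114044000218204880a200129d38600042060e102000c0d4,
  0x9562556a1388081d48a0a2008808081a95228188001a4030c0000a4c9d58804081ab56201035618186000008410182015ab552556a4303101430002203064ea44000ea44050c100880a18184081022556a430310143000218307552004a0c1420204181ac4aa942710103a914145010c1010356a440314044000d2010016a93ab0c0810356ac302049c4031000001082030448956270c0c30009283080c954a910083a91414404061800956ac4020610304981a602040d6244c9c404092014800255a90c1450006a4305100430002202840c1d5a90c0c5010c142020610348001022556a47030c0034804255ab10081840c1260698081ad561024a06180840c1a603080000002b562448993880812402900040156ac4050c084ab5220086080d48802182860004405081800956ad488021820290000ab5220186001250308004880e103060c0d6,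
  0x2b56ac489134a0d28108049122710144030c00302981a6040c080ad5ab554a06182840c1d54a0a1038606102035a102840000000489542718144020d283480008125509c405180814a05200089800084121030806b56244aa13880918100940a400100420908184ac489430608943070c081250c1c3030c0000a4aa13460620000941a40005304840e10206080d6,
  0x2a54a950912880c192a5100c3000c9c405100c2050c00204489c405100c3000e9440308143000a201034e103840a10184000030202a54a94e9d2880620006089528606180048c1c30204952860a180050c1a3030c0000a080d4,
  0xad5ab562556183880805584021830210101ad5ab55ab100c2060c943050c1820a10156,
  0x2ad5a84a9c3070c003a90814300081c20a16a92a90c1012651001860220207080430402104084895386061808608182248c1c30202a53860a180840414207080014a0c1010156ad42552181034ca518c062008a04143010c1032680144020520184000008414280ab56ad4250c102a94e2018802102070c081250c1c3048c0000a0c0d5,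
  0xab56a92250c180250c1c3030c0010804055ab5491227100c3050c003044920346040d4860a101840e1000014101ab56ad5244a183064920386081542710144030810386011810214182,
  0xa34495086102cf264e180010c104400e104020c94f2934a820650ac4000a180007811d050c18440080a10708285a3081c20810051a24a8430816793270c00086082200708201064a7949a541032856200050c0003c08e82860c220040508384142d1840e10408028d1,
  0xa950912a44e18286041513e062023e040220010252a548f82040295288000138806182068c003a54a200004e20186081a2010818405081830152a54254e1828404012440a1000814201a950912460c124061409225489a0030c10244002240016952270c103074a91f0409182440c052a51400026800c3040d100840e100080a1030012a54,
  0xaf5eb92ad56182860620005081c3000c0d6ad0c0430606b42030c042060e1820410912275618288001a602940044e04256ad0c181ad080c401081838608142060c057af5c912860c104244a203049c1830c06bd7244eac40310001880e18286021030802b568602182015a1008606103090c1020848913ab10043040d2804c042270016b568606100095a200840c1c3040a1030602bd7,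
  0xa5489502850ac401180820050a9501100803e061800650a450000f82860218202128143a0a1813a001938606180860810203468c3040281327100010050e823a0218286041a101080c204041c20a14052a44a8149c50a80047c0832b38a0000740c3050c000287401d047400209409c40200a1d0474043030c10342001018414280a54a951254218004841c30204943070c14302800000a0c0d2,
  0x2a54a6489944004f0086081230288004a74a1808606182010818309081030552a12264e2010050f803c0a18186000a206129d286021818608142060a9a305081808404101a6489944008f0186001a30488081a74a181860a1800308000024a9a3020c99388040144200f01860218206880c2040a9d28606101860a180010808048041c20a14054a84a9d3a50c0c3050c0010000913288401f050c00344051820548a2004780c3050c0034406101034e10084040028414280a950953a74a180860618204001d3a4510013c021828604122010818426510818604f8002881c2068c04204002c2040c154,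
  0xa548951a30c100074281386061800408a143a081142b100460208e810050a9501100803e06182860019429140003e0a1818602182021281327100010050e823a0218286041a101080c204081420a14052a44a8149c50a80047c0832b38a0000740c3050c000287401d047400209409c40200a1d0474043030c10342001028414280a54a951254218004841c30208943070c120030c0000a0c0d2,
  0x9d3a74e,
  0xa950952a548f80000e9528808113880a180008c1010a4a9528808113880a1800088104a44e1828600193880620003081a20200042040c054a84899327101022658b008a06280880220103101014400185244c9968a02301880228188040814600253840e180040a9d384040d3a50c143000110101082010806a12274a9430000152a47c000460510006161020750952a5141022680143000110209489a0050c003840d1010108082244e944030c0034409181094e945010c10044061030090124020c0002550913264e202044cb17011404401140c40206202020c9d28806180068c0a204002d3a74a2008608022020210402100d4,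
  0xa74e992254620286061808608183254618286061800484180a5081c303080010404053a74e9d2840e100860410100029d3,
  0xa952a122488180a7081c303080010400913264e202008c080264e2020250f8186062008608123000c2d3a74a2028600080a64e20288040d28a0218288000430202104024899388080943e050008606182048c004a74a1828600042060520084081040552a12a84899327101012710144000021327101012880045050c0c3040918004169d3a5100440406944010c14300000420804202,
  0x29d3a74e94207080c20008081014e9d3,
  0x9d3e74e84101cd9b18a822a0a2028608182840e1048408083013a7ce9d082039b363150454144050c10305081c2090810106027cf,
  0x2a54254e9d2880a1810488180064c9932c5c04501100450310082044e2028804084274a2018600023048818084081030152a12254e18008129d3840c1d3a50c1430209103000c993265a2808c062008a062010409180064c9962c022818a02200880410227101440205100840c2420408180a84a9d3a510143000c184264c9c40404a46010c14300011820908182254e943030c102064c9c40200a200318043050c003460610203082000b509124608105254c9c4040e94505101430202201064c9c4020518084081240810953a5141430209103044e944030c000440d18284040a408901800606a54254e99388081d2880a1818608044020c213264e202044e2028804081264e2010051001860a28086001a3020210304140d4,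
  0x2550953a74a20286041a20400293264cb17011404401140c40208113880a20102089d28806200008c1220202104040c054a8489d2a50c100074a91f040118344001028410201a84a9d3a50c143020c005254d100094e1038600183264c9968a023018802281880410246001932658b008a06280880220104089c4051008144021020508202075095226800430405102094a94500009a0010c103840d1010308183254e945050c0834408213a5100c40001182440610302901a40408000a950952a548f82000a95288040938802182008c104044a913880a200044e18286000a204129528800013880218207081a2020404208100d4,
  0x2448955aa4e281075218146021820406ad4880a1818a0218006901000b56a938a08154860a28188021810206ad4460628004900c40002104040c056ac4aa93ab14082a9180430310000880c213a914102ab141430206ac4050c080880c085ab549c50510081a90c145010c080064eac5040ea46030c144020620088080c20808955a90c081880d200095528186021030756a45010c1430205200840e10204980830602b562556a45050c0c3000d2020956a43040920188021030355282840e1818400026060801225509c605100834a0d2000408954271014600052024a0422604021048404201ad58912a89419346062000094182044aa13880918004940a404109250690081010824202100d6,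
  0x2952a54a951254218004841c30204943070c14302800000a0c0d2,
  0x2952a54a951254218004841c30208943070c120030c0000a0c0d2,
  0xad5aa92aa94084264e2020152201860a18004900c206081d5aa94042020a10400140d6ac4aaa504109938808054860a20186001240308181aa940c201081800804912ab0c1c302941004c0c0c20498283055ab56244a181024aa43050c0c3000a18388042030402b56ac4aa44010c143030c00286042128606180840c003044aad5860d2810614955860c21327101004806103860811327101004806101840e182020aad586092800556182840210103082000a06b5624982c2040c156,
  0x29d3a64a8d1a27c10005468c40204a9f027c0c6010c14300011020808951a3100002a7c09f0318043050c00344040c208021040a069d3254a94306001d1a34620102128d188000142b18046020a1828a021803e04180a3449c5020804202881a200081420814092,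
  0xad5ab56244a181024aa43050c0c3000a18388041830402b56ac4aa44010c143030c0028604212860e18186000030448913a9141450009283040aad5ab0c10303549c4030c143000e10104049124a040d5ab0c0802710043050c0c2000404208021040a06b56aa4aa548a080250694002aa4e20186081938802181860804202041c208140d6,
  0x255eb928410202ae4894208021040b5e104840c081af5c912840814208101572508205af082420604092,
  0x2ad5ab54912a70c0c3010c102044a1828604092a710143010c0c3040920186000030402ad5aa48943060c924070c102254e182880218186001d3860a1818602102030c1010a0c155,
  0xab56a92a952a430404203274e9c5040019327100812918146010c0c3000120309081022552a43020011327100002918146010c0c3000e10148080c20800281ab54954a9521820004193265228286062800602993860a201064e1818802182000610204140d5,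
  0x993264c,
  0xa54a8d0264e745020001c067c11e0400a14860409d0670043010c184840c150264e745020001c067c11e0404a14860401d06700c3030c18484061030108285014a951264cf020050e833802180860c24206089933c080943a0ce01860618309080c206021050a02952,
  0x9f3e74d952a18000641c3050811a070c184840c0c20a1404f9f3a6cd84000432c0cb83320cd03860e182090814206061050a027cf,
  0x2952a54a8d1880c192420d0828604151840e10284040050606952,
  0x2ad5ab54953860a1818802180070c144020c1010156ad5244a20306489c4050c043020d2020552101840e10286000050606ad5,
  0xa3468d1,
  0x9f3e74d9728a0202681c3070c08484061030308285013e7ce9b2e5140404d03860e18109080c206061050a027cf,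
  0xa54a8932678101287419c030c0c30612103044c99e0404a1d06700c3030c18484061030308285014a951a04c9ce8a04000380cf823c08094290c0803a0ce0186061830908182a04c9ce8a04000380cf823c08094290c0803a0ce01860618309080c206061050a02952,
  0xa54a8932678101287419c030c0c30612103064c99e0408a1d0670143050c184840a1030308285014a951a04c9ce8a04000380cf823c08094290c0803a0ce0186061830908183a04c9ce8a04000380cf823c08114290c0003a0ce02860a183090814206061050a02952,
  0x9f3e74d9728a0202681c3070c08484061030508285013e7ce9b2e5140404d03860e18109080c2060a1050a027cf,
  0x9f3e74d9b080818658197066419a070c1c30012100840c1420a1404f9f3a6ca950c081320e1808400d03860c242060a1050a027cf,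
  0xa14094e264e181030c182264e18100680c306002ce264e181030c184264e18000681c30402104053899386040430610993860001a070c1018412101010820401428129c4e183044cd01860c0059c4e183084cd038608042080a713860c213340e182030824202021040802850,
  0xa142850,
  0x9d3a74e,
  0x2952a44a8149c50a80027c1019c54a01030c11d030c000287401d027400203409c40200a1d0274043050c08142001858404101a548950a04e18286001022850e810450ac403180003a040152a500813e08e8186061800250a450200f81860a18086041810b4681327100810050e813a0218286040a10108184a30c04206081c202080d2,
  0xa14094e270c18226680c306042ce270c18426681c3040610405389c3061099a070c1018412101030820401428129c4c9c30202183044c9c30200d01860c0859c4c9c30202183084c9c30000d0386080c2080a713270c080860c213270c000340e182030824202061040802850,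
  0xa14094e270c183266814306042ce270c18426681c3040610407389c3061099a070c1028412102030820401428129c4c9c30202183064c9c30000d02860c0859c4c9c30202183084c9c30000d0386080c2080e713270c000860c213270c000340e182050824204061040802850,
  0xa952a12250c18324881a20408922068812202002030152a54,
  0x28d1254282002002d0a0800808410250a1081839f3e5c3025801601140440008142070811f00067cf970c0960058045011000205081c2047c04200000840146892a1409c3030c04304080048404101a34494f2710082291e3008a0001d030c1430001002094099d050c0c3000a10307080010140950400024f9f164802c00b002e02280040899d0310000840cf80020a850840500005082042541001094210340041cf9f164802c00b002e02280040899d0310000840cf8084080210200200a34681226521823a06200010c0a00412813880a1808604142060c04202080d1,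
  0x9b3a6cd841024c991628288081c3040e104840c0c2061004d9d366c2081264c840004c99080008b14144040e18207082420606103080274e,
  0x2a54254a9142b180c6000a1828a04f00060e9523c08122068810005081840152a12a54a91e0408052a5100002b1809e0078043050c0834400202254a9440000ac6027801e010c143020d1000508204840c200a848953880e180060c993271008146001132710082440d1008408182a74e9c304001d3a710100840814202042d4a74c944020c193287814300021014609103041491229101450310043030c14300040a40810912860412408901830d529d3250c002044ca1e04800c3000e10046051020308204a74e203074a91e040a100440d1020290224060ea53860e182840422407081020004954244c99388040a2060c9944004f0286001a30288100054e9c4040e9d386040c306021010214092,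
  0xad589420610056ac4894208121030802b122556181880e180064d2804a06102040c29224982042498226060c31225082042498226060eb558406183860a18008981c2040800125589122694125000aac305080810414092,
  0xa74e9d3a74a10384061820608000a74e992254618288061808604081254618286021810084080a50c1c205080040a100d3,
  0x2ad5ab56a4207080c300081010156ad5ab52101840e1820608000ab56a92250c00027100c2031004307080040a4894304089c4050814403080c3000528404100d5,
  0x2ad5ab56a4205080c300081010156ad524489c3010c143020c154840e101860a1800014181ab56a922490102a908143010808106080d5,
  0xa54a8d0a10c183840015186121008408205034a951a1421830708002a30c24201081040a06952,
  0xa34494f9e4c9c300021820601004054218484040210b0820403468929f3c9938600043040c020080a8430908080421610408068d1,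
  0x9b3a6cd841024c99162818806181060e1048406103021004d9d366c2081264c8b140c4030c08307082420308181080274e,
  0x9b3a6cd841024c99162818806181060e1048406103041004d9d366c2081264c8b140c4030c08307082420308182080274e,
  0xa344950a04e18186021820400242040c151a2489948f180450000e8186080cf88061800080104a04ce82860618005081838404101a04a82002109932e580490114044000814f8606200010819f02081d0a108120030c0038410212a080104a1081a0040c9932e580490114044000814f8606200010819f030810142080840146892a141002021685040080c20812850840c1cf9f2e1802c04b018a06201040a1038408f81053e7cb8600b012c062818804102840e1023e061010208200a34681226521823a06200030c0200412813880a1818600142060c042040c151,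
  0x9b3a6cd841024c99080819932101031628088001c3000e104840c142001004d9d366c2081264c8b14044000e1800708242060a100080274e,
  0xa346850a10c183013e7cd990c0940004d808604d8036001839f3cd82047c19f04021010410051a3409cf985c01b010c09b006c0033e00242020a84f985c01b010c09b006c0038404f80050820408028d0273e643026c143006c11b0400f830908082a13e643026c143006c11b040e1003e080c208002d1244a74e2804043027411d0004f833e00105a142203013e79b04021013e0cf800484204a142203073e79b040a1003e0cf8202842210600201a346850a10c180093e7cd98500808604d828600d8236081809f3cd82007c19f000e10104140d1,
  0x2448912264e182054e20088061828604023020810200489124a08100244899386081538802201860a181008c08201081020556a922508204244e9c3050c0c3000c113a70c143030c0038404092a70c143020a9c3050c0c20206200840c1820802a92244e9c3010c143020c113a70c043050c0838404082244a9c3050c001a70c143010800088080c208002d5244a1810414912860a1810494204244a18186000a50894180080491224489d388062008608113860a181008c083040809224492830404912274e2018802182044e1828604023020c0c20408155,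
  0xa34684f9f080819f3e100010c1008410150840a1040810051a13e7c3000e7cf8600142020610405421018410005a34218084082c2090800403468d09f3e1820108202a1081420810200a3427cf86001c2080a84203082000b468430108105841210008068d1,
  0x993264c,
  0x9f3e795,
  0x9f3cacf,
  0x9f3e74d9728a01070c19a030c08284121010b08103053e7ce9b2e514020e18334061810308242041610104067cf9d365ca28041c306680c3020610484082c202080cf9f3a6cb9450083860cd01860414209080858408182,
  0x993264c,
  0x993264c,
  0x993264c,
  0xa142850,
  0xa74c913267400028527c50314044030c08204740430010193267408028527c50314044030c08202740430012102024c99d0200a149f140c501100c3020809d010c004840a1000108285014e992264ce800050a4f8a0628088061810408e808600203264ce810050a4f8a0628088061810404e80860024204049933a04014293e2818a0220186041013a02180090814200021050a029d3,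
  0xa74c913267408028527c50314044030c08202740430010193267408028527c50314044030c08202740430012102044c99d0204a149f140c501100c3020801d030c084840a1010108285014e992264ce810050a4f8a0628088061810404e808600203264ce810050a4f8a0628088061810404e80860024204089933a04094293e2818a0220186041003a06181090814202021050a029d3,
  0xa142850,
  0xa142850,
  0xa54a952,
  0xa142850,
  0x9f3c9129b2cc80320019d00066cb3200c80067404200000c20b08205013e7ce9d36598860401900065932c000190064000840c2129b0c1430008e83010810484041019f3e74d964cb000064003966218104641190402102084a6c3050c0023a0c1c20308001004a74d96621800064003964cb0104641190402101024a6c3050c0013a000029c4a6c3050c00103365988600019000e5932c0411904641008404e80007c08084121050a027cf244a6cb3200c8002740049b2cc82320801d07081800b0814202080cf,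
  0xa952a12248818224881a2020494306880a200002010152a54,
  0xa952a542449183064a18386080d3a50c0c30508001840e10200901050806a54,
  0xa950953a68c1820a4a9d2860a1818600084a70c0c2060c99388081132c60045031404401100828804042068c0c204081d3a68c101a708123010808284100050352a12a74e943050c0820310005254d183084c9c4040499636062808a06200880414400021034608153840e1828404082a74d181014d182840610003082000a06a54,
  0x29d3a648943070c103a5080c20404182034e912265274503140019f140c4000220207461828804043040a8c3070c04304041420a169d3250c1c303080020308200014e99225467cf8a02201010c144020e8c30510043020010284161000a029d3,
  0x9f3c9129b2cc81320419d020a6cb3204c8106740c202041420b08205013e7ce9d365988604019000a5932c000990264080840c2129b0c1430208e83010808484081829f3e74d964cb000264083966218104641190406102084a6c3050c0823a0c1c20108082024a74d96621800264083964cb0104641190406100044a6c3050c0003a040839c4a6c3050c00005365988600099020e5932c0411904641018400e81027c10184121050a027cf244a6cb3200c8004740049b2cc82320809d07081800b08142020c14f,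
  0x9f3e7ce9d081809d082420016102060a7cf9d3a103013a10484002c2040c14f,
  0xa74c913267408128527c50314044030c08200740c30210193267408128527c50314044030c08200740c30212102044c99d0204a149f140c501100c3020801d030c084840a1010308285014e992264ce810250a4f8a0628088061810400e818604203264ce810250a4f8a0628088061810400e81860424204089933a04094293e2818a0220186041003a06181090814202061050a029d3,
  0x993264c,
  0x9f3e7cf,
  0x9f3e7cf,
  0x9d3a74e,
  0xa142850,
  0x993264c,
  0x993264c,
  0xa1428129c4c9c30402182064c9c30400d0286040859c4c9c30402182084c9c30200d0386040c2080e713270c1008604213270c080340e18105082420404201a14094e264e182010c103264e182006814302042ce264e182010c104264e18100681c30206104073899386080430210993860401a070c082841210202100d0,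
  0x993264c,
  0x9f3e7cf]

def certs_9_5 : List ℕ := [
  0xa54a952a54a952,
  0xa142850a142850,
  0x9d3a74e9d3a74e,
  0xa74e9d3a74e94209081420014201014e9d3a74a104840a1000a10080a74e9d3,
  0x2952a24ca1c0474043001499e010c2028400213287019d010c0052678043080e100840c1420c18052a4489933c040143a021800a109933c0a1020050e808600282a3081c202021060c02952a24ca1c0474043001499e010c2028400213287019d010c0052678043080e100840c1420c18052a5449943808e8086002933c0218405080042650e033a021800a4cf0086101c201081828418300a54a8932678202287421c030c0c30802105084c99e080ca1d0870143050c200840e1050508007034a951264cf040450e8486100420a109933c101c20650e8486100420a0a1000e06952a24c99e0808a1d08700c3030c20084142132678203287421c050c14308021038414142001c0d2a5449933c101143a10e0186061840108284264cf040650e84380a182861004207082828400381,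
  0x9f3e74d952a1820464cc3040001a010c00584001c20c1804f9f3a6cd84081432c00b803202196005c019010c18134021800b0800384183009f3e74d9b08102865801700640432c00b803202183026804300161000708306013e7ce9b2a5430408c99860800034021800b0800384183009f3e74d8720216085c219330c100086824308021050708007033e7ce9b36102050cb042e10c84865819706641c30400d0486100420a0e1000e067cf9d366c2040a196085c219090cb032e0cc83860801a090c20084141c2001c0cf9f3a6c39010b042e10c998608004341218401082838400381,
  0xa142850a142850,
  0x2448913264c9c400000220600994290c1024004f00088c0a200141850048912264c9938800000440c0132852182048009e001118144002830a02a12244a9c4030c0050a4c9932710102048c004264c9c40408122028804208141870448913268822200109d2400d0000688222000418624489953c00f033c00022088808348143122650a430000f038808022088c182481408703509132650a4304090013c0022302880050648994290c1023c02201088800384142852448994290c0003c0d002008822306092050c489932710000008c22306092050806a122654f003c0cf0008881a2000a1050a489932710000008822206092054810254a7101c2030c20384152040000054244895388061800a14993264e2020409180084c9938808102440510084102830e08912264d1044400213a4801a0000d10444000830c489132a7801e067800044111010690286244ca14860001e0710100441118304902810e06a12264ca148608120027800446051000a0c91328521820478044021110007082850a48913285218000781a00401104460c1240a18913264e2000001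184460c1240a100d4244ca9e007819e001110344001420a14913264e2000001104440c1240a90204a94e203840618407082a40800000244891326882220214994290c0813c0cf0008881a200001860248912264d10444042932852181027819e001110344000030c04912244c993271010204880852650a4300010023c0c0230688200061c1122448993264e20204091010a4ca1486000200478180460d104000c382,
  0xb04ac122562c12249c18125101c300002020202c582448912860c192880d3820014203024ac58,
  0xa74e9d3a648921080a94307080c20800281014e9d32449084054a18384061040014080a74e9922484100a5081c303080050c140d3a74c9124208052840e18184002860a069d3,
  0x2a54a952a122488203a70814301082000a04953a64e2028600201a64e202034a280860a200010c0850c4c9a306009943e0e18388080230606105064a9d2860a18008149943e0d002860c023070820248121000008454a95091244101d3840a1808410005024a9d3a51010486000d3a5100440406945010c14400021810a18993264e20204091814600213264e2020204a14860001f070c180460d1830308283254e94304121800a4c99388080812852180007c1a0050c180460e10404902420000108a952a12254e99388080d2880218286000050c4c9942914000400a183008c18084141870550912a74c9c40406944010c1430000286264ca148a00020050c180460c0420a0c382,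
  0x29522540a149c54044000c0149c540150000e8186002052650e833a0218008841810708306014a912a050a4e9d100812a001809c50a800338a94020618204740c30010a1d067401d0604293a1101002a7419d00741c30011083020e1060c02952244ca143a000942a5620103180003a04205274099388000020054e833a0ce8086002210604192a050a958804095000ce80860c213860a183000a8c307080800108306014a9122650a1d0004a152b100818c0001d0210293a04c9c400001002a7419d06740430011083020c9502854ac40204a80067404306109c3050c180054618384040008418300a54a952,
  0x24489132650a158a063000404a168c0404605180c40408202264cac503180030250a140200a4303141030604993285a300028c1470518045040c0932710100291402404080142d1c0c5031c0012a8c1460000aa3051804303140002c8c145048c0230114043031010304001840048912ae4eb14ab1804402080d6a85804701140c402023018608104044eb14aa540440204056a8580450318044020630086081822650b46031c04501140818c081942d1c0c601140828a061820204013285228248001832650ac601140828a00194480218204049948a081158c0a28086040138a062008608182020c3832448993264e2020404093264e20202009932b180c50110080004e2028806200060c1830c489132850ac502080942d180c6011404502022020410994aa540c5020a201065218288041012650b4601180c502051800650b4601180c50314002860a201024e2028a062000000106244c9938808101264e202024e281880000004a02850408912ae4eb142d180c601140c40204056ab1c04402063808608184044eb564802182060c9942b140c5000a30106523018608101024ca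1546080142d1c0460314045020628088081822650b47032004501140818e0a2800650b4601180c5020a30086080812656282880a281045120286063000098183000c212244ca142d1c0c601140c500080942b180c500022820408994480a28005551828e0a18188000802650b48025c04501140818a0a3800450b17031c04503140018c0a28086040a6069800404189132850b46031804502040142b140c5000620206109958a06300065218288041012652a1603180c5011408188081942d1c04501180c5020a18288040938a0a2818a0000004a02830448957ae4e20202049932b1804503100c40004013880a20186001830414913285120088081832650ac601140828a022010652301860810127592020450ac603180018a0a1818a000a60600128080c9122650b4601180c5011408188001942d180c60114045020a18288000a6050c0010a489938808093880a20188000015010212275aa9503100028a06201075a301860a2010510001501140304040802448913264c9c40408081264c9c4040401326563018a00024051008027101440310003060c1860448913264c9958c0628005180c60008081264c9c40404013271000027101440310003060c18524489932710102024caa4051014600049a403100000008292264c9958a022810510082024c9c402049a4031000000094040804092255c9d6ad180c304081812758a168c063008a062010404aa30510145030c102044ca240408aa3051414302040002650a168c000a3051c1002b181470110145000c2132b180c6000ca430518002024ca168c0404605180c50310103285a30105140c7011404304009c4031004304081020610912264c9c404040932656301029014601100002710144031000306082922650a4404081932b140c60110083290c144020809328901022b14145010c0c40406b4501101440000002501018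1244abd72710081004c9c404049c4010c10202082122650aa3051c000285a381028c123008c0450518003044ca168c000a3051c1460110045040ca542c04147031c04501180c304040932a8c14603141450208a24050c0c5000130306094030648957275630088000a4050c101270c144031000002109132710102271014402049c4031004304000a8060c913ac90102aa8c145011814302062004c0c0a806a01020000012244899328591824609180005630246022828a00184044ca56480018326563818a0019448021820404093265a3828c0a3818a062820608a1646062818c00095460a2800050b47020630246023008a0a18106009d68c0620103551818a062828602201011018306181832448993264cac6031404402092000404093264e20202009938800013880a2018800183061019224a0284244ca148a0810326562818a0220106521828804101265120204563028a021818808093880920188000000a4c9958a062014800101264e202024e281880000084101820404912264ca142d1c04602051828e0005546023808808184044ca148a09200060c9958c063808a00194280a18204040932650b4603140804806301880a2010608a142d180c5020a38002562828a000142d1808146091808a02202860620006009948a08095460a2818602202010c183060c19224a0283244ca4b3408d023408d02aa0aa82aa0aa82aa091820050b48031c0018e091808a0a3800608996460918246022808a0a2000650b4601140024806301860a20002049958e0a3018a08114480a18100980a6060c2932855181025a3028a091818a0620204109958a063008804194860a20104049942d1c001460a3028c001942d180828a063808a0218288040938a0a281880000084101020448928060c913264e201020099388040938806200015e1828600184064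ca142d1c0c6000a3818e00095460a3018a0810226522804808155460a1818a0230202009942d1c081460918046022828c001142c5c0c800051828e023828a0218102981a6001210204089125010192501140204489d64808155460a382860620002981c300109938808093880a201880004206089942d1c001460a3028c0228088081942d1c0028e063018e02280860a28103080c4010818102040002448913264c9958c06280880410202049932710101024c9c402049c5031400000001850248912ae4eb14a858046000518246080558a091808c021820610113ad5920086081832656381460230106523018608101024ca158e080142d180818c091808e022028a001822650b47000518246091808c0a2800650b4603180028c06300860808126563028a0620204512028604026060c0030e0c912264c9938808081004c9932b14081480a30000009938808113880a201024e201880218200102030c489132850ac503140020250b4600023828a0a20204109958a05180065218288041012650b4600051828a0918088001942d180028c062818c0218288000a60400106244c9938808101264e202024e2018a0000004a02850408912af5c993ab180c403100028c00101024c9938808080264e200004e2028806180060c1830a4891328512008a08183265630146022818a001948c0618204049d648081158e0a30086062008a080a60600106244c9958c062818c00101264e202024e2018a0000004a02840448957ae4e20204049932b1800148092028a0001388061800608105244c9932b1804503100440208101264e201024e2028806200060012808109122655180880228188041d68c0618288041430004292264e202044e2028806200000540408489932b18045020a2014800113880a2018800001501140306040812448913264c9c40408081264c9c4040409326563008a0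620102049c5031400000001860448912264ca142b180c600080942d1c0c601140808a08104044ca148a0810326562818a00194480218204040932850b46031c0450114082025630288081022650b47031804503140018a081942d1804603140828c02182020499448081142b1404602061818a08093880a2818800000000c383,
  0x244ac5824489124c000030c10158b0489280800202255ebd7af141000406bd7af0c144020c1d7af0c14402053820214192af5ebc30310002055ebc303100004e0400284140010e4ac582448926060c1040402c5824494040010112af5ebd78a08003055ebd7880a181060ebd7880a181029c1820a0c957af5e2018600102af5e201860002704041420a003012448957af5ebc50400182af5ebc504000d7270c143020c9c3030c04304001830618092244abd7af5e282000c157af5e282000ab93860a181064e181860218200040830c04912,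
  0xaf5ebd7af5c9124c0c1922710144010c0824a0c1122710144030c001880e1820010181015ebd7af5eb92244e20188021820608913880a20086040c3060494406940a600002840406bd7,
  0x2448942060c0592448913264e2020010a148c041144a0128186081948c021828804002264e20100523004a0a18186000a80604203024892908061030602c92b3649d8af1404305100804e0425827141014e02103070c10504489138802181860c201244a20302a4183021c459b2489d8af100c304053800762bc501100c30401401840c2430414180b248958af100a5050c00386053828400205084891329100c4011010386061808608200264c9c40404194289400329180250404a46030c144010c082044c9c40400a2500940c3050c0025006103084c9c40400a46010c144030c001840e182001018124494850048913af10144030c0834e0138208a400552042c2060c01224489132652282880620001101842652202880620004a01c300061820a0c01224a4280840c1802448912244ac134e0c0d829140440310143000d382010c1050c14112,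
  0xaf5c912ac509c4020c9c5030c102035aac4051404303100024a0c003264d283004ca450284043040d28007081020614012244891326941002651102420218106940044c081020a02b92ae48912860c1832449303070c1020c0c157255c912860408524489c405100c400040a70810101244a1050a489420812b5627100c30405280084eb440514081860c0d62714081ab18045010c080860e201840c183264ca21010c144020d280064ca21008c0c3040d2804c0610309081020614057255c912860409286061800014101ae48956ab14144010c0824a0e180044d2834a09300840408200489124c081034e0030524493850a4892708109d6ad0c083ad1014300001d6ad101014e06103080c9934a0d280064ca23030c0c500012834a0610309081020648956ad10080044ca23030c0c5000d28284040a700093848414006035eb92244c994420110286041a50011302040891226511028806180069810205082850a02b92244ea9446001148c0a30002089d58c041148c01181860402506940840408912265230046041d58c02182029412500040c20a0031224489d546021820494002049c28524489a5069412602040a70a9c2000a06bd724489d62710101095ab4304089c40510080000c993268c102044ca21050c0c4000d2820108102061809224489132694084285118005563028c000d58c06182860418226510824606280075630086080a504940000408301ae4ab92250c1020c0c112,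
  0x2b56ad5ab56244928304489c4051004302052030355282880d2800010101015ab56ac489124a081124809201000ead5a90c0c3050c00305561034a0610207080050c140d6ad5891224900810156aa50406ad4860a20186001c2050c08284002860a06b56,
  0xaf5ebd72448943060c192249418386081030402bd7ae489124a0c102ad593020359300840618205082000a06bd725593018602103001009224982022449303024a183860002706001821048912255c9a602941810a1418324489578608182055eb92250c18324941c30408182ae4c9c40402b26010c1028812104095eb2605080c301081834e080800e02bd7ae4891224982020c0c157,
  0x9122508306015eb92244c9948a0508086081034a0028524489948a05080860812500102420408202af5c9132652300420a18102940024a102922652300420a18102940250612101020c0922448994440908186001a6049408204089122651081440218206940a600040a706061060c009122448993ab100c4000d302024ca450484043040930104940050a101122448993288412303140430204093ab1014403100430209280009420506049124e0c0c20c18012244a1060c02bd724489430800303035eb9224489260204292250c00086100060606b92ae48943060019224941804e0810602489132652301420218204980a5000c2932651181860a2800298125000a10400189122652301420218204940042651181860a280029814206013810b081020416bd724489932914145030c1020494005264ca23030c0c400040a509082000c10157,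
  0x2ad5244899428801430208aa002800200280000084caa00280143040e9c3050c080480418205083060156ad4244ca154005000005100286050000410995400900140081d3860a2818a00024040c112a94e1808606182040899388000144009000860618007080a404040828418300ab56a122650aa00280103084c9c40204a200480043030c103044caa000800a0000e9c305140c500092010008954a70c0c3010c100044ca430280003480a101480008107083060156a92244ca14400218102550024005002400418426550014002180074e182860012402001028418300ab56ad5aa489240608913880620086081c40204923068c0a400002830406ad5,
  0x2558956244892506040840402b56ad5891224941820010100ad58912,
  0x2ad5aa4a993a74cf81020c013285230286001954208f808c08082a64e1810654f808c0a1818608123000c186244ca148c0a18006550823e02302020a99386041953e023028606182048c0030b08102080aad5244a1840848943060c923070c1020410155244c9943e02182028c1230008293a952201000a10408489943e02182028c1230012a548804042060e101020ea92a74cf81028c1230212a5488040c2060c192244e20288041c4000d2820448943060d2824a040840202ad5244c994290c10028563018a000c50408102a74c9a10200153268408028563018c000c3027c04504040810c48993290c11f027c001024e9a1028400246051800016a1327100810752a430206a43030c00001082040010112ab5491286102040400955aa489932854f808c081143e021823e04002044e9d34205080000c9d342001153e023023e02181028c00202189132854f808c081143e021823e04002274d0800454f808c08f8086040a300042c2040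82022448953a650a158c022810204a158c06300030c0c50408102274e99f0205182064ca43047c00146080800c10112,
  0x2564912244ec28020c994880a2818800127070c00088081a9040c1802448912b04ca4505100430514082044ca4505140c4010c10388040c30014283244a1050a494855210100004ac92244c9c306009d888081148c061818802202010c183860420424489d88a0812701101c3020c192269c02802a0183b3101c204081020214912b2a41040848913275e20088040c406109948a062008808144030c182860028524489948a0a20004a00c4070c004084c9c4069c004275e2818a0004406a00c2060e20206a4103064895952041832448994880a200049c0c3070c00352041c20a1491226522828a06200049c1c4030c00252041290aa420200009122448993b110102044ca4405100450209381860c04302102060248912,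
  0x24489132650a168e063008a0410028563018c000c504081022650a45040819328900022b14145010c08102049942a8c080285a3018e022808a040c40408213285a3008c062810318003285a3818c022818a001430514081024ca158a023010514083290c12402089c405140c400000000c0c058b1609122710127030c002020c112ae4eb14a858046000918146040558a091808c021820408113ad5920086081032652302045638246023028604081024ca142b140c500080142d180818c09180880810426563818c00194860920104009942d180818c091808e022028a001942d1c00246051814602301860a280029810200189132850b46011808246040158a0a280880810226522020456282460218102049942d180018c0a2828c022000650b4600091818a05180860a20002981000aa0102244ca144802282040c99428041158c0918086062808a0808126563818c022008a041d6480618204980800a489d68c0a202045518088022828606202030c00450040a80604180b1609132652b46031008306049942c8c1450518001aa8c0c50314144020c2132a8c0c5000ca24010c1020000994285a3818c02281048c0002b181450408113285a38103181230118045040cb23028c0a3011404304040132b181230114145000ab430290001880c1830c489942914102064ca440408ac505140430310101024cac60314044020ca4304900822710124031000000154030248994285a3008a000a405181012b1c1460314144020c213966809a026809a03540d503540d503540a3031000328900c30510002004ca169006380031c1230114147000cb23028c0a30114045030c14400053020414913aa8c0c7031000328900c304900024c0618008a0100501000301609122562c578606180030c1830a14012264ca148a08103024ca552a023000050b4702063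02460228204109958c0628006512008608100004ca158c091800250b4702023828e063018a0a28106089942d1c0818c091808c0228288001942d1c00246051814602280860808027551808a0a30004522828605200031018306189132850b4601180c5011408200562828808102265220204562824602181880808126591828a0a3008a022020650b4600091818a051808608093880a28188000000aa0102244ca142b180c500080142d1c0c60006382460228204109d54606381880019486092018a001002650b48025c0018e091808a0a3800650b47000918146051808c0628086080a604980020a489942d1804500052028c0a2000650b4600091818a05180860a2000298143001140102a02000602c58b162c12250c18125101a700002840406c12,
  0x2448912244c99388081022851280065230186080944a021818808101264e2020451281860a18100a008008101802448929080801224a410084142822448912264ebc40310102880021329140c40110100880a183070c0840810092244899327100800850a460204a2504940802894043010c0c4040c09327100802894043010c0c404061830610203b24891329141440110082880e180060c993880d380064ebc50314000880d401840c2440414192244c9c40408a25030c1430201401060d48552081000048912244ca4505140c4000d3828806180080892908a40810000912520c092b2a4100520800624494830248913af100c4010c1034e0538008a410052080420a141122448913b0a008426522028a06200069c14300022020a0c9290aa41020004912244891326522828a02201071010226522828a0620005101a8020218108102012448929080c09224a4181841428224489420a14112,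
  0x912244c9932a90145049000102049932710101024c9c404089a4031000000002830162c58244abc4069c0c300080830448993264cac601140c400063020204093264e20204009938808093880a20188001020014913264cac503140014808081264e202024e201480000008a0102244c9932b180018c0a2024800081264e202044e20288062000200212ae4eac602052024802180024e2028806180060d40102a01810602c58b048912af0c0c3010c1030604301244c99326563008a062010204081264c9c40404093271010226900a400000000a489932710102004c9958c06280880620002049c405100c4000c084500c092264c9c404080132710101271014403100020410957af101022710144030c00106a01005014000096095824489c4050c0a700081060606c582448957860a1818600183000c112264c9932b140018c0a2020204093264e2020204993880811348052000000005244c9938808080264cac603140014809200024e202880620006042280408913264e20204009938808113880a201024e20288021810008212af5e202024e201860010350040a80a001802562c12,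
  0x2bd7255c912aa5118100523028c040d5460618286040558c0a301860a1818600083040c100af5eb92244a180001491286000260808303055c912255d3034c001820608912264eac303140014c0d303024c99690023018a062018a0220004092800008112244c9968e02281880628088001024a0528002049d64c080d64c06180011025688093008406180041405627589c5040c113ab10123030c081860c0c400149d6268c08203592814a000440908200ac4ca44048c0828800256270c123020d2804c0c0d6ab14043050c0824a021034a00042040c2810d5c9572448a1446040558c0a30103563018602181075630186021818608103040c100ae4ab56264e1810608a134604093880a181060e2000a14956ac98101ac9804404082d6264e1800406b5546062008604125000a20484102000b5c956ac4e3020756302880a1810310004084c9932d180c5031404400080260212103044ab26050c004ac4e20246041250108183264cb4803140c40314044000812501081420604004ae489260608292275a3024600143020c9d58606280880a20003081024e101922555181860a18186001014e11382000c101af5c956ac509c4040c9a3030c101095aac5050c0c4010c1024a000030a4ab562714103271012302021810610993265a3008a0628088022010408013ab1414401101014a001420608105035eb92ad5ab13460618206940020214956ac4e302075620288021818608084ac4e20246041250000213264cb47031c0450110045031008204009d5880a20002981a500061030408281ae4ab9224982020c0c157,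
  0x2bd7af5ab56ac94180000eb56ac941800108102080abd7244a2040848944060c92606981020410157244c9948c0630086080a50008293ac4d1028600002841021226523018c021820294004ac4d1028600042060e101020ebd6ac4a2810204994860a2818a000420610192244e2828a06180060d3820448944060d3824e040840202bd7ad5ab564a040850248993290c1450314001024eac603180024a052800016b13271408107589a2050c0812688143030c00001082040010112af5c91288102040402bd724489430800303035ebd6ac4c994860a2818a000818410280ad58994860a2818a000c206100420408202af5c91224981810248943000218400181d7255ab13880a1818600002084ab13880a18186000038404081ae48943060019224941804e08112ad5a2810210994860a2818a0014206013824e040860806bd7ad5ab564a040850248993290c1440204093290c14402092800016b56ad1408107082040010157,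
  0x2448912250810204089122448913af1004405100c3040d38050042040010112244a105001891225082000a48913af1014403100024e0d3814e002005210181024891225082850004912244894204082022448912275e201880a200860812702a0002040831224489d788062028800127069c0a70004085244a10102a42030204912,
  0x255ebd7af5c91288040928605300000c012244a181009c181244930286000c30408303055ebd7244a18306493038608105244d2834c09280029c227060018224489932a8404603140004c08255288c001ab18146000aac6050c023030c1030608112244ca23050c0a300092830206b5627100c3050c001095ab4404021014c0c10302489132a84046020eac6030c1024a0130102049562710043050c080049c08084140420a043d7ae48913aa50a4502001554609180020c9d546041942b180c4000a1820098125021010224489942b180c400081d5460218204980a500040c20a021050c06bd72448994aa8c001ab18123020c1932a8c0c60114083ab0c146020928000081420a180d7ae48913285218105551818a08183aa4d181005630142021828a001a60200102ad5ab250600112ac4e2018608193880218186080022755182460012507080a500040818414301244ab92250c1020c0c112,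
  0x2a5424489d2860a20008880050a4ca52860c252860e103060e9523e0c1a2088c18005082040152a12244e94305100044400285265294306129430708183074a91f060d104460c0028410200a952a12a70c1c2020092205080050c140d4a84892308092040c04912a44c9a0020618304880054800352a44e18308129523e0c1a30688200a44d002004c9a002061830888042090800505082000b52a122490204244d1040a49184460c1820222a54a94e101860e104080039226529200600193a4801c306091830008913a50c1044400293a50c1c2060d10004900068410200a952a54,
  0xa548912a30c0040940a142a5620001181030050a9588000150400e838600205264e1820050e833a02183080e813264e20000080153a00e833a0218309081a1000c1420c18052a4489518600204a050a152b100008c081802854ac40000a8200741c30010293270c100287419d010c184074099327100000400a9d007419d010c184840d080060a1060c029522540a149d3a20000541000854ace28000002b38a00010c000860ce820050e803a0ce80061681388080153a00e833a0218308840030508306014a912a050a4e2a0a2020010a4e2a08a8206741430600293287419d010c18442001828418300a54a95125421800684202250c24306800800c100d2a54a892a10c0034210112861218340040060806952,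
  0x912244ac134e0c0d829140440310143000d382010c1020608012244ac92244a1810208312244d38050081290808993b1141440004093880a18009609c4020ebc505100c4050c0008406183030c1810a08092b248912860c0010648913af100c50002183860938100a41008414280b2489598804204264e20001609c504062014e001d8af1404305100804e0610386042430408192b24ebc4029410388021814e0a1000204993291014402053808608113af140c404054028802101024ebc4040a2004e0618184000430815484000c05924489420a149582652280880a201029c00226522028806200010c128020e1840aa42020004912244891327622020204994880a2018a00027030c180860c0810c04912,
  0x2a54254e9d2880e1810688200084c9939258016005801600580170114044000c183268822306021030410054a84a9d3a5101c3020d10400109932724b002c00b002c00b002e022808800183064d104460c0420608200a9529d3a708204084a9a2080c952860e181070c204004c9939458016005801600580450110003068c004264c9c402042132710081965801600580160058045000c193400cf82010822200161030410054254e9d2880a18008102d3254a181860c1838414013264c9c40204f800850a430000f83860c023061499327100003e0c194290c0003e0d002400a183088c1420802104041aa12248c1820c4a9d28802202094a283880e18100109932710081068c22301081824814292a74a28386041a2080c993a5100c300000230708122080520548100040352a12254e1800a169d38410253a50c1c3020d1040010993272cb002c00b002c00b008a0019f000d1000a4c9ca2c00b002c00b002c022808800183460210409081820802a12a74c9c4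050c0040814993287c1c307101040108202254e943020e184084ca1f06801430611182840c0c20a00354244918304189532710104a5141c4070c080084d180840c1240a14953a5141c3020d104064d104460e10202902a40800201a950953a64e202094a203860618300102932650a450001002860c223040210404180d4a84a9d32710104a5101c3030c180081499328522800080143061118201082020c06a54,
  0x957255ab562710083ab1414303100430408156268c0034a0a1810008312ad589c5020c9c4048c0828600105264cb2303140a3008c0024a00113ab140c400013024a040c20804084015eb92ad589938600101284d180004e2018600102881028625589938600101ad551818802181049400288102d6ac981018412b4206980440408204095c956ac4e3010556301860220101101840a4ab1388091810494004ad081a6050c003064c9932d1404603100450208126000c9932d200c5031404401100820494042040a104020eb9224941810848926060538306489d68c09181030c00427563018a02201880004206053834e081020200957255ab56268c043020d2820200312ad589c6020c9c4048c082055aac405100c3000d2828604005264c9968e063808a022008a062010408113ab100c400013024a040420804084015c912244a1830210101af5eb92250c18324941c304001810048913ac98080ad10126010c0028810204244ab26050c003064c9d54806280009812604009932d2004603140c40314044000812500089932d1c04503100c5011000204940c204940020206b13ac4e28104049d58805180860004304022040a4eb134604101ac940a500022048410256265220146000c40612b558a0218286041250108183ac4e18146001a504981a504021010418200af5eb9224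4a18300109124a0c0430604202035ebd7,
  0x954254e9d2880e18108881800c4c993925801600580160058017000d0004000183268c1a204021050410012a84a9d3a5101c3021110300189932724b002c00b002c00b002e001a00080003064d18344080420a08200a950952a44e18308029523e0c023088800305082850352a12a44c9a000010023e0a1830288185a44d002044c9a00000f823e0a1830888142080610408029d3a7082040d4c952860e1810810922090c183004c9939458016005801600580450110003068c004264c9c402042132710081965801600580160058045000c1933e0d00201081a2000e105044a9d28a0e1810888185264e94403100000108223068810148112030010054a8489d2a480043060c213288010344080028414281a84a9d3a50c1c30210006254d1000b4e1048600204264c9ca2c00b002c00b002c0228006800034600213272cb002c00b002c00b008a001a0000d100840c1c20a0825425489c306051030b489c3061210444080c20810953a5141c302111030a4d183440a1040290224060c000a950914a548f83000e913860c0230614112274a20386042220616913860c242088810101082850352a12294a91f06001d2270c180460c282244e944070c084440c2d2270c184841110202021050a06a54,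
  0xab56ad5aa489138a06182860018324901a404041820202ad5ab56ad524489c40310043040c112480e2010249183480518000141820356ad5,
  0xa54a952a54a95125421800684202250c24306800800c100d2a54a892a10c0034210112861218340040060806952,
  0xb04891224489d6ad18002ad1804403101440008193ad100440209301024eb44030c08329523018a022818800143050c0004c09302081008102489122561382081008124489584c04200004891329523018a022818800143000eb44010c14300093014c0400084142800162c12244c994880a1800098104860c0812448994880a18006980c304000420a00301b160912244d3014e02182040899329140440510083004c9c3040130184040c306041060248912244eb5688041d68c0220188081032652a47031404603140828a001d688021820498080275a2008806182044e181860802602040810c04912,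
  0x244a9d325468d13e0c003a3468c402040952b180002b180430000f82860cf820088185044a8d1a3100000054ac60000ac6010c0003e0a1833e0822204061050108286034e992a34689f06001d12a56300007c11f050c180440c2822544a958c0001f047c143061110203082808414301a74c951a3449c5040c022080e8942a56300000ca158c001450000f82860cf8208881000508286034e992a3468938a0818044101d12854ac600001942b180028a0001f050c19f0411102000a1050c04912,
  0xaa4aad5aa4891286000032449180010c1020c10155ab549128608105244d1834809180029420008089122752a440404254a9101004a0c083064e9d3a67c10004049d3270c10146080942a8409f040ca4605180430204a9f027c0c6010c1430000005274e99f04011834600093287c1430201181460d18109081030448954a9100804a00102274c9c302011810050aa1027c1032918146010c0812a7c09f0318043050c000084ca1f050c08346011828405180040610500043d5aa489932850f8286041153e063003e04004004e9d3420908004049d342080954204f828c06180008c18408089132850f8286041153e063003e0400426550813e0a301074e1824204023040c0c20a00301ab54912a9509c30404254a90c10227101430200003074e99326840830614994290c08128563018c0001f0514083084ca158c022810514003a6840c30408000264ca1f050c09f000c013a684121000518346001c2040c1060248912264e9d34201082040c0932850ac6031400200521813e08104a650ac60318002860a280068c0800008301aa4aa92250c1020c10112,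
  0x2b56ad5ab562449283064aa4305100c3010c0824a0c092880e1824a000040604056ad5ab5625552820449283880409227100c4010c1034a052000014182035ab56ad58954860a18088040d4860a1808a06100009414306101820206b56,
  0xa54a952a44894408109210884182a30824207080800c100d2a548912881021242110830546104840e1010018201a54a952,
  0xa54a8932678181287421c030c0c30816104064c99e0608a1d0870143050c205840a1040308306014a951264cf030250e8486102c2080c9933c0c1143a121840b0814208061060c02952a24c99e0604a1d08700c3030c20584101932678182287421c050c143081610284100c20c18052a5449933c0c0943a10e0186061840b08203264cf030450e84380a18286102c205082018418300a54a952,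
  0x9f3e74d8720216085c219330c100086824308161040508306013e7ce9b36101030cb042e10c84865819706641c30400d0486102c2080a1060c027cf9d366c20206196085c219090cb032e0cc83860801a090c20584101420c1804f9f3a6c39010b042e10c99860800434121840b0820284183009f3e7cf,
  0xa14094e270c2032668143080434e270c2052668243060610507389c3081499a090c1828416102030828501428129c4e184064cd028610086264cd0403082ce86121818410203264cd0405082ce8612182841024204061050a0285025389c3080c99a050c2010d389c3081499a090c18184141ce270c2052668243060a10584080c20a14050a04a7138610193340a184021a7138610293341218303082839c4e1840a4cd04860c1420b081018414280a142850,
  0x2bd7af5c91227100c4010c10304489c40310043040e18102492834c06200000c101015ebd7af5ebd7244a18306489c40510043020c9c405100430308102024a2034c092800014203035ebd7,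
  0x912244899329140a10110103064d2804a0804304081050048912244c994a71c0c601180c503140024202201060ead588001d588021820556281880a200880408227562018802182029402504001020a02bd724489932884044050c0834a002430408112244ca210110143020d28086081028414285004abd7244a20102493018600005060ab92244d2824a02181024d2824a02100860400100489124c040824e0030524493850a489270810993288804301100804a0c2134a0d2804c0a103060ab56ab18143020c9c505140828600213ad141440006203055aac50110143020d280860a103070808104489132888023030c0034a080d627100430405282840002704053848414006035eb92244ead58a040d58806200000aad5440005346051814201080420218206980a50010102244aad5440005346051814201080420218206980a500081420a14280ae489132651100009812506113010408912265118144001a504980a600040c20a0031224489a5069402602081270a14912275620188000a5069412500040a70a9c2000a0491224489934a0c1932884122010c0834a080260208106024ab92244c993880810126510828a061800694100055ab558a0a2008604193880a2810412b138802182029410084040820c04912,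
  0x2b12ac4ab1224941810608080ad5ab56ac4aa43010c0c4040ea43050c04503081014a0a1800608080015ab56ac489124804080ab552830556a44050c0c3000618384081c20014305035ab562448925020492402900000556ad4860a1818600101ab080a5070810284002860a06b56,
  0x2b56ac4ab1224941010608080ad5ab56244928304492838804092a910143030c043040d281860000506080d6ad5ab55,
  0xa950913a549002860c003a450a958c040c6000e1833c0022200101420814054a84a952293ca800650ac6020a281027801e010c19e0010213a4801024411103000a1040a02a54254a9523c0c180a454ac60204f003c021830888005044a9152b180813c00f00860c222000a1050b082050150912a7102430010213264c9c402040a3000c9d2400d0000688222010818404189122650a430000f03008c1a208092050c492054810207a848994290c0003c0d002088c12206061050a4a9523c0c1a20888181481520409529c3090c1c20215204840c1800352a12a54a91e060c0522a56301027801e010c18444002822548a958c0409e0078043061110005082858410280a84895388121800810993264e2010205180064e92006800034411100840c2020c4891328521800078180460d104049028624902a408103d4244ca14860001e068010446091030308285254a91e060d104440c0a40a90204a94e184860e1010a90242060c0012448913264c9c402040a20810994290c0004008f03088c12206001060248912264c993880408144102132852180008011e0611182440c0020c04912,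
  0xa74e9d3a74e94209080c30610180014e9d3a74a1048406183080c000a74e9922484080a50c24205080050c140d3a74c9124204052861210284002860a069d3,
  0x28d125428200404350a08010184142d0a108204264e59602580c50310083067c0c20908182264e59602580c50310083067c0c209080c206041050146892a1409c3030c1830016102060a8d1244ca148f18045000001d050c181400c2d026741c3020e104090808203409504004293272cb012c04b818a06201060e1043e04103a14210240041c20a1495040082d08411002084c9cb2c04b012e0628188041838410f81840c0a10404280a344950a04c9c30202181860c1800b0810305468929e4c9c40200194291e3000000a478c000430000f023a0a1830280185a04c9c30200e8386041c208121010406812a0800859f3e2c90258096025c0c5020c19327100003a0ce82030821f02081d0a108120020e1050a4a820041684208801049f3e2c90258096025c0c5020c19327100003a0ce82030821f030818142080850146892a141002021a85040080c20a168508410213272cb012c0628188041833e06104840c113272cb012c0628188041833e0610484061030208280a3468d0244ca1488000430674101400c2d027101c3020e1040802102060a8d1a0489942910000860ce820280185a04e20386041c20810042040c151,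
  0x9b3a6cd84142cc99162c502062c503100818b140c4030c08108121058410105013674d9b082859932101033264202062c58a080458a0a2020116282880a18200102420b082020a026ce9b361050b32642020664c84040c58b141008b1414404022c5051014304002048416104041404d9d366c20a1664c8b16281031628188040c58a06201860408409082c208082809d3a74e,
  0x2ad52448993287c044050c003068c082264ca1f0110143000c1a303080810414012244891326522823e04f808600183460418204009122494182004891326522823e04f8086001834604180840810225549124a142922494204264ca46027c0430201183084e9c401100c30409180840c1a302081010e48912244ca43027c0440409180860c204064892508112820218955264ca46027c0430201183084e9c401100c30409180840c1a302042c20408155aa48913a7101440008a508e063808c063008a06280027c11f010c081460d18008121010406ad5244ca1f050c0c4000118386042420004012244ca46027c043020d1824600081244ca46027c043020d182460002502021050a00912264ca1f007c0c3040d180088c0820448913a7100c4010c1014609180020528500489250800993287c01f030c1034600213a7100c4010c101460a103008c0814a08092244ca1f007c0c3040d1804604102244ca1f007c0c3040d18046040a5040528084142850156a922508285244a104084c9943e0228286001842650f808a0a180070818346041132650f808a0a18006109943e0228286001c2060d18184040820a02a92244c9943e02281860800446041132650f808a061820011181840408224489943e0228186081a300049943e0228186081a3010800003082800d54912248c0810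418912268c0a300089a3028c04202041250a14912268c12300049a3048c04200000a50a942000a06ad52448993287c1430510083008c082264ca1f050c144020c0230308081041809224489132650f828a04f80860818046042020404912249420202489132650f828a04f808608180460420184081022448942040c155,
  0x912253e794290c081993218102580470114003360218308127cf360c19f087c1800414051a248950a14218204001019f3e101033e7c20206197005c01700680452c00b002c0019b006c01b010c184093e79b060e7cf36081420000f843e0c0020a028d1a1421050a4c9c202067cf84040c92e00b802e00d803600d80860c21f00167cf84040c92e00b802e00d803600d80860c21f01082040414051a142105004c9c202067cf84040c92e0cb832e0cd83360cd83860801f08167cf84000492e0cb832e0cd83360cd83860821f0708200041a892244a74e2804043027411d000409f087c0020d4284408027cf84040cf9f08000360c01f087c00242142d0a1102049f3cd83073e79b040a100007c21f060508542100050346892273e64c860409b006c01b010c1843e00282253e64c860409b006c01b010c1843e001420a14280a2489cf9932180006c19b066c1c30400f840a0894f9932180006c19b066c1c30410f8303082800c4894f9e6c1803e10f800484285253e79b060cf843e0c0a10a842000a04912253e7cd9b30a0100026cc28040430000d83360cd8386082009f3cd83007c21f001010603468922542850860800304067cf84040cf9f08000865c197065c19a0714b022c08b02046c19b066c1c3041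004f9f080819f3e100006c19b0600f843e002020c06892,
  0xa346850a10c204004c9cd98500028608d803600d80081099f087c180840810501468d0a14218408009939b30a00050c11b006c01b00102133e10f8301081020a028d1a04e7cc2e00d808608d80360021f001610205427cc2e00d808608d803600242047c002841428501468139f30b83360e181360cd83007c20584081509f30b83360e181360cd83090809f0606105001a892253a7430206294045011404501140400e833a0011f087c0020d4284408027cf360c042047c21f00090850b4284408127cf360c1c2027c21f0605085421000503468d0264e61b006c01b010c1043e002c2040a813986c01b006c04304121023e001420a14280a340993986c19b066c1c30200f840b08102a04e61b066c19b070c0848404f8303082800d449129d38a02007419d0008f843e00106a142204004e1023e10f800484285a142204084e1013e10f8302842a10800281a346850a10c2000a4c9cd9850101360e181360cd83080099f087c004840810603468d0a14218400149939b30a02026c1c3026c19b06100133e10f8009081020c068d1,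
  0xa74e992244ca153a08e803a081149f100803a04e818608e8100049d12b180c402081153a08e8286040a10084021060c2808408182a74c912a5489c4010c143020c18402489942874143000ca158c02281033e2018a02200011010103449c5040ca9d04741430205080420c1852544a4f88063008a00043050c0004209082094a10344081800108103054e9d3a64891242040924205080000a9528408152440a10103080050c140d3a74c91224840818610052a508122020e1000a18281a74e9922484000a48814203080040a10092244ca153a00e8204521823a0620000068953a0a1810250e803a0002100841a1000c280244a8949f180c50314044000a182044e2023e040a202840042652745011004603140813a0a18002841c206002d2a44cf0086041c20012913860a18107081a2000c0858408182a74c9122650a1d050c00328562818a000ce8a022008c06281880414400040d12a7414302049c5027400042010830614042040c153,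
  0x9e54a952a54a95,
  0x993264c993264c,
  0x29d3244c99d0200a14293e2818a0220186041020274043001421326741002850a4f8a062808806181040409d010c005840c11326741012850a4f8a062808806181040401d030c085840e10101083060054a92264ce810050e808600284264ce820050e8086002c206089933a080943a061810b081c202021060c00a95244c99d0200a1d010c005084c99d0400a1d010c005840c113267410128740c3021610384040420c180152a489933a040143a021800a109933a080143a021800b08182264ce820250e8186042c207080808418300a6569d3,
  0xa142850a142850,
  0xa142850a142850,
  0xa952a12248820324882220404943088812200002810152a54244910406491044408092861110244000050202a54a952a54,
  0xa952a12248820324882220408943088812202002810152a54244910406491044408112861110244040050202a54a952a54,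
  0xab56ad5aa48913880a2018600183244e20186001c404089138804153880a200028c02306042020202ad5aa48912460c112480d201020aa544804054480a10184000c208003050356ad52448924060c92306901020752a240406a420490042020a1040018281ab56ad5,
  0x29d3244899428740430204a158a02281013a28188063008a0220003101030944a9d010c1032674145020508142000020508306014e992244ca142b180c500027c403140440008184a2527c40318045000a18186081a1000a8953a02182064ce828a0402102840800408952a488080064a9138802182860400226521813a0220207080a100040818418300a74e9922449083070c082a54a10344001c20204182034e9d32449083034a103440a100000808024489942a7409d0000a43027404404082512a74043040ca1d047410142050804204002044a952270c1430201101000c95226780430400113293a28188063008a0011d010c08342021010344a4f8c062818a02200050c103267c1440205101420210184000010308306014e992244ca149f100823a00e8086041153a04e803a00e8100109953a00e800744ac60310080860812102840a100001028418300a74e9d32448921060892106840800b4a942060e9420688100840408304069d3,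
  0x9f3c9129b2cc81320421d020a6cb3204c8108740c202041420d08286013e792253659800640430608993965804400040190200e800b3a6c3070c080841020584081829f3c94d264e596011000100125980664199070c1013a102ce9b0c1c3020e1040708082024894d9454a022a08099030c184272cb0288081190604e81040894d9454a022a08099030c184272cb0288081190604e81027c101841a1050c027cf244a6cb3000c80860c113272cb008800080320401d001674d860e18101082040b08103053e7929a4c9cb2c02200020024b300cc83320e18202742059d3618386041c2080e10104049129b28a9404541013206183084e5960510102320c09d02081129b28a9404541013206183084e5960510102320c09d0204f8203083420a1804f9e4894d96640990210e81053659902640843a06101020a10684143009f3e792253659900640023a002cd96641990604e84841000684081829f3c9129b2cc80320011d00166cb320cc8302742420800342040c14f,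
  0xa95244c99d0204a1d030c085084c99d0404a1d030c085840c113267410128740c3021610384040c20c180152a489933a040943a061810a109933a080943a061810b08182264ce820250e8186042c207080818418300a74c91326740812850a4f8a062808806181040801d030c085084c99d0404a14293e2818a02201860410100740c30216103044c99d0404a14293e2818a02201860410100740c3021610384040c20c180152a489933a040943a061810a109933a080943a061810b08182264ce820250e8186042c207080818418300a74e995,
  0x9f3cacf9e567cf,
  0x9d3a74e9d3a74e,
  0xa142850a142850,
  0xa142850a142850,
  0x993264c993264c,
  0xa1428502538993860c003264e18300681010d38993860c005264e182006820184141ce264e1830014993860801a080a105840808503428129c4c9c3040899386040c30600193270c101264e181010c18034080869c4c9c3040899386040c306002c20a4c9c3020499386000430400d0484100839c4c9c30404993860404306002c20a4c9c3020499386000430400d0484101420404281a14094e264e182044c9c30206183000c9938608093270c080860c01a040434e264e182044c9c302061830016105264e181024c9c30002182006824208041ce264e182024c9c302021830016105264e181024c9c300021820068242080a10202140d0a04a713270c180064c9c30600d02021a713270c1800a4c9c30400d0403082839c4c9c30600293270c10034101420b081010a06850,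
  0xa14285025389938608093270c080860c003264e182024c9c3020218300681020d389938608093270c080860c00584149938604093270c000860801a090820207389938608093270c080860c00584149938604093270c000860801a0908202840810503428129c4c9c30600193270c18034081069c4c9c30600293270c10034101420a0e713270c1800a4c9c30400d0405082c20408281a14094e264e183000c993860c01a040834e264e1830014993860801a080a1050738993860c005264e1820068202841610204140d0a04a713270c101264e181010c180064c9c3040499386040430600d02041a713270c101264e181010c1800b08293270c081264e180010c1003412104040e713270c101264e181010c1800b08293270c081264e180010c100341210405081020a06850,
  0x993264c993264c,
  0x2b3e7cf9f3e795,
  0x993264c993264c]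

def certs_10_5 : List ℕ := [
  0x24489122448912244c9ab0808993560c0ab0400993560c0935605580010c1810a101012448912264d584044c993880802b021158200142020248912244891326ac100264c9c4020558004ac2020a101012448912264d5820a4c9ab0609580064c9ab02109ab00ac182860c08508080922448912,
  0x2448912244899352080132651202860628000a018050082830c10112244891326a0181264ca2404940c3000140308a410006181822448912264c9a904a0003000c1870448912264c994480228186081a8000c0030618912244c9944a0618288001a902001020c4891326a0128020010254142810248912244c99350002280210993b098044050c082500c12900a4003060c3822448912264d403024ca45000d481500148100a01820418092244c99350041a90808994500540150001a804a0100060c912264ec4501101440005483024d4005004028060812a0a043012448912264d402004c9944a0520086081a800014820a0c2840248912244c9a8060499329141430290003500022804001850604912244899350080030618092244891326a0181060c3012448912264d404044c9a904009d8880620004a01a800a01825004203061c112244891326a400228a012802a012802114030408301244899326a00835000193265228200a00a806114825208283064891326a0080276220188000a906a00290605403040950502180922448913264d4015000204060c3822448913264ca24010c0c4040140108101830c48912264ca4601140c30401401080810624489935205400080812a0a140812448912264d482000c1870448912244c9a806041830e08912,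
  0x244ad5a256891224a41010210182016895a24495040210180b56ad5ab448912520c1010c04912541009224a818054140000a1095a256891224a41810010182004ad1224495050000284244ad5ab568912,
  0x2448912244891225721835604204060c180244891224489122448912,
  0x24489122508183060c912244891284180001048912244895b860d481060c1870e00912244895b520d48108100030648912264ecc401141450310144020c0932914125010c082520c1a9001428024489132914125010c08252014830810042060c2832448912256d4825200102041c012244895b860148202043002448993b31014503140440310002004ca250514043020548004a420500489132894145010c081520d480080210204101122448993b3100c505140440510002024ca4504940c3000148308a4103060c912264ecc403141450110144000809328940c5010c1005204229040812b0808912244ca4504940c3000d4815208102044891328940c5010c1035205480020558303083000e04912244891326522814a0220204094800a140050648912841800724489420a00312244c9944a0a2818800081521028056142020248912250830600049122448942060c2832448912264ca250314044040c029040c1830e48912264ca4504940c4000c0290408106244a10204ac284040491224495850808092244891225081830618912,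
  0x959b248959244a2020410182004acd92448993285218102552824a062828a04183024ca142a0918000521818c0810426551808c0628006552814a02182040000306489132850a8246000148606302041099546001954a052808608127029c000040a106001c0d9b366c922449380000c91250000440408304060acd9b3649128808105244938102a4200080c112244c994290c0812b18146031010306049d7288c1014e040142a8c0a30000aa303180430400a4303141450008200060c912264ca46050c0c6000c013af1814600093830208158b1609c4051400202149d8b11410003609c5000d40109081020808912264cac600093814e040142a8c0a30000aa303180430400a430314145000820204489132918043020d3824e00081b1609c5051008101609c5040a101500008303083000222cd9b36491224a01830648927060e20204101820164912264ca142b180c600080148c0a1818c00104004eb944a000d78c0a30004049958c080958c0a180009c127061020306489132850ac603180020052302860630004109958c081958c06182009c0a7040c1028418007b24ac58b04e2018a001820a10958b04e282880010107082800d64913b04e280021019326521818a001808408112b04e2820008994860628007080818410005b2489270408292b162282000c9948606300030810252102122510081521148300101820366c92244c994290c0812a941250314145020c1812650a430204aa305180c5040c2132a8c0a301180032a940a5010c10200001832448994290c0812a8c1460314103084ca1505180032a940a5010c145000938100081420c003812448912264ca574a000148606302040c09328551814600014860628204109954606300075e300860a3010400003061c0d9b2489132650aa50494083290c0c5040818126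50aa3028c000290c0c404082132a8c0032a940a5010c1024e04000060ec58b1613830010192b04c9c504000d8271008327101440000183264ca430314102024ca4303140034e0804204081020e06cd9244899328552824a041948606282040c093285518100521818a0810426551818c001954a0528086081270200003064ac58264e282000ec138808193880a2010004184b04ac588a08002024c9948604127060499486041a7049c0008408102041c09224489132652ba50200a4303181010604994290c0812a8c0a300002132a8c045000ebc305180024e04000060c3812564912b2489440408304060ac92,
  0x91224489932850b47031804502080158c0a28204081132852282040c9944c001158a0a3008604081024ca154a040142d1c0c601140818a081042650b4701180c502063000650b4701180c5020a300860808126562818c001944c02182044e2828a062800000003080c0122448913264c9c40204081264c9c404040932a980c5029800227140c50000000080c100b448912256ad5986061828600101081008124489932851302040c0932850ac603140020050b47031c045020628204109958e0630006523008608100004ca142d1c0c701140c500080158e0a28204089942d1c0c601140c500062820650b460318045020a28086080802650ac603140018a081144c0a18102a0044060c1830648993264cac603100c50008100004c9938808080264e201024e2028806200060c184244c9938804081264e202024e2018a00000064ca142d180c601140820050ac601140818808102265220204562828e0218102049942d1c046031404502062800650b47031c0450114082860a28002a010084081020448993264e2020400013264e20202009932b180c403140440004093880a20188001830614913264cac5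03140440204081264e202024e2014c00000084ca148a081032650a010450ac60314001860628202049942b18045020a28006521824c0012802021030408913264cac503140440204081264e202044d3018800000084c9938804081264cac601140c402081134c06200000210306489932b1804401140c40204093880a2018800003264e201024e2028806200010810226513000450ac60114081860628002a01c20510042020408102100122448913264caa605141260004081264c9c40404093271010227140c500000000a0c080b44ad12244891386001a805100820404384036ad122448959860618286001830000203244ac93b1623018608183024ec142d1c0c700052824a080d78a092818a0618206109958e0630106523018608100004ca142d1c0c503180028e000158c0a28204089964a0a3808a0a28006592818e063808c0218202009958c0a2808a08114860630002a0183040c192264c9938808100004c99f2a00a802a00a802a00a802a00a802a00a808c0a30002049938808113880a201004e20088080840614913264e20202009958a093008a000938806200060c2132852282060ca158a0a30086040a806049958c062808a041948c06182044d301880a28000021030408092b24ec572a023820250b4702023828a0a3818c061820608113b15ca808e040142d1c0818e0a2828e02300860810426592824a0a3808a081964a052818e022818608081004ca148a0810326563018a001944c0218204009948a081158c0a28086040a80608086244ca158a081142d1c0028e063018e00002265228004563808a0a1818a00081265a3824a062828a041164a0a3808a0a280860402806a00840a4ca168e092808a081158a0a30188081842650b4700063828c0a380065a3818a063808c0218202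a010126563808a04194860a201044e2828a06280000210404089132850b4700063828c080954a0638000109958e022808a04194860a28004009968e092808a0a28006592818e022818a0218202a01280008293264e202020499388081138806200020210408489942d1c0018e0a3808a023020650b47000a3818e02280860a301031002804109938808093880a200004e2818800142060c9958e022808a041d88c06182051002803081420604080001005ab568912256494304014028804085021c092244c993265630188062800518000080099327100c4000c193271010027100c404081030808912264c9c4000c013271008126562818a001260298000060c093264cf9500540150054015005401500540150054046051800106049932656300029812600041c206049932710081004c9c404009c40310002024c9c404049c405100002710044040a101081428124489932710002004c9c402049958a0628004980a600002030248913265630004980c402980022710144031000004009932710100084c9c404049c40310002024c9c404089c4051008027140c4000610200100132650b25031c0c70000ac605140450408102264cac705180010360a460200a43031800106049932b1414601140010252c460404a4303181020708181b24ec46030c103024cb470518125031c0c50314102500c158285a3818e000a504941012c9414701141430204ac703140460202bc504940c5030c04305100830050ac603140430402103500540202149932d1c0c5031c04601140010250ac70000b4704940450514002285a380031c14701140430318101084cac70114045020ec46030c10288014010050ac505180c3000d402840140107082000c00005b44ad122448959860218286041020808384036ad122448913860412807100010a00203244ac93b15ca808e080942d1c0808e0a2828e063018608182044c9964a052818e0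22810206c572a0238100592824a0a3808a080942d1c0818e0a2828e021818c02182041001326563018a001802850a0200521808a08183265228204563028a0218102a0182020c192244c9948a00101285628204563808a0a1810250b47000a3818c063808a00002265a3824a062828a041164a0a3808a0a280860402806a00840408993264e2010210013267ca802a00a802a00a802a00a802a00a802a013014c00003264e201024e2018800181024c9938804082264e202044e20288040138a0220202121020610112244c9948a001002850b4700063828c080954a0638000563808a061828a00004265a3824a022828a001964a063808a0628086080a804a000204089122650b4700063828e022808c081942d1c0028e063808a021828c040c400a0101024c9932b180024c0530000109938808093880620004089938808093880a200004e2018800142020418128509934c080938c0a1020210194264e301004d3018404001287ca802a00a802a00a802a00a802a00a802a02380005630086080168e0a3024a023808a081158a06300860a280840800401649d88c021820404a158e080d78a0928086062800450b4702023828a0a3818c0618206089968e0a3024a023808a0228206592818e022818a0218202a010028563028a02181030812800a0181064c9968e0a2828e023008a001802856380025a3824a062828a041942d1c0028e063808a021828c04002276230204563808a0228286040c400a018128562828c0218104a01c202a00038408106001001224489132650a168e063008a041002b1814504081022650a45040819328980022b14146010c08102049942a94080285a3818c022810314102084ca168e023018a040c6000ca168e023018a04146010c101024cac50318003289804304089c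505140c50000000001c201244ad122568912,
  0x244ab5624489124a101000e14156ac489122494202001c282ad5ab56ad5ab56ac489124a0c1010e14156ad589122494182021c2822448912,
  0x9122448912244c994a684100a6840210684003080499346102142854ac6000001f0610a9f007c19f010c183014ca152a08a950110000070c180460d18302183030248912ab551810818303244aad5460018604489942854ac6000001f06102932a7c01f067c004460c1d32854a822a5404400001c30611182460800284183000048912264ca53420805342010834200184024c9a30810a142a563000000f830854f803e0cf80860c180a650a950454a808800003860c023068c1810c181812448955aa8c0840c181922556aa3000c302244ca142a563000000f8308149953e00f833e00223060e9942a541152a02200000e183088c12304001420c18000ab549132650a9f007c1832854ac4000019f047c1000a009d3a6841a1000c093a6841812854a822a54044000001f070c000461028506489942a7c01f060ca152b10000067c11f04002932854a822a54044000001f06129c30684100460c20284180070356a92264ca143e0c1953e08f820014013a6510834200181a64d0810854f833e0e180008c2050a0c9132850f830654f823e08005a654f8386002134200f83068c18405083000e04912244c9942854ac600022820600a14860409f067c0030a0099346102532884183a6841a1010c183024ca152b180008c0801f06129c30684100460c005061c09224489932850a958c00045040c014290c0813e0cf800614013268c204a651083074d083420218306049942a5630001181003e0c253860d082008c1800a0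c3812448913274e9a1008418308049942854ac500023020600a14860409f060c2d32a54a46020001529180808a0001f047c11f050c1844608000061c0922448993a65108306100932854f833e0c205a650a958c00046040e183088c100000c3812448912,
  0x912b448912541831224a8285264e104084c9a806109d84c0218288062000508183500411326a010026512818a0218200a00c20611482000c187056891224a830624495050a4c9c20810993500019328940c30510000840c22904001830e089122448993500409326512024a0618006a01005208003061c112244891326a4100264ca24050c0c5000d40200a0081060c1082448912256ad122448929060c1030404912541831224a8285264e104084c9a806109d88a0618288022010508183520019326a0142060c9944a06280860a18106a01005004083060845a244892a0c1891254142932708204264d400064ca4601140c3040210308a0081060c3822448912264d482000c1870448912244c9a802041830e08912,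
  0x912b2489592448a144a001948c061820452300860a281005230086062028600082080c10101649122448913b29c10050082800010212b366c92249c18325101a804002030220912b364a148c041144a0a3000052301860a28086041148c021828a061808604002000c1d9b24892800009944a02182860220100a0083080ec5826512800710104840c193289c1822651200880814204089934a040948a09281860628084040c40606200024c9944a081022651200880414204089944a0a2818a0218207100a8041220084000060e084122448912b3654014e0018500002042566c92244938000149124e000595005380080c1851048959b24d40200a0082060ecd9b24940188001010362c132894082880c14206109932894102044d381880c0d8289414305140034e0538184081c40000993291012502081584e0e102044ca4504940c5010c081880d402031004200043070420912b2489125008006080c0d9244acd92448912500408506080d9b366c92b162c134a0a201009c0840760a134a040a70606c578a0628086081a70310000840c2060e18159b364958b1609c404940814e00182b162bc50514043020538302509a5040d3818800042060c3070c08912,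
  0x91224489932852282860411446022020010203061801224489132652aa3028c0a3028c0230000a2303141020810993288c0a3000c1a702041830c00959b364912249c1830648928060e202041038208489128418306b364912249c1830448928060eca70510181020c092264ca14460411446022020010994460630086081a70208283244c994460228286041a7001011326511818c02182069c0a70012101020491328511810451180880800426511818c02182069c08206489944602181069c00226511818c02181069c042020548303082850a0c059b2489132650a23020aaa3028c0a3008c023028c0000810993288c0834e09380089c081060c9122650a23020aaa3028c0a3008c023028c000084ca23020d3824e01381020c1c20c183002448912264ca55291c0804605181460118000511818a08104084c9944605180069c1034e0409327551814605181460118046001a7020ebd786081578c0620288040d7880a2018800002275e200880a201029c1a7009c100000c1860166c92244c99429141430208a23011014502002040648993288c043000c1a702089932914145010c003069c0c202040830c009122448959b29c0830a1428408489122566ca70200285060c912264d381024ebd78c040d78c06200880a20102089d7880a20188000a700000132852ac7011804501140c40200194460630202109944606182069c0822652ac60114047031004602081d78802182049c0a7029c0000a0c192244ca14ab1c0460114045031008006511818c08084265118186081a70208994ab18045011c0c40118082075e2008608127029c0a7000018384183060166c92244c994288c082288c0440400213288c043020d38002141832448994288c082288c0440400213288c043020d380020c1c20c183002448912b3649128808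106080c1122564912,
  0x2ad52448993287c0430010223040c993287c04300102230508102061801224489132650f823e021800811182080c1802448925080c012244c9943e08f8086002044608200840c1832448912264ca148a0809f047c0430010223041018300489124a1018024489932852282027c11f010c004088c10401081830756a92244c9943e021800811182064c9943e02180081118284081030c02ad5244a1060c489932852282027c04304111800a0c9932852282027c04304111800b08102244ca148a0809f010c10446001932852282027c043041118084081420a141860154912264ca148a0401f030c1804608283264ca148a0401f030c18046082c20408192244ca148a0401f030c18446041132852281007c0c3061118184040828418007aa4891246081030e489134609180064d1824602102040d2860c48913460d181044d183460610102092864a14006024aa92249430624492850a4c9a300109943e0cf81860c0420815182060c08824489122650a44040a1813e001a3001428424492850a941810e4aa93268c0042650f833e0618301082054608086840c183ab549122650a508e063808c063008a062800204f833e00123088c0050b081030556a922650a440000f8386080a3081610104049122650f833e06183088c08204489943e0cf81860c2230205282030830600489132650f803e0a1800815182060c912268c1a302081250c009124a14013268c1802650f803e0a1800908005460812506089122650f803e0a180088c10306489943e00f828600223040928304940420c1830025549124a183122494285264d180084ca1f067c0c306021040a8c103060441224489132852202050c09f000d1800a1421224942854a0c08725549934600213287c19f030c18084102a30404342060c1d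5aa489132852847031c04603180450314001027c19f000918446002858408182ab549132852200007c1c304051840b080820248913287c19f030c1844604102244ca1f067c0c30611181029410184183002448993287c01f050c0040a8c1030648913460d181040928600489250a00993460c013287c01f050c00484002a304092830448913287c01f050c0044608183244ca1f007c143001118204941824a021060c18055aa489420c1891284142932650f8086002052650f8086002420811182064c9943e0218008149943e021800908204460a102040c300aa489132650f81860c00546081932650f81860c005460a102040c9122650f81860c22302089943e06183088c0c202041420c003d52448923040818724489a3048c003268c1230108102069430624489a3068c082268c1a3030808104943250a00301ab54912264ca1f070c184008c103264ca1f070c184008c14204081870248912244c9943e0cf81860c20046082830604912249428302489132650f833e0618308011820a06103060c91224489932852281007c19f030c184008c105060c09224492850604912264ca148a0401f067c0c3061002304140c2060c1d5aa489132650f83860c20046081932650f83860c200460a102040c381aa48912840c203244894206101d5,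
  0x912244c99f0a009cd9b30a00040a6cc28001430408d803600d800a7c0050618051a340993840811327081029b36614000814d9850002860814d9850002860a102046c01b006c0050a0e850861429327080813e14f840400300a3468132708102264e10205366cc28001029b30a00050c1029b30a00050c1420408d803600d800a141d0a10c285264e101027c29f08080060048912264cf85004e6cd98500020536614000a182046c01b006c0053e002830c028d1244e7c92e00b802e00d803600d800a7c006064a7c92e00b802e00d803600d800a7c003841830601449139f326430204b843610d84361001f0a181929f326430204b843610d84361029f080a106001c9129f3cd84007c29f000d0860c4a7cf361021f0a7c202421908500180d1a3428420c18993840814f9f08102925c017005c01b006c01b0014f800d3e7c2040a497005c017006c01b006c0053e021050a0c300a3428420c00993840814f9f08102925c217085c21b086c21b0800f850d3e7c20206497085c217086c21b086c2053e12105000c3d1244894e8a500140050014000e294045011404501140400e833a001023e14f80061e850881404f9f081029f3e101026c2003e14f800684306a1422050b3e79b08127cf360c1c20204f853e101210c842800c068d1a1421060c4c9c2040899384081492e00b802e00d803600d800a7c006264e1020524b802e00b803600d80360029f01082850618051a142106004c9c2040899384081492e10b842e10d843610d84007c286264e1010324b842e10b843610d84361029f0908280061e892244a74e280801d0674002047c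29f000c3d0a110280264e102047c29f000d0860d428440a14993840409f0a7c202421908500180d1a2489939932182046c01b006c0053e00303244e64c860811b006c01b0014f8007083060c02892264e64c860409b086c21b0800f850c0c9139932181026c21b086c2053e101420c00392244cf853e001a10c189133e14f8404843210a00301244891327366cc28080819b30a02030c0813610d843610280267c29f001418703468d0a1421850018993840811327080819b3661404040cd985010186040cd98501018606101026c21b086c205004c9c20408f853e002830e068d1a1428430a003132708102264e10103366cc28080819b30a02030c0819b30a02030c0c20204d843610d840a00993840811f0a7c005061c09224489939b3661404040cd9850101860409b086c21b08140133e14f800a0c3812546892,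
  0xaf5ebd7255eb92249418224981a502042030404057af5ebd7af5ebd7ae489124c0c1124a0d28100142030406bd7af5ebd6,
  0x29d3a6489132850e820050e8386002022654e833a0c12100840210810300840c203a74c9122650a9d067401d060ca149f10080007411d047414306001132744ac603100820404b9d067401d0074182420108042102060108184074e9d3a648952a44e20086082050a049132854e833a00e8306089943a0e18004842050c48994293e2010000e823a0a18302841a1061694208881840002103080e9d3244a9522710043041028502489942a7419d0074183044ca1d070c0024210286244ca149f10080007411d050c181420d0830b4a104440c2000108184074e9d3a64a952440c142001891242081124209081014a103840a1000a0c386034e9d3a44a94206881050848921040a18584140070c069d3a64a922070810524840c2080030502489132850e8308521833a080022654e803a0e1833a0012100103002448994293e3018a062800408f813a001a202840052650e83860012109082000d4a9133c021820908005a44e18209082220010086840c203a74e9922449082050c280a54a10344082420018386034e9d324490810149103840a1000a1828124489942a7401d060ca14880004306741000544a95860409d0608a1d02740804201084420020600489519f3e1820530a002800a00028009d0074003264e202027c10144050800a4ca149d1404401180c5020409d070c0024212104001a952267804304121000b4899386080c3041210444002010d08184074e9d3254a922060a1000c4892104089210484080a5081c20508005061c301a74e992244c9a10814a143a0e1800854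e803a0e1833a001820c02103080e9d32448993421029428741c30010a9d00741c30674003041804206101d3,
  0xa54a952a54a952a452914a54a952,
  0xa952a12248828424882a206089430a881a202003010152a5424491050849105440c112861510344040060202a54a8489220a109220a88182250c2a206880800c04054a95091244142124415103044a185440d1010018080a952a54a952a54a952a54,
  0xb366c92244892708082830402cd924489124e101830e18159b248912249c203061c302256491225649a702013810a103050966c92244892708082830402c92b2489124e10203080c0d9b364959244892708101840606c922448913b29c1014e082840a203922448913269c2022765383029c1810c10404b366c93,
  0x2bd7af5ebd7ae4892506089260694081080c101015ebd7af5ebd7244930306492834a081122710144030c0024a0d30100142030406bd7af5ebd7af5ebd6,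
  0x2a54913267410128740c30218293267418128740c3021a104064c99d0608a1d050c106841210203083870054a952a54913267410128740c30218293267418128740c3021a104064c99d0608a1d050c106841210203083870054a95244c99d0404a1d030c0860a4c99d0604a1d030c086841019326741822874143041a10484080c20e1c0152a489933a080943a061810c149933a0c0943a061810d08203264ce830450e8286083420908101841c380a654a952a54a95,
  0x9f3c9129b2cc82320829d040e6cb3208c820a7414204081c20e1c04f9e4894d9660c430400019000c99396580c402080990400e800c1a103080e7cf253499396580c402080859660c43040021908642023a14342040c1122536598310c0810464105264e596051010200642023a081832536598310c0810464105264e596051010200642023a0811f060a1070e027cf244a6cb30621820000c80064c9cb2c062010404c8200740060d08184073e7929a4c9cb2c0620104042cb30621820010c84321011d0a1a10206089129b2cc1886040823208293272cb028808100321011d040c1929b2cc1886040823208293272cb028808100321011d0408f830508387013e792253659904641053a081cd96641190414e828408103841c3809f3c9129b2cc82320829d040e6cb3208c820a7414204081c20e1c04f9e4894d9660c430400019000c99396580c402080990400e800c1a103080e7cf253499396580c402080859660c43040021908642023a14342040c1122536598310c0810464105264e596051010200642023a081832536598310c0810464105264e596051010200642023a0811f060a1070e027cf244a6cb30621820000c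80064c9cb2c062010404c8200740060d08184073e7929a4c9cb2c0620104042cb30621820010c84321011d0a1a10206089129b2cc1886040823208293272cb028808100321011d040c1929b2cc1886040823208293272cb028808100321011d0408f830508387013e792253659904641053a081cd96641190414e828408103841c3809f3e792253659900640033a0034d96642190808e858414007840c2039f3c9129b2cc80320019d001a6cb3210c8404742c20a003c206101cf9f3e792253659900640033a0034d96642190808e858414007840c2039f3c9129b2cc80320019d001a6cb3210c8404742c20a003c206101cf,
  0x9d3a74e9d3a74e9d3a74e9d3a74e,
  0xa142850a142850a142850a142850,
  0xa142850a14094e264e1840010993861001a06083ce264e1840018993860c01a0a0a10609389938610006264e1830068283841a10304180d0a04a713270c200084c9c30800d03041e713270c2000c4c9c30600d0505083049c4c9c30800313270c18034141c20d081820c0685025389938610004264e18400681820f38a1a0418a1a0a68282841824e2868186286829a0a0e106840c10603428129c4c9c30800213270c200340c1079c4c9c30800313270c18034141420c12713270c2000c4c9c30600d0507083420608301a14094e264e1840010993861001a06083ce264e1840018993860c01a0a0a10609389938610006264e1830068283841a10304180d0a04a713270c200084c9c30800d03041e71434083143414d0505083049c50d030c50d0534141c20d081820c0685025389938610004264e1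8400681820f389938610006264e1830068282841824e264e1840018993860c01a0a0e106840c10603428129c4c9c30800213270c200340c1079c4c9c30800313270c18034141420c12713270c2000c4c9c30600d0507083420608301a142850,
  0x2a54a952a54acf9e54a952a54a95,
  0x993264c993264c993264c993264c]

theorem all_2_1 : checkAll 2 1 [] = true := by decide +kernel

theorem all_2_2 : checkAll 2 2 [] = true := by decide +kernel

theorem all_3_2 : checkAll 3 2 certs_3_2 = true := by decide +kernel

theorem all_4_2 : checkAll 4 2 certs_4_2 = true := by decide +kernel

theorem all_2_3 : checkAll 2 3 [] = true := by decide +kernel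

theorem all_3_3 : checkAll 3 3 [] = true := by decide +kernel

theorem all_4_3 : checkAll 4 3 certs_4_3 = true := by decide +kernel

theorem all_5_3 : checkAll 5 3 certs_5_3 = true := by decide +kernel

theorem all_6_3 : checkAll 6 3 certs_6_3 = true := by decide +kernel

theorem all_2_4 : checkAll 2 4 [] = true := by decide +kernel

theorem all_3_4 : checkAll 3 4 [] = true := by decide +kernel

theorem all_4_4 : checkAll 4 4 [] = true := by decide +kernel

theorem all_5_4 : checkAll 5 4 certs_5_4 = true := by decide +kernel

theorem all_6_4 : checkAll 6 4 certs_6_4 = true := by decide +kernel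

theorem all_7_4 : checkAll 7 4 certs_7_4 = true := by decide +kernel

theorem all_8_4 : checkAll 8 4 certs_8_4 = true := by decide +kernel

theorem all_2_5 : checkAll 2 5 [] = true := by decide +kernel

theorem all_3_5 : checkAll 3 5 [] = true := by decide +kernel

theorem all_4_5 : checkAll 4 5 certs_4_5 = true := by decide +kernel

theorem all_5_5 : checkAll 5 5 certs_5_5 = true := by decide +kernel

theorem all_6_5 : checkAll 6 5 certs_6_5 = true := by decide +kernel

theorem all_7_5 : checkAll 7 5 certs_7_5 = true := by decide +kernel

theorem all_8_5 : checkAll 8 5 certs_8_5 = true := by decide +kernel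

theorem all_9_5 : checkAll 9 5 certs_9_5 = true := by decide +kernel

theorem all_10_5 : checkAll 10 5 certs_10_5 = true := by decide +kernel

end BP

namespace BP

theorem all_exists (w m : ℕ) (hw : 2 ≤ w) (hwm : w ≤ 2 * m) (hm : m ≤ 5) :
    ∃ cs, checkAll w m cs = true := by
  have h1 : m ≠ 0 := by rintro rfl; omega
  obtain rfl | rfl | rfl | rfl | rfl : m = 1 ∨ m = 2 ∨ m = 3 ∨ m = 4 ∨ m = 5 := by omega
  · obtain rfl : w = 2 := by omega
    exact ⟨_, all_2_1⟩
  · obtain rfl | rfl | rfl : w = 2 ∨ w = 3 ∨ w = 4 := by omega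
    exacts [⟨_, all_2_2⟩, ⟨_, all_3_2⟩, ⟨_, all_4_2⟩]
  · obtain rfl | rfl | rfl | rfl | rfl : w = 2 ∨ w = 3 ∨ w = 4 ∨ w = 5 ∨ w = 6 := by omega
    exacts [⟨_, all_2_3⟩, ⟨_, all_3_3⟩, ⟨_, all_4_3⟩, ⟨_, all_5_3⟩, ⟨_, all_6_3⟩]
  · obtain rfl | rfl | rfl | rfl | rfl | rfl | rfl :
      w = 2 ∨ w = 3 ∨ w = 4 ∨ w = 5 ∨ w = 6 ∨ w = 7 ∨ w = 8 := by omega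
    exacts [⟨_, all_2_4⟩, ⟨_, all_3_4⟩, ⟨_, all_4_4⟩, ⟨_, all_5_4⟩, ⟨_, all_6_4⟩, ⟨_, all_7_4⟩,
      ⟨_, all_8_4⟩]
  · obtain rfl | rfl | rfl | rfl | rfl | rfl | rfl | rfl | rfl :
      w = 2 ∨ w = 3 ∨ w = 4 ∨ w = 5 ∨ w = 6 ∨ w = 7 ∨ w = 8 ∨ w = 9 ∨ w = 10 := by omega
    exacts [⟨_, all_2_5⟩, ⟨_, all_3_5⟩, ⟨_, all_4_5⟩, ⟨_, all_5_5⟩, ⟨_, all_6_5⟩, ⟨_, all_7_5⟩,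
      ⟨_, all_8_5⟩, ⟨_, all_9_5⟩, ⟨_, all_10_5⟩]

/-- The conclusion of the computation. -/
theorem comp_final (w : ℕ) (l : List (ℕ × ℕ)) (hl : l.Sublist (pairs w)) (hw : 2 ≤ w)
    (hm : l.length ≤ 5) (hc : ∀ i < w, ∃ p ∈ l, p.1 = i ∨ p.2 = i)
    (hcan : canon w l.reverse = true) (g : ℕ → ℕ) (n : ℕ)
    (hn : n = (mins w l.reverse).length + 2) (hev : Even n) (hpos : pos g w = n)
    (hg : ∀ i < w, 1 ≤ g i) (hodd : ∀ p ∈ l, pos g p.1 % 2 ≠ pos g p.2 % 2)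
    (hadj : ∀ i < w, (i, i + 1) ∈ l ∨ (0, i) ∈ l ∧ i + 1 = w → g i ≠ 1)
    (hlen : ∀ L, 2 ≤ L → L ≤ n → Even L → L + (mins w l.reverse).countP
      (fun c => decide (L + 1 ≤ wlen w l.length g c)) = n) : n = 14 ∨ n = 22 := by
  have hwm : w ≤ 2 * l.length := by
    have := card_cover l (Finset.range w) (by simpa using hc)
    simpa using this
  by_contra hne
  obtain ⟨cs, hcs⟩ := all_exists w l.length hw hwm hm
  have hlt := pairs_lt w (by omega)
  have ht : test w l.reverse = true := by
    apply test_true _ _ hcan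
    · have := (Nat.even_iff).1 hev
      rw [Nat.even_iff]; omega
    · omega
    · omega
  have hmem := gen0_mem (test w) w l.length (by omega) l hl rfl hc ht
  obtain ⟨c, hc'⟩ := checkList_mem w _ cs hcs _ hmem
  refine chkDiag_sound w l.reverse c (by omega) ?_ (by simp; omega) (by simpa using hm) g n hn hev
    hpos hg ?_ ?_ ?_ hc'
  · intro p hp
    exact hlt p (hl.subset (by simpa using hp))
  · intro p hp
    exact hodd p (by simpa using hp)
  · intro i hi h
    exact hadj i hi (by simpa using h)
  · simpa using hlen

end BP

set_option linter.unusedVariables false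
namespace BP

/-- A set of edges for which every vertex has even degree. -/
def Ev {V : Type*} [DecidableEq V] (F : Finset (Sym2 V)) : Prop :=
  ∀ v, ∑ e ∈ F, (if v ∈ e then 1 else 0 : ZMod 2) = 0

/-- A minimal nonempty even set of edges. -/
def IsCyc {V : Type*} [DecidableEq V] (F : Finset (Sym2 V)) : Prop :=
  F.Nonempty ∧ Ev F ∧ ∀ F' ⊆ F, Ev F' → F' = ∅ ∨ F' = F

/-- A cyclic sequence of `n` distinct vertices. -/
def CInj {V : Type*} (n : ℕ) (φ : ℕ → V) : Prop := ∀ i j, φ i = φ j ↔ i % n = j % n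

/-- The edges of the cycle. -/
def cycE {V : Type*} [DecidableEq V] (n : ℕ) (φ : ℕ → V) : Finset (Sym2 V) :=
  (Finset.range n).image (fun k => s(φ k, φ (k + 1)))

theorem mod_succ' {n k : ℕ} (h : k < n) : (k + 1) % n = if k + 1 = n then 0 else k + 1 := by
  split_ifs with h1
  · rw [h1, Nat.mod_self]
  · exact Nat.mod_eq_of_lt (by omega)

theorem mod_pred' {n k : ℕ} (h : k < n) : (k + n - 1) % n = if k = 0 then n - 1 else k - 1 := by
  split_ifs with h1
  · rw [h1, Nat.zero_add]; exact Nat.mod_eq_of_lt (by omega)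
  · rw [show k + n - 1 = k - 1 + n by omega, Nat.add_mod_right]
    exact Nat.mod_eq_of_lt (by omega)

theorem CInj.ne_succ {V : Type*} {n : ℕ} {φ : ℕ → V} (h : CInj n φ) (hn : 3 ≤ n) (k : ℕ) :
    φ k ≠ φ (k + 1) := by
  intro h1
  rw [h, Nat.add_mod] at h1
  have h2 : k % n < n := Nat.mod_lt _ (by omega)
  rw [Nat.mod_eq_of_lt (show 1 < n by omega), mod_succ' h2] at h1
  split_ifs at h1 <;> omega

theorem CInj.edge_inj {V : Type*} {n : ℕ} {φ : ℕ → V} (h : CInj n φ) (hn : 3 ≤ n) :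
    ∀ k < n, ∀ l < n, s(φ k, φ (k + 1)) = s(φ l, φ (l + 1)) → k = l := by
  intro k hk l hl h1
  rw [Sym2.eq_iff, h, h, h, h, mod_succ' hk, mod_succ' hl, Nat.mod_eq_of_lt hk,
    Nat.mod_eq_of_lt hl] at h1
  split_ifs at h1 <;> omega

theorem inc_eq {V : Type*} [DecidableEq V] {a b : V} (v : V) (h : a ≠ b) :
    (if v ∈ s(a, b) then 1 else 0 : ZMod 2) =
      (if v = a then 1 else 0) + (if v = b then 1 else 0) := by
  by_cases h1 : v = a
  · subst h1; simp [h]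
  · by_cases h2 : v = b
    · subst h2; simp [h.symm]
    · simp [h1, h2]

theorem sum_image_sub {V : Type*} [DecidableEq V] (N : ℕ) (e : ℕ → Sym2 V)
    (he : ∀ k < N, ∀ l < N, e k = e l → k = l) (F : Finset (Sym2 V))
    (hF : F ⊆ (Finset.range N).image e) (f : Sym2 V → ZMod 2) :
    ∑ x ∈ F, f x = ∑ k ∈ Finset.range N, (if e k ∈ F then 1 else 0) * f (e k) := by
  have h1 : F = ((Finset.range N).image e).filter (· ∈ F) := by
    ext x; simp only [Finset.mem_filter]; exact ⟨fun h => ⟨hF h, h⟩, fun h => h.2⟩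
  rw [h1, Finset.sum_filter, Finset.sum_image]
  · refine Finset.sum_congr rfl fun k hk => ?_
    have h2 : e k ∈ ((Finset.range N).image e).filter (· ∈ F) ↔ e k ∈ F := by rw [← h1]
    simp only [h2, ite_mul, one_mul, zero_mul]
  · intro k hk l hl
    simp only [Finset.coe_range, Set.mem_Iio] at hk hl
    exact he k hk l hl

theorem CInj.sum_cyc {V : Type*} [DecidableEq V] {n : ℕ} {φ : ℕ → V} (h : CInj n φ)
    (χ : ℕ → ZMod 2) (i : ℕ) (hi : i < n) :
    ∑ k ∈ Finset.range n, χ k * ((if φ i = φ k then 1 else 0) + (if φ i = φ (k + 1) then 1 else 0))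
      = χ i + χ ((i + n - 1) % n) := by
  simp only [mul_add, Finset.sum_add_distrib]
  congr 1
  · rw [Finset.sum_eq_single i]
    · simp
    · intro k hk hki
      rw [Finset.mem_range] at hk
      rw [if_neg, mul_zero]
      rw [h, Nat.mod_eq_of_lt hk, Nat.mod_eq_of_lt hi]; omega
    · simp [hi]
  · have hlt : (i + n - 1) % n < n := Nat.mod_lt _ (by omega)
    rw [Finset.sum_eq_single ((i + n - 1) % n)]
    · rw [if_pos, mul_one]
      rw [h, mod_succ' hlt, mod_pred' hi, Nat.mod_eq_of_lt hi]
      split_ifs <;> omega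
    · intro k hk hki
      rw [Finset.mem_range] at hk
      rw [if_neg, mul_zero]
      rw [h, mod_succ' hk, Nat.mod_eq_of_lt hi]
      rw [mod_pred' hi] at hki
      split_ifs at hki ⊢ <;> omega
    · simp [hlt]

theorem CInj.ev {V : Type*} [DecidableEq V] {n : ℕ} {φ : ℕ → V} (h : CInj n φ) (hn : 3 ≤ n) :
    Ev (cycE n φ) := by
  intro v
  rw [cycE, Finset.sum_image (by
    intro k hk l hl
    simp only [Finset.coe_range, Set.mem_Iio] at hk hl
    exact h.edge_inj hn k hk l hl)]
  simp only [inc_eq v (h.ne_succ hn _), Finset.sum_add_distrib]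
  have h1 := Finset.sum_range_succ (fun k => if v = φ k then 1 else 0 : ℕ → ZMod 2) n
  rw [Finset.sum_range_succ'] at h1
  have h2 : φ n = φ 0 := by rw [h]; simp
  rw [h2] at h1
  rw [add_right_cancel h1]
  exact CharTwo.add_self_eq_zero _

theorem CInj.card {V : Type*} [DecidableEq V] {n : ℕ} {φ : ℕ → V} (h : CInj n φ) (hn : 3 ≤ n) :
    (cycE n φ).card = n := by
  rw [cycE, Finset.card_image_of_injOn, Finset.card_range]
  intro k hk l hl
  simp only [Finset.coe_range, Set.mem_Iio] at hk hl
  exact h.edge_inj hn k hk l hl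

theorem ite_one_eq {P Q : Prop} [Decidable P] [Decidable Q]
    (h : (if P then 1 else 0 : ZMod 2) + (if Q then 1 else 0) = 0) : P ↔ Q := by
  by_cases hP : P <;> by_cases hQ : Q <;> simp_all

theorem CInj.isCyc {V : Type*} [DecidableEq V] {n : ℕ} {φ : ℕ → V} (h : CInj n φ) (hn : 3 ≤ n) :
    IsCyc (cycE n φ) := by
  refine ⟨?_, h.ev hn, ?_⟩
  · rw [← Finset.card_pos, h.card hn]; omega
  · intro F hF hE
    have h1 : ∀ i, i < n → (s(φ i, φ (i + 1)) ∈ F ↔ s(φ 0, φ (0 + 1)) ∈ F) := by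
      intro i
      induction i with
      | zero => intro; rfl
      | succ i ih =>
        intro hi
        rw [← ih (by omega)]
        have h2 := hE (φ (i + 1))
        rw [sum_image_sub n _ (h.edge_inj hn) F hF] at h2
        simp only [inc_eq _ (h.ne_succ hn _)] at h2
        rw [h.sum_cyc (fun k => if s(φ k, φ (k + 1)) ∈ F then 1 else 0) _ hi, mod_pred' hi,
          if_neg (Nat.succ_ne_zero i)] at h2
        exact ite_one_eq h2
    by_cases h0 : s(φ 0, φ (0 + 1)) ∈ F
    · right
      apply Finset.Subset.antisymm hF
      intro e he
      simp only [cycE, Finset.mem_image, Finset.mem_range] at he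
      obtain ⟨k, hk, rfl⟩ := he
      exact (h1 k hk).2 h0
    · left
      rw [Finset.eq_empty_iff_forall_notMem]
      intro e heF
      have he := hF heF
      simp only [cycE, Finset.mem_image, Finset.mem_range] at he
      obtain ⟨k, hk, rfl⟩ := he
      exact h0 ((h1 k hk).1 heF)

theorem CInj.mem_cycE {V : Type*} [DecidableEq V] {n : ℕ} {φ : ℕ → V} (h : CInj n φ)
    {i j : ℕ} (hi : i < n) (hj : j < n) :
    s(φ i, φ j) ∈ cycE n φ ↔ (i + 1) % n = j ∨ (j + 1) % n = i := by
  simp only [cycE, Finset.mem_image, Finset.mem_range, Sym2.eq_iff, h _ _]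
  rw [Nat.mod_eq_of_lt hi, Nat.mod_eq_of_lt hj]
  constructor
  · rintro ⟨k, hk, h1⟩
    rw [Nat.mod_eq_of_lt hk] at h1
    rcases h1 with ⟨rfl, h2⟩ | ⟨rfl, h2⟩
    · exact Or.inl h2
    · exact Or.inr h2
  · rintro (h1 | h1)
    · exact ⟨i, hi, Or.inl ⟨Nat.mod_eq_of_lt hi, h1⟩⟩
    · exact ⟨j, hj, Or.inr ⟨Nat.mod_eq_of_lt hj, h1⟩⟩

theorem cyc_adj {n : ℕ} (hn : 3 ≤ n) (i j : Fin n) :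
    (cycleGraph n).Adj i j ↔ (i.1 + 1) % n = j.1 ∨ (j.1 + 1) % n = i.1 := by
  rw [cycleGraph_adj', mod_succ' i.2, mod_succ' j.2, Fin.val_sub, Fin.val_sub]
  have key : ∀ a b : ℕ, a < n → b < n → ((n - b + a) % n = 1 ↔ (if b + 1 = n then 0 else b + 1) = a) := by
    intro a b ha hb
    by_cases hab : b ≤ a
    · rw [show n - b + a = a - b + n by omega, Nat.add_mod_right, Nat.mod_eq_of_lt (by omega)]
      split_ifs <;> omega
    · rw [Nat.mod_eq_of_lt (by omega)]
      split_ifs <;> omega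
  rw [key _ _ i.2 j.2, key _ _ j.2 i.2]
  tauto

/-- An injective homomorphism from a cycle graph gives a cyclic sequence. -/
theorem cinj_of_fin {V : Type*} {n : ℕ} (hn : 3 ≤ n) (f : Fin n → V) (hf : Function.Injective f) :
    ∃ φ : ℕ → V, CInj n φ ∧ ∀ i : Fin n, φ i.1 = f i := by
  refine ⟨fun i => f ⟨i % n, Nat.mod_lt _ (by omega)⟩, ?_, ?_⟩
  · intro i j
    rw [hf.eq_iff, Fin.mk.injEq]
  · intro i
    exact congrArg f (Fin.ext (Nat.mod_eq_of_lt i.2))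

theorem not_acyclic {V : Type*} [DecidableEq V] [Fintype V] (F : Finset (Sym2 V))
    (hd : ∀ e ∈ F, ¬ e.IsDiag) (hF : F.Nonempty) (hE : Ev F) :
    ¬ (fromEdgeSet (F : Set (Sym2 V))).IsAcyclic := by
  classical
  intro hac
  rw [isAcyclic_iff_forall_isBridge] at hac
  obtain ⟨e, he⟩ := hF
  induction e using Sym2.ind with
  | _ u v =>
  have huv : u ≠ v := by have := hd _ he; simpa using this
  have h1 := hac (e := s(u, v)) (by simp [he, huv])
  rw [isBridge_iff] at h1
  set K := (fromEdgeSet (F : Set (Sym2 V))).deleteEdges {s(u, v)} with hK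
  set S : Finset V := Finset.univ.filter (fun x => K.Reachable u x) with hS
  have h2 : ∑ x ∈ S, ∑ e ∈ F, (if x ∈ e then 1 else 0 : ZMod 2) = 0 :=
    Finset.sum_eq_zero fun x _ => hE x
  rw [Finset.sum_comm] at h2
  have h3 : ∀ e ∈ F, ∑ x ∈ S, (if x ∈ e then 1 else 0 : ZMod 2) = if e = s(u, v) then 1 else 0 := by
    intro e he'
    induction e using Sym2.ind with
    | _ a b =>
    have hab : a ≠ b := by have := hd _ he'; simpa using this
    simp only [inc_eq _ hab, Finset.sum_add_distrib, Finset.sum_ite_eq', hS, Finset.mem_filter,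
      Finset.mem_univ, true_and]
    split_ifs with ha hb heq heq hb heq heq
    · exfalso
      rw [Sym2.eq_iff] at heq
      rcases heq with ⟨rfl, rfl⟩ | ⟨rfl, rfl⟩
      · exact h1 hb
      · exact h1 ha
    · rfl
    · simp
    · exfalso
      apply hb
      refine ha.trans (Adj.reachable ?_)
      rw [hK, deleteEdges_adj, fromEdgeSet_adj]
      exact ⟨⟨by exact_mod_cast he', hab⟩, heq⟩
    · simp
    · exfalso
      apply ha
      refine hb.trans (Adj.reachable ?_)
      rw [hK, deleteEdges_adj, fromEdgeSet_adj, Sym2.eq_swap]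
      exact ⟨⟨by exact_mod_cast he', hab.symm⟩, heq⟩
    · exfalso
      rw [Sym2.eq_iff] at heq
      rcases heq with ⟨rfl, rfl⟩ | ⟨rfl, rfl⟩
      · exact ha (Reachable.refl _)
      · exact hb (Reachable.refl _)
    · simp
  rw [Finset.sum_congr rfl h3, Finset.sum_ite_eq', if_pos he] at h2
  exact one_ne_zero h2

theorem exists_cinj {V : Type*} [DecidableEq V] [Fintype V] (F : Finset (Sym2 V))
    (hd : ∀ e ∈ F, ¬ e.IsDiag) (hF : IsCyc F) :
    ∃ n φ, 3 ≤ n ∧ CInj n φ ∧ cycE n φ = F := by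
  have h1 := not_acyclic F hd hF.1 hF.2.1
  rw [isAcyclic_iff_free_cycleGraph] at h1
  push Not at h1
  obtain ⟨n, hn, h2⟩ := h1
  obtain ⟨f⟩ := h2
  obtain ⟨φ, hφ, hf⟩ := cinj_of_fin hn f f.injective
  refine ⟨n, φ, hn, hφ, ?_⟩
  have hsub : cycE n φ ⊆ F := by
    intro e he
    simp only [cycE, Finset.mem_image, Finset.mem_range] at he
    obtain ⟨k, hk, rfl⟩ := he
    have hlt : (k + 1) % n < n := Nat.mod_lt _ (by omega)
    have h3 : φ (k + 1) = φ ((k + 1) % n) := by rw [hφ]; simp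
    rw [h3]
    have h4 : (cycleGraph n).Adj ⟨k, hk⟩ ⟨(k + 1) % n, hlt⟩ := by
      rw [cyc_adj hn]; simp
    have h5 := f.toHom.map_adj h4
    rw [fromEdgeSet_adj] at h5
    have h6 := hf ⟨k, hk⟩
    have h7 := hf ⟨(k + 1) % n, hlt⟩
    simp only at h6 h7
    rw [h6, h7]
    exact_mod_cast h5.1
  rcases hF.2.2 _ hsub (hφ.ev hn) with h3 | h3
  · have := (hφ.isCyc hn).1
    rw [h3] at this
    simp at this
  · exact h3

/-- The subgraph of a cyclic sequence. -/
def cycSub {V : Type*} [DecidableEq V] (G : SimpleGraph V) (n : ℕ) (φ : ℕ → V)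
    (h : ∀ e ∈ cycE n φ, e ∈ G.edgeSet) (hn : 0 < n) (hφ : CInj n φ) : G.Subgraph where
  verts := Set.range φ
  Adj a b := s(a, b) ∈ cycE n φ
  adj_sub := fun {a b} hab => h _ hab
  edge_vert := by
    intro a b hab
    simp only [cycE, Finset.mem_image, Finset.mem_range] at hab
    obtain ⟨k, hk, hk2⟩ := hab
    rw [Sym2.eq_iff] at hk2
    rcases hk2 with ⟨rfl, -⟩ | ⟨-, rfl⟩
    · exact ⟨_, rfl⟩
    · exact ⟨_, rfl⟩
  symm := ⟨by intro a b hab; rwa [Sym2.eq_swap]⟩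

theorem cycSub_iso {V : Type*} [DecidableEq V] (G : SimpleGraph V) (n : ℕ) (φ : ℕ → V)
    (h : ∀ e ∈ cycE n φ, e ∈ G.edgeSet) (hn : 3 ≤ n) (hφ : CInj n φ) :
    Nonempty ((cycSub G n φ h (by omega) hφ).coe ≃g cycleGraph n) := by
  let f : Fin n → (cycSub G n φ h (by omega) hφ).verts := fun i => ⟨φ i.1, i.1, rfl⟩
  have hf : Function.Bijective f := by
    constructor
    · intro i j hij
      have h1 : φ i.1 = φ j.1 := congrArg Subtype.val hij
      rw [hφ, Nat.mod_eq_of_lt i.2, Nat.mod_eq_of_lt j.2] at h1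
      exact Fin.ext h1
    · rintro ⟨_, k, rfl⟩
      refine ⟨⟨k % n, Nat.mod_lt _ (by omega)⟩, Subtype.ext ?_⟩
      change φ (k % n) = φ k
      rw [hφ]; simp
  refine ⟨RelIso.symm ⟨Equiv.ofBijective f hf, ?_⟩⟩
  intro i j
  rw [cyc_adj hn, ← hφ.mem_cycE i.2 j.2]
  rfl

theorem cinj_of_iso {V : Type*} [DecidableEq V] (G : SimpleGraph V) (n : ℕ) (hn : 3 ≤ n)
    (H : G.Subgraph) (f : H.coe ≃g cycleGraph n) :
    ∃ φ, CInj n φ ∧ H.edgeSet = cycE n φ ∧ H.verts = Set.range φ := by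
  obtain ⟨φ, hφ, hf⟩ := cinj_of_fin hn (fun i => (f.symm i).1)
    (fun i j hij => f.symm.injective (Subtype.ext hij))
  have hlt : ∀ k, k % n < n := fun k => Nat.mod_lt _ (by omega)
  have hmod : ∀ k, φ k = φ (k % n) := fun k => by rw [hφ]; simp
  have hr : H.verts = Set.range φ := by
    ext x
    constructor
    · intro hx
      refine ⟨(f ⟨x, hx⟩).1, ?_⟩
      rw [hf]; simp
    · rintro ⟨k, rfl⟩
      rw [hmod, hf ⟨k % n, hlt k⟩]
      exact (f.symm _).2
  refine ⟨φ, hφ, ?_, hr⟩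
  have hadj : ∀ i j : Fin n, H.Adj (φ i.1) (φ j.1) ↔ s(φ i.1, φ j.1) ∈ cycE n φ := by
    intro i j
    rw [hφ.mem_cycE i.2 j.2, ← cyc_adj hn, hf, hf, ← f.symm.map_adj_iff]
    rfl
  ext e
  induction e using Sym2.ind with
  | _ a b =>
  rw [Subgraph.mem_edgeSet, Finset.mem_coe]
  constructor
  · intro hab
    have ha := H.edge_vert hab
    have hb := H.edge_vert hab.symm
    rw [hr] at ha hb
    obtain ⟨i, rfl⟩ := ha
    obtain ⟨j, rfl⟩ := hb
    rw [hmod i, hmod j] at hab ⊢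
    exact (hadj ⟨_, hlt i⟩ ⟨_, hlt j⟩).1 hab
  · intro hab
    have hab' := hab
    simp only [cycE, Finset.mem_image, Finset.mem_range] at hab'
    obtain ⟨k, hk, hk2⟩ := hab'
    rw [← hk2, hmod (k + 1)] at hab
    have h1 := (hadj ⟨k, hk⟩ ⟨_, hlt (k + 1)⟩).2 hab
    rw [← hmod (k + 1), ← Subgraph.mem_edgeSet, hk2] at h1
    exact h1

theorem verts_of_edges {V : Type*} [DecidableEq V] {n : ℕ} (hn : 3 ≤ n) (φ : ℕ → V)
    (hφ : CInj n φ) : Set.range φ = {v | ∃ e ∈ cycE n φ, v ∈ e} := by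
  ext v
  constructor
  · rintro ⟨k, rfl⟩
    refine ⟨_, Finset.mem_image_of_mem _ (Finset.mem_range.2 (Nat.mod_lt k (by omega : 0 < n))), ?_⟩
    rw [Sym2.mem_iff]
    left; rw [hφ]; simp
  · rintro ⟨e, he, hv⟩
    simp only [cycE, Finset.mem_image, Finset.mem_range] at he
    obtain ⟨k, hk, rfl⟩ := he
    rw [Sym2.mem_iff] at hv
    rcases hv with rfl | rfl <;> exact ⟨_, rfl⟩

theorem cycleCount_eq {V : Type*} [DecidableEq V] [Fintype V] (G : SimpleGraph V) (k : ℕ)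
    (hk : 3 ≤ k) : cycleCount G k =
      {F : Finset (Sym2 V) | (∀ e ∈ F, e ∈ G.edgeSet) ∧ IsCyc F ∧ F.card = k}.ncard := by
  classical
  rw [cycleCount]
  refine Set.ncard_congr (fun H _ => H.edgeSet.toFinset) ?_ ?_ ?_
  · rintro H ⟨f⟩
    obtain ⟨φ, hφ, he, hv⟩ := cinj_of_iso G k hk H f
    have h1 : H.edgeSet.toFinset = cycE k φ := by ext e; simp [he]
    refine ⟨?_, ?_, ?_⟩
    · intro e he
      exact H.edgeSet_subset (by simpa using he)
    · rw [h1]; exact hφ.isCyc hk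
    · rw [h1]; exact hφ.card hk
  · rintro H H' ⟨f⟩ ⟨f'⟩ hHH
    obtain ⟨φ, hφ, he, hv⟩ := cinj_of_iso G k hk H f
    obtain ⟨φ', hφ', he', hv'⟩ := cinj_of_iso G k hk H' f'
    have h1 : H.edgeSet = H'.edgeSet := by simpa using hHH
    have h2 : cycE k φ = cycE k φ' := by rw [he, he'] at h1; exact_mod_cast h1
    apply Subgraph.ext
    · rw [hv, hv', verts_of_edges hk φ hφ, verts_of_edges hk φ' hφ', h2]
    · ext a b
      rw [← Subgraph.mem_edgeSet, ← Subgraph.mem_edgeSet, h1]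
  · rintro F ⟨hF, hc, hcard⟩
    obtain ⟨n, φ, hn, hφ, rfl⟩ := exists_cinj F (fun e he => G.not_isDiag_of_mem_edgeSet (hF e he)) hc
    rw [hφ.card hn] at hcard
    subst hcard
    refine ⟨cycSub G n φ hF (by omega) hφ, cycSub_iso G n φ hF hn hφ, ?_⟩
    ext e
    rw [Set.mem_toFinset]
    induction e using Sym2.ind with
    | _ a b => rfl

/-- Lengths of cycles in bipartite graphs. -/
theorem cyc_len {V : Type*} [DecidableEq V] [Fintype V] (G : SimpleGraph V) (col : V → ZMod 2)
    (hcol : ∀ a b, G.Adj a b → col b = col a + 1) (F : Finset (Sym2 V))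
    (hF : ∀ e ∈ F, e ∈ G.edgeSet) (hc : IsCyc F) :
    Even F.card ∧ 4 ≤ F.card ∧ F.card ≤ Fintype.card V := by
  obtain ⟨n, φ, hn, hφ, rfl⟩ := exists_cinj F (fun e he => G.not_isDiag_of_mem_edgeSet (hF e he)) hc
  rw [hφ.card hn]
  have h1 : ∀ k ∈ Finset.range n, col (φ (k + 1)) = col (φ k) + 1 := by
    intro k hk
    exact hcol _ _ (hF _ (Finset.mem_image_of_mem _ hk))
  have h2 := Finset.sum_congr rfl h1
  rw [Finset.sum_add_distrib] at h2
  have h3 := Finset.sum_range_succ (fun k => col (φ k)) n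
  rw [Finset.sum_range_succ', h2] at h3
  have h4 : φ n = φ 0 := by rw [hφ]; simp
  rw [h4, add_left_inj, add_eq_left, Finset.sum_const, Finset.card_range, nsmul_eq_mul, mul_one,
    ZMod.natCast_eq_zero_iff] at h3
  have hev : Even n := even_iff_two_dvd.2 h3
  refine ⟨hev, ?_, ?_⟩
  · obtain ⟨m, rfl⟩ := hev; omega
  · have : Function.Injective (fun i : Fin n => φ i.1) := by
      intro i j hij
      simp only at hij
      rw [hφ, Nat.mod_eq_of_lt i.2, Nat.mod_eq_of_lt j.2] at hij
      exact Fin.ext hij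
    simpa using Fintype.card_le_of_injective _ this

end BP

namespace BP

/-- Index of the gap which contains the edge `k` of the Hamiltonian cycle. -/
def gi (g : ℕ → ℕ) (w k : ℕ) : ℕ := Nat.findGreatest (fun i => pos g i ≤ k) (w - 1)

theorem pos_zero (g : ℕ → ℕ) : pos g 0 = 0 := rfl

theorem pos_mono (g : ℕ → ℕ) {i j : ℕ} (h : i ≤ j) : pos g i ≤ pos g j := by
  induction j, h using Nat.le_induction with
  | base => exact le_rfl
  | succ j _ ih => rw [pos_succ]; omega

theorem pos_strict (g : ℕ → ℕ) {w i j : ℕ} (hg : ∀ i < w, 1 ≤ g i) (h : i < j) (hj : j ≤ w) :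
    pos g i < pos g j := by
  have h1 := pos_mono g (show i + 1 ≤ j from h)
  rw [pos_succ] at h1
  have := hg i (by omega)
  omega

theorem gi_le_iff (g : ℕ → ℕ) {w k : ℕ} (hk : k < pos g w) (x : ℕ) :
    x ≤ gi g w k ↔ pos g x ≤ k := by
  constructor
  · intro h
    have h1 : pos g (gi g w k) ≤ k :=
      Nat.findGreatest_spec (P := fun i => pos g i ≤ k) (m := 0) (Nat.zero_le _) (Nat.zero_le _)
    exact (pos_mono g h).trans h1
  · intro h
    refine Nat.le_findGreatest (P := fun i => pos g i ≤ k) ?_ h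
    by_contra hc
    have := pos_mono g (show w ≤ x by omega)
    omega

theorem gi_lt (g : ℕ → ℕ) {w k : ℕ} (hw : 1 ≤ w) : gi g w k < w := by
  have : gi g w k ≤ w - 1 := Nat.findGreatest_le _
  omega

theorem gi_pos (g : ℕ → ℕ) {w i x : ℕ} (hi : i < w) (hx : x < g i) :
    gi g w (pos g i + x) = i := by
  have h1 : pos g i + x < pos g w := by
    have := pos_mono g (show i + 1 ≤ w from hi)
    rw [pos_succ] at this; omega
  apply le_antisymm
  · by_contra hc
    have h2 : i + 1 ≤ gi g w (pos g i + x) := by omega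
    rw [gi_le_iff g h1, pos_succ] at h2
    omega
  · rw [gi_le_iff g h1]; omega

theorem sum_gi (g f : ℕ → ℕ) {w : ℕ} : ∀ v ≤ w, ∑ k ∈ Finset.range (pos g v), f (gi g w k) =
    ((List.range' 0 v).map (fun i => g i * f i)).sum := by
  intro v
  induction v with
  | zero => intro; rfl
  | succ v ih =>
    intro hv
    rw [pos_succ, Finset.sum_range_add, ih (by omega), List.range'_concat, List.map_append,
      List.sum_append]
    congr 1
    rw [Finset.sum_congr rfl (g := fun _ => f v) (by
      intro x hx
      rw [gi_pos g (by omega) (Finset.mem_range.1 hx)])]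
    simp

/-- The edges: first those of the Hamiltonian cycle, then the chords. -/
def edg {V : Type*} (n : ℕ) (φ : ℕ → V) (g : ℕ → ℕ) (D : List (ℕ × ℕ)) (k : ℕ) : Sym2 V :=
  if k < n then s(φ k, φ (k + 1))
  else s(φ (pos g (D.getD (k - n) (0, 0)).1), φ (pos g (D.getD (k - n) (0, 0)).2))

/-- The graph consists of a Hamiltonian cycle and chords described by `D`. -/
structure Data {V : Type*} (G : SimpleGraph V) (n w : ℕ) (φ : ℕ → V) (g : ℕ → ℕ)
    (D : List (ℕ × ℕ)) : Prop where
  hn : 3 ≤ n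
  inj : CInj n φ
  hw : 1 ≤ w
  hD : ∀ p ∈ D, p.1 < p.2 ∧ p.2 < w
  hg : ∀ i < w, 1 ≤ g i
  hpos : pos g w = n
  einj : ∀ k < n + D.length, ∀ l < n + D.length, edg n φ g D k = edg n φ g D l → k = l
  eset : ∀ x, x ∈ G.edgeSet ↔ ∃ k < n + D.length, edg n φ g D k = x

theorem solve_cyc (n : ℕ) (hn : 1 ≤ n) (X b : ℕ → ZMod 2) (hb : ∑ l ∈ Finset.range n, b l = 0) :
    (∀ i < n, X i + X ((i + n - 1) % n) + b i = 0) ↔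
      ∃ t, ∀ i < n, X i = t + ∑ l ∈ Finset.range (i + 1), b l := by
  have hc : ∀ x y : ZMod 2, x + y = 0 ↔ x = y := by decide
  constructor
  · intro h
    refine ⟨X (n - 1), ?_⟩
    intro i
    induction i with
    | zero =>
      intro hi
      have h1 := h 0 hi
      rw [mod_pred' hi, if_pos rfl, add_assoc, hc] at h1
      simpa using h1
    | succ i ih =>
      intro hi
      have h1 := h (i + 1) hi
      rw [mod_pred' hi, if_neg (Nat.succ_ne_zero i), add_assoc, hc, Nat.add_sub_cancel,
        ih (by omega)] at h1
      rw [h1, Finset.sum_range_succ _ (i + 1)]; ring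
  · rintro ⟨t, ht⟩ i hi
    rw [mod_pred' hi, add_assoc, hc]
    split_ifs with h0
    · subst h0
      rw [ht 0 hi, ht (n - 1) (by omega), Nat.sub_add_cancel hn, hb]
      simp
    · rw [ht i hi, ht (i - 1) (by omega), Finset.sum_range_succ, Nat.sub_add_cancel (by omega)]
      ring

theorem edg_cyc {V : Type*} {n : ℕ} {φ : ℕ → V} {g : ℕ → ℕ} {D : List (ℕ × ℕ)} {k : ℕ}
    (h : k < n) : edg n φ g D k = s(φ k, φ (k + 1)) := if_pos h

theorem edg_chord {V : Type*} {n : ℕ} {φ : ℕ → V} {g : ℕ → ℕ} {D : List (ℕ × ℕ)} (j : ℕ) :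
    edg n φ g D (n + j) =
      s(φ (pos g (D.getD j (0, 0)).1), φ (pos g (D.getD j (0, 0)).2)) := by
  rw [edg, if_neg (by omega), Nat.add_sub_cancel_left]

theorem getD_mem {D : List (ℕ × ℕ)} {j : ℕ} (hj : j < D.length) : D.getD j (0, 0) ∈ D := by
  rw [List.getD_eq_getElem _ _ hj]; exact List.getElem_mem hj

/-- The contribution of the chords. -/
def chs (D : List (ℕ × ℕ)) (Y : ℕ → ZMod 2) (i : ℕ) : ZMod 2 :=
  ∑ j ∈ Finset.range D.length, Y j * (if (D.getD j (0, 0)).1 ≤ i ∧ i < (D.getD j (0, 0)).2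
    then 1 else 0)

theorem Data.posn {V : Type*} {G : SimpleGraph V} {n w : ℕ} {φ : ℕ → V} {g : ℕ → ℕ}
    {D : List (ℕ × ℕ)} (h : Data G n w φ g D) {j : ℕ} (hj : j < D.length) :
    pos g (D.getD j (0, 0)).1 < pos g (D.getD j (0, 0)).2 ∧ pos g (D.getD j (0, 0)).2 < n := by
  have h1 := h.hD _ (getD_mem hj)
  rw [← h.hpos]
  exact ⟨pos_strict g h.hg h1.1 h1.2.le, pos_strict g h.hg h1.2 le_rfl⟩

theorem Data.ev_iff {V : Type*} [DecidableEq V] {G : SimpleGraph V} {n w : ℕ} {φ : ℕ → V}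
    {g : ℕ → ℕ} {D : List (ℕ × ℕ)} (h : Data G n w φ g D)
    (F : Finset (Sym2 V)) (hF : ∀ e ∈ F, e ∈ G.edgeSet) :
    Ev F ↔ ∃ t : ZMod 2, ∀ k < n, (if edg n φ g D k ∈ F then 1 else 0) =
      t + chs D (fun j => if edg n φ g D (n + j) ∈ F then 1 else 0) (gi g w k) := by
  have hn := h.hn
  have hF' : F ⊆ (Finset.range (n + D.length)).image (edg n φ g D) := by
    intro e he
    obtain ⟨k, hk, rfl⟩ := (h.eset e).1 (hF e he)
    exact Finset.mem_image_of_mem _ (Finset.mem_range.2 hk)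
  set X : ℕ → ZMod 2 := fun k => if edg n φ g D k ∈ F then 1 else 0 with hX
  set b : ℕ → ZMod 2 := fun i => ∑ j ∈ Finset.range D.length, X (n + j) *
    ((if i = pos g (D.getD j (0, 0)).1 then 1 else 0) +
      (if i = pos g (D.getD j (0, 0)).2 then 1 else 0)) with hb
  have hsumb : ∀ i < n, ∑ l ∈ Finset.range (i + 1), b l = chs D (fun j => X (n + j)) (gi g w i) := by
    intro i hi
    rw [hb, Finset.sum_comm, chs]
    refine Finset.sum_congr rfl fun j hj => ?_
    rw [Finset.mem_range] at hj
    rw [← Finset.mul_sum, Finset.sum_add_distrib]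
    congr 1
    rw [Finset.sum_ite_eq', Finset.sum_ite_eq']
    have h1 := h.posn hj
    have h2 := gi_le_iff g (w := w) (k := i) (by rw [h.hpos]; exact hi)
    simp only [Finset.mem_range]
    simp only [← not_le (a := (D.getD j (0, 0)).2), h2]
    split_ifs <;> first | omega | rfl
  have hinc : ∀ i < n, ∑ e ∈ F, (if φ i ∈ e then 1 else 0 : ZMod 2) =
      X i + X ((i + n - 1) % n) + b i := by
    intro i hi
    rw [sum_image_sub _ _ h.einj F hF', Finset.sum_range_add, ← h.inj.sum_cyc X i hi, hb]
    congr 1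
    · refine Finset.sum_congr rfl fun k hk => ?_
      rw [Finset.mem_range] at hk
      congr 1
      rw [edg_cyc hk, inc_eq _ (h.inj.ne_succ hn _)]
    · refine Finset.sum_congr rfl fun j hj => ?_
      rw [Finset.mem_range] at hj
      congr 1
      have h1 := h.posn hj
      rw [edg_chord, inc_eq]
      · simp only [h.inj _ _]
        rw [Nat.mod_eq_of_lt hi, Nat.mod_eq_of_lt (h1.1.trans h1.2), Nat.mod_eq_of_lt h1.2]
      · rw [Ne, h.inj, Nat.mod_eq_of_lt (h1.1.trans h1.2), Nat.mod_eq_of_lt h1.2]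
        omega
  have hb0 : ∑ l ∈ Finset.range n, b l = 0 := by
    have h1 := hsumb (n - 1) (by omega)
    rw [Nat.sub_add_cancel (by omega)] at h1
    rw [h1, chs]
    refine Finset.sum_eq_zero fun j hj => ?_
    rw [Finset.mem_range] at hj
    rw [if_neg, mul_zero]
    have h1 := h.posn hj
    have h2 := gi_le_iff g (w := w) (k := n - 1) (by rw [h.hpos]; omega)
    rw [← not_le, h2, h2]
    omega
  have h3 : Ev F ↔ ∀ i < n, X i + X ((i + n - 1) % n) + b i = 0 := by
    constructor
    · intro hE i hi
      rw [← hinc i hi]; exact hE _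
    · intro hE v
      by_cases hv : ∃ i < n, φ i = v
      · obtain ⟨i, hi, rfl⟩ := hv
        rw [hinc i hi]; exact hE i hi
      · refine Finset.sum_eq_zero fun e he => ?_
        rw [if_neg]
        intro hve
        apply hv
        have hr : ∀ k, ∃ i < n, φ i = φ k := fun k =>
          ⟨k % n, Nat.mod_lt _ (by omega), by rw [h.inj]; simp⟩
        obtain ⟨k, hk, rfl⟩ := (h.eset e).1 (hF e he)
        rw [edg] at hve
        split_ifs at hve <;> rw [Sym2.mem_iff] at hve <;> rcases hve with rfl | rfl <;> exact hr _
  rw [h3, solve_cyc n (by omega) X b hb0]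
  refine exists_congr fun t => forall_congr' fun i => imp_congr_right fun hi => ?_
  rw [hsumb i hi]

/-- bits to `ZMod 2` -/
def bz (b : Bool) : ZMod 2 := if b = true then 1 else 0

theorem bz_xor (a b : Bool) : bz (a ^^ b) = bz a + bz b := by
  cases a <;> cases b <;> rfl

theorem bz_inj {a b : Bool} : bz a = bz b ↔ a = b := by
  cases a <;> cases b <;> decide

theorem bz_surj (t : ZMod 2) : ∃ b, bz b = t := by
  revert t; decide

theorem par_eq (D : List (ℕ × ℕ)) (e i : ℕ) : ∀ k, bz (par D e i k) =
    chs D (fun j => bz (e.testBit (k + j))) i := by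
  induction D with
  | nil => intro k; rfl
  | cons p D ih =>
    intro k
    change bz ((e.testBit k && (decide (p.1 ≤ i) && decide (i < p.2))) ^^ par D e i (k + 1)) = _
    rw [bz_xor, ih, chs, chs, List.length_cons, Finset.sum_range_succ', add_comm]
    congr 1
    · refine Finset.sum_congr rfl fun j _ => ?_
      rw [show k + 1 + j = k + (j + 1) by omega]
      rfl
    · simp only [List.getD_cons_zero, add_zero, ← Bool.decide_and]
      cases e.testBit k <;> simp [bz]

/-- the position of the bit describing the edge `k` -/
def ix (g : ℕ → ℕ) (n w k : ℕ) : ℕ := if k < n then gi g w k else w + (k - n)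

/-- the edge set described by a codeword -/
def cedge {V : Type*} [DecidableEq V] (n w : ℕ) (φ : ℕ → V) (g : ℕ → ℕ) (D : List (ℕ × ℕ))
    (c : ℕ) : Finset (Sym2 V) :=
  ((Finset.range (n + D.length)).filter (fun k => c.testBit (ix g n w k) = true)).image
    (edg n φ g D)

theorem Data.mem_cedge {V : Type*} [DecidableEq V] {G : SimpleGraph V} {n w : ℕ} {φ : ℕ → V}
    {g : ℕ → ℕ} {D : List (ℕ × ℕ)} (h : Data G n w φ g D) (c : ℕ) {k : ℕ} (hk : k < n + D.length) :
    edg n φ g D k ∈ cedge n w φ g D c ↔ c.testBit (ix g n w k) = true := by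
  simp only [cedge, Finset.mem_image, Finset.mem_filter, Finset.mem_range]
  constructor
  · rintro ⟨l, ⟨hl, hc⟩, he⟩
    rw [← h.einj l hl k hk he]; exact hc
  · intro hc
    exact ⟨k, ⟨hk, hc⟩, rfl⟩

theorem Data.cedge_sub {V : Type*} [DecidableEq V] {G : SimpleGraph V} {n w : ℕ} {φ : ℕ → V}
    {g : ℕ → ℕ} {D : List (ℕ × ℕ)} (h : Data G n w φ g D) (c : ℕ) :
    ∀ e ∈ cedge n w φ g D c, e ∈ G.edgeSet := by
  intro e he
  simp only [cedge, Finset.mem_image, Finset.mem_filter, Finset.mem_range] at he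
  obtain ⟨l, ⟨hl, hc⟩, he⟩ := he
  exact (h.eset e).2 ⟨l, hl, he⟩

theorem Data.ix_surj {V : Type*} {G : SimpleGraph V} {n w : ℕ} {φ : ℕ → V}
    {g : ℕ → ℕ} {D : List (ℕ × ℕ)} (h : Data G n w φ g D) {i : ℕ} (hi : i < w + D.length) :
    ∃ k < n + D.length, ix g n w k = i := by
  by_cases hw : i < w
  · have h1 := pos_strict g h.hg hw le_rfl
    rw [h.hpos] at h1
    refine ⟨pos g i, by omega, ?_⟩
    rw [ix, if_pos h1]
    exact gi_pos g (x := 0) hw (h.hg i hw)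
  · refine ⟨n + (i - w), by omega, ?_⟩
    rw [ix, if_neg (by omega)]; omega

theorem land_eq_iff (a c M : ℕ) (ha : a < 2 ^ M) :
    a &&& c = a ↔ ∀ i < M, a.testBit i = true → c.testBit i = true := by
  constructor
  · intro h i _ hi
    rw [← h, Nat.testBit_and] at hi
    simp at hi; exact hi.2
  · intro h
    apply Nat.eq_of_testBit_eq
    intro i
    rw [Nat.testBit_and]
    by_cases hi : i < M
    · have := h i hi
      cases h1 : a.testBit i <;> simp_all
    · rw [Nat.testBit_lt_two_pow (lt_of_lt_of_le ha (Nat.pow_le_pow_right (by norm_num) (by omega)))]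
      rfl

theorem Data.sub_iff {V : Type*} [DecidableEq V] {G : SimpleGraph V} {n w : ℕ} {φ : ℕ → V}
    {g : ℕ → ℕ} {D : List (ℕ × ℕ)} (h : Data G n w φ g D) (a c : ℕ) (ha : a < 2 ^ (w + D.length)) :
    cedge n w φ g D a ⊆ cedge n w φ g D c ↔ a &&& c = a := by
  rw [land_eq_iff a c _ ha]
  constructor
  · intro hs i hi
    obtain ⟨k, hk, rfl⟩ := h.ix_surj hi
    rw [← h.mem_cedge a hk, ← h.mem_cedge c hk]
    exact fun h => hs h
  · intro hs e he
    have he' := h.cedge_sub a e he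
    obtain ⟨k, hk, rfl⟩ := (h.eset e).1 he'
    rw [h.mem_cedge _ hk] at he ⊢
    apply hs _ _ he
    rw [ix]
    have := gi_lt g (k := k) h.hw
    split_ifs <;> omega

theorem Data.ev_cedge {V : Type*} [DecidableEq V] {G : SimpleGraph V} {n w : ℕ} {φ : ℕ → V}
    {g : ℕ → ℕ} {D : List (ℕ × ℕ)} (h : Data G n w φ g D) (c : ℕ) (hc : c < 2 ^ (w + D.length)) :
    Ev (cedge n w φ g D c) ↔ c ∈ code w D := by
  rw [(code_spec w D h.hw h.hD).1 c, h.ev_iff _ (h.cedge_sub c)]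
  have hX : ∀ k < n, (if edg n φ g D k ∈ cedge n w φ g D c then 1 else 0 : ZMod 2) =
      bz (c.testBit (gi g w k)) := by
    intro k hk
    simp only [h.mem_cedge c (show k < n + D.length by omega), bz, ix, if_pos hk]
  have hY : ∀ i, chs D (fun j => if edg n φ g D (n + j) ∈ cedge n w φ g D c then 1 else 0) i =
      bz (par D c i w) := by
    intro i
    rw [par_eq]
    refine Finset.sum_congr rfl fun j hj => ?_
    rw [Finset.mem_range] at hj
    congr 1
    simp only [h.mem_cedge c (show n + j < n + D.length by omega), bz, ix,
      if_neg (show ¬ n + j < n by omega), Nat.add_sub_cancel_left]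
  simp only [hc, true_and]
  constructor
  · rintro ⟨t, ht⟩
    obtain ⟨t, rfl⟩ := bz_surj t
    refine ⟨t, fun i hi => ?_⟩
    have h1 := pos_strict g h.hg hi le_rfl
    rw [h.hpos] at h1
    have h2 := ht _ h1
    have h3 : gi g w (pos g i) = i := gi_pos g (x := 0) hi (h.hg i hi)
    rw [hX _ h1, hY, h3, ← bz_xor, bz_inj] at h2
    exact h2
  · rintro ⟨t, ht⟩
    refine ⟨bz t, fun k hk => ?_⟩
    rw [hX k hk, hY, ← bz_xor, bz_inj]
    exact ht _ (gi_lt g h.hw)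

theorem exists_bits (M : ℕ) (P : ℕ → Prop) : ∃ c < 2 ^ M, ∀ i < M, c.testBit i = true ↔ P i := by
  classical
  refine ⟨∑ i ∈ (Finset.range M).filter P, 2 ^ i, ?_, ?_⟩
  · exact lt_of_le_of_lt (Finset.sum_le_sum_of_subset (Finset.filter_subset _ _)) (by
      rw [Nat.geomSum_eq le_rfl]
      have := Nat.pow_pos (n := M) (show 0 < 2 by norm_num)
      simp)
  · intro i hi
    rw [← Nat.mem_bitIndices, ← List.mem_toFinset, Finset.toFinset_bitIndices_sum_two_pow]
    simp [hi]

theorem Data.exists_code {V : Type*} [DecidableEq V] {G : SimpleGraph V} {n w : ℕ} {φ : ℕ → V}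
    {g : ℕ → ℕ} {D : List (ℕ × ℕ)} (h : Data G n w φ g D) (F : Finset (Sym2 V))
    (hF : ∀ e ∈ F, e ∈ G.edgeSet) (hE : Ev F) : ∃ c ∈ code w D, cedge n w φ g D c = F := by
  obtain ⟨c, hc, hb⟩ := exists_bits (w + D.length) (fun i =>
    if i < w then edg n φ g D (pos g i) ∈ F else edg n φ g D (n + (i - w)) ∈ F)
  have hlt : ∀ i < w, pos g i < n := by
    intro i hi
    rw [← h.hpos]; exact pos_strict g h.hg hi le_rfl
  have hbits : ∀ k < n + D.length, (c.testBit (ix g n w k) = true ↔ edg n φ g D k ∈ F) := by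
    intro k hk
    rw [ix]
    split_ifs with hkn
    · have h1 := gi_lt g (k := k) h.hw
      rw [hb _ (by omega), if_pos h1]
      obtain ⟨t, ht⟩ := (h.ev_iff F hF).1 hE
      have h2 := ht k hkn
      have h3 := ht _ (hlt _ h1)
      rw [show gi g w (pos g (gi g w k)) = gi g w k from gi_pos g (x := 0) h1 (h.hg _ h1), ← h2] at h3
      apply ite_one_eq
      rw [h3]; exact CharTwo.add_self_eq_zero _
    · rw [hb _ (by omega), if_neg (by omega), Nat.add_sub_cancel_left, Nat.add_sub_cancel' (by omega)]
  have heq : cedge n w φ g D c = F := by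
    ext e
    constructor
    · intro he
      obtain ⟨k, hk, rfl⟩ := (h.eset e).1 (h.cedge_sub c e he)
      rwa [h.mem_cedge c hk, hbits k hk] at he
    · intro he
      obtain ⟨k, hk, rfl⟩ := (h.eset e).1 (hF e he)
      rwa [h.mem_cedge c hk, hbits k hk]
  refine ⟨c, ?_, heq⟩
  rw [← h.ev_cedge c hc, heq]; exact hE

theorem Data.card_cedge {V : Type*} [DecidableEq V] {G : SimpleGraph V} {n w : ℕ} {φ : ℕ → V}
    {g : ℕ → ℕ} {D : List (ℕ × ℕ)} (h : Data G n w φ g D) (c : ℕ) :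
    (cedge n w φ g D c).card = wlen w D.length g c := by
  rw [cedge, Finset.card_image_of_injOn, Finset.card_filter, Finset.sum_range_add, wlen]
  · congr 1
    · rw [← sum_gi g (bitN c) w le_rfl, h.hpos]
      refine Finset.sum_congr rfl fun k hk => ?_
      rw [Finset.mem_range] at hk
      rw [ix, if_pos hk, bitN_testBit]
    · rw [List.range'_eq_map_range, List.map_map, ← List.sum_toFinset _ List.nodup_range,
        List.toFinset_range]
      refine Finset.sum_congr rfl fun j hj => ?_
      have hix : ix g n w (n + j) = w + j := by
        rw [ix, if_neg (by omega), Nat.add_sub_cancel_left]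
      rw [hix, Function.comp_apply, bitN_testBit]
  · intro k hk l hl
    simp only [Finset.coe_filter, Finset.mem_range, Set.mem_ofPred_eq] at hk hl
    exact h.einj k hk.1 l hl.1

theorem Data.inj_cedge {V : Type*} [DecidableEq V] {G : SimpleGraph V} {n w : ℕ} {φ : ℕ → V}
    {g : ℕ → ℕ} {D : List (ℕ × ℕ)} (h : Data G n w φ g D) {a c : ℕ} (ha : a < 2 ^ (w + D.length))
    (hc : c < 2 ^ (w + D.length)) (hac : cedge n w φ g D a = cedge n w φ g D c) : a = c := by
  have h1 := (h.sub_iff a c ha).1 hac.le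
  have h2 := (h.sub_iff c a hc).1 hac.ge
  rw [← h1, Nat.land_comm, h2]

theorem cedge_zero {V : Type*} [DecidableEq V] (n w : ℕ) (φ : ℕ → V)
    (g : ℕ → ℕ) (D : List (ℕ × ℕ)) : cedge n w φ g D 0 = ∅ := by
  simp [cedge]

theorem Data.mins_iff {V : Type*} [DecidableEq V] {G : SimpleGraph V} {n w : ℕ} {φ : ℕ → V}
    {g : ℕ → ℕ} {D : List (ℕ × ℕ)} (h : Data G n w φ g D) (hwD : w + D.length ≤ 15) (c : ℕ) :
    c ∈ mins w D ↔ c ∈ code w D ∧ IsCyc (cedge n w φ g D c) := by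
  have hnd := (code_spec w D h.hw h.hD).2
  have hlt : ∀ c ∈ code w D, c < 2 ^ (w + D.length) := fun c hc =>
    (((code_spec w D h.hw h.hD).1 c).1 hc).1
  rw [mins_spec w D h.hw h.hD hwD, List.mem_filter, decide_eq_true_eq]
  refine and_congr_right fun hc => ?_
  have hEv : ∀ a ∈ code w D, Ev (cedge n w φ g D a) := fun a ha => (h.ev_cedge a (hlt a ha)).2 ha
  have h0 : 0 ∈ code w D := by
    rw [← h.ev_cedge 0 (by positivity), cedge_zero]
    intro v; simp
  have hcount : (code w D).countP (fun a => decide (a &&& c = a)) =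
      ((code w D).toFinset.filter (fun a => a &&& c = a)).card := by
    rw [List.countP_eq_length_filter, ← List.toFinset_card_of_nodup (hnd.filter _),
      List.toFinset_filter]
    simp
  rw [hcount]
  have hsub : ({0, c} : Finset ℕ) ⊆ (code w D).toFinset.filter (fun a => a &&& c = a) := by
    intro a ha
    simp only [Finset.mem_insert, Finset.mem_singleton] at ha
    simp only [Finset.mem_filter, List.mem_toFinset]
    rcases ha with rfl | rfl
    · exact ⟨h0, by simp⟩
    · exact ⟨hc, by simp⟩
  constructor
  · intro h2
    have hc0 : 0 ≠ c := by
      rintro rfl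
      have h3 : (code w D).toFinset.filter (fun a => a &&& 0 = a) ⊆ {0} := by
        intro a ha
        simp only [Finset.mem_filter, Nat.and_zero] at ha
        simp [ha.2]
      have := Finset.card_le_card h3
      rw [h2] at this; simp at this
    have h3 := Finset.eq_of_subset_of_card_le hsub (by rw [h2, Finset.card_pair hc0])
    refine ⟨?_, hEv c hc, ?_⟩
    · rw [Finset.nonempty_iff_ne_empty]
      intro h4
      rw [← cedge_zero n w φ g D] at h4
      exact hc0 (h.inj_cedge (hlt c hc) (hlt 0 h0) h4).symm
    · intro F hF hE
      obtain ⟨a, ha, rfl⟩ := h.exists_code F (fun e he => h.cedge_sub c e (hF he)) hE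
      have h4 : a ∈ ({0, c} : Finset ℕ) := by
        rw [h3, Finset.mem_filter, List.mem_toFinset]
        exact ⟨ha, (h.sub_iff a c (hlt a ha)).1 hF⟩
      simp only [Finset.mem_insert, Finset.mem_singleton] at h4
      rcases h4 with rfl | rfl
      · left; exact cedge_zero _ _ _ _ _
      · right; rfl
  · intro hcyc
    have hc0 : 0 ≠ c := by
      rintro rfl
      have := hcyc.1
      rw [cedge_zero] at this
      simp at this
    rw [← Finset.card_pair hc0]
    congr 1
    apply Finset.Subset.antisymm _ hsub
    intro a ha
    rw [Finset.mem_filter, List.mem_toFinset] at ha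
    simp only [Finset.mem_insert, Finset.mem_singleton]
    rcases hcyc.2.2 _ ((h.sub_iff a c (hlt a ha.1)).2 ha.2) (hEv a ha.1) with h4 | h4
    · left
      rw [← cedge_zero n w φ g D] at h4
      exact h.inj_cedge (hlt a ha.1) (hlt 0 h0) h4
    · right
      exact h.inj_cedge (hlt a ha.1) (hlt c hc) h4

theorem Data.count {V : Type*} [DecidableEq V] [Fintype V] {G : SimpleGraph V} {n w : ℕ}
    {φ : ℕ → V} {g : ℕ → ℕ} {D : List (ℕ × ℕ)} (h : Data G n w φ g D) (hwD : w + D.length ≤ 15)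
    (k : ℕ) (hk : 3 ≤ k) :
    cycleCount G k = (mins w D).countP (fun c => decide (wlen w D.length g c = k)) := by
  have hnd : (mins w D).Nodup := by
    rw [mins_spec w D h.hw h.hD hwD]
    exact (code_spec w D h.hw h.hD).2.filter _
  have hlt : ∀ c ∈ mins w D, c < 2 ^ (w + D.length) := fun c hc =>
    (((code_spec w D h.hw h.hD).1 c).1 ((h.mins_iff hwD c).1 hc).1).1
  rw [cycleCount_eq G k hk, List.countP_eq_length_filter,
    ← List.toFinset_card_of_nodup (hnd.filter _), ← Set.ncard_coe_finset]
  symm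
  refine Set.ncard_congr (fun c _ => cedge n w φ g D c) ?_ ?_ ?_
  · intro c hc
    simp only [Finset.mem_coe, List.mem_toFinset, List.mem_filter, decide_eq_true_eq] at hc
    refine ⟨h.cedge_sub c, ((h.mins_iff hwD c).1 hc.1).2, ?_⟩
    rw [h.card_cedge]; exact hc.2
  · intro a c ha hc hac
    simp only [Finset.mem_coe, List.mem_toFinset, List.mem_filter, decide_eq_true_eq] at ha hc
    exact h.inj_cedge (hlt a ha.1) (hlt c hc.1) hac
  · rintro F ⟨hF, hcyc, hcard⟩
    obtain ⟨c, hc, rfl⟩ := h.exists_code F hF hcyc.2.1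
    refine ⟨c, ?_, rfl⟩
    simp only [Finset.mem_coe, List.mem_toFinset, List.mem_filter, decide_eq_true_eq]
    exact ⟨(h.mins_iff hwD c).2 ⟨hc, hcyc⟩, by rw [← h.card_cedge]; exact hcard⟩

theorem countP_split (l : List ℕ) (p q r : ℕ → Bool)
    (h : ∀ c ∈ l, (p c = true ↔ q c = true ∨ r c = true) ∧ ¬ (q c = true ∧ r c = true)) :
    l.countP p = l.countP q + l.countP r := by
  induction l with
  | nil => rfl
  | cons c l ih =>
    rw [List.countP_cons, List.countP_cons, List.countP_cons,
      ih (fun c hc => h c (List.mem_cons_of_mem _ hc))]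
    have h1 := h c List.mem_cons_self
    cases hp : p c <;> cases hq : q c <;> cases hr : r c <;> simp_all <;> omega

theorem Data.tail_count {V : Type*} [DecidableEq V] [Fintype V] {G : SimpleGraph V} {n w : ℕ}
    {φ : ℕ → V} {g : ℕ → ℕ} {D : List (ℕ × ℕ)} (h : Data G n w φ g D) (hwD : w + D.length ≤ 15)
    (hcard : Fintype.card V = n) (hev : Even n) (col : V → ZMod 2)
    (hcol : ∀ a b, G.Adj a b → col b = col a + 1)
    (hcyc : ∀ k, 4 ≤ k → k ≤ n → Even k → cycleCount G k = 2) :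
    n = (mins w D).length + 2 ∧ ∀ L, 2 ≤ L → L ≤ n → Even L → L + (mins w D).countP
      (fun c => decide (L + 1 ≤ wlen w D.length g c)) = n := by
  have hl : ∀ c ∈ mins w D, Even (wlen w D.length g c) ∧ 4 ≤ wlen w D.length g c ∧
      wlen w D.length g c ≤ n := by
    intro c hc
    have h1 := ((h.mins_iff hwD c).1 hc).2
    have h2 := cyc_len G col hcol _ (h.cedge_sub c) h1
    rwa [h.card_cedge, hcard] at h2
  have h2n : 4 ≤ n := by
    have := h.hn
    obtain ⟨m, rfl⟩ := hev
    omega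
  have main : ∀ d, 2 ≤ n - 2 * d → 2 * d ≤ n → n - 2 * d + (mins w D).countP
      (fun c => decide (n - 2 * d + 1 ≤ wlen w D.length g c)) = n := by
    intro d
    induction d with
    | zero =>
      intro _ _
      rw [List.countP_eq_zero.2]
      · omega
      · intro c hc
        have := (hl c hc).2.2
        simp; omega
    | succ d ih =>
      intro h1 h2
      have h3 := ih (by omega) (by omega)
      have h4 := hcyc (n - 2 * d) (by omega) (by omega) (by
        rw [Nat.even_iff] at hev ⊢; omega)
      rw [h.count hwD _ (by omega)] at h4
      rw [countP_split _ _ (fun c => decide (n - 2 * d + 1 ≤ wlen w D.length g c))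
        (fun c => decide (wlen w D.length g c = n - 2 * d)), h4]
      · omega
      · intro c hc
        have h5 := (hl c hc).1
        rw [Nat.even_iff] at hev h5
        simp only [decide_eq_true_eq]
        constructor
        · omega
        · omega
  have main2 : ∀ L, 2 ≤ L → L ≤ n → Even L → L + (mins w D).countP
      (fun c => decide (L + 1 ≤ wlen w D.length g c)) = n := by
    intro L h1 h2 h3
    have h4 := main ((n - L) / 2)
    rw [Nat.even_iff] at hev h3
    have h5 : n - 2 * ((n - L) / 2) = L := by omega
    rw [h5] at h4
    exact h4 h1 (by omega)
  refine ⟨?_, main2⟩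
  have h1 := main2 2 le_rfl (by omega) (by decide)
  rw [List.countP_eq_length.2] at h1
  · omega
  · intro c hc
    have := (hl c hc).2.1
    simp; omega

end BP

namespace BP

/-- A parametrization of the Hamiltonian cycle with edge set `C`, starting at an endpoint of a
chord; `S` is the set of endpoints of chords. -/
structure Rep {V : Type*} [DecidableEq V] (S : Set V) (C : Finset (Sym2 V)) (n w : ℕ)
    (φ : ℕ → V) (g : ℕ → ℕ) : Prop where
  hn : 3 ≤ n
  inj : CInj n φ
  hw : 1 ≤ w
  hg : ∀ i < w, 1 ≤ g i
  hpos : pos g w = n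
  cyc : cycE n φ = C
  pts : ∀ v, v ∈ S ↔ ∃ i < w, φ (pos g i) = v

theorem mem_cycE_iff {V : Type*} [DecidableEq V] {n : ℕ} {φ : ℕ → V} (h : CInj n φ) (hn : 1 ≤ n)
    (x : Sym2 V) : x ∈ cycE n φ ↔ ∃ k, s(φ k, φ (k + 1)) = x := by
  simp only [cycE, Finset.mem_image, Finset.mem_range]
  constructor
  · rintro ⟨k, _, hk⟩; exact ⟨k, hk⟩
  · rintro ⟨k, rfl⟩
    refine ⟨k % n, Nat.mod_lt _ hn, ?_⟩
    have h1 : φ (k % n) = φ k := by rw [h]; simp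
    have h2 : φ (k % n + 1) = φ (k + 1) := by rw [h]; simp
    rw [h1, h2]

theorem pos_rot (g : ℕ → ℕ) (w x : ℕ) (hx : x < w) :
    pos (fun i => g ((i + 1) % w)) x + g 0 = pos g (x + 1) := by
  induction x with
  | zero => simp [pos]
  | succ x ih =>
    rw [pos_succ, pos_succ g (x + 1), ← ih (by omega), Nat.mod_eq_of_lt (show x + 1 < w by omega)]
    omega

theorem pos_rot_w (g : ℕ → ℕ) (w : ℕ) (hw : 1 ≤ w) :
    pos (fun i => g ((i + 1) % w)) w = pos g w := by
  obtain ⟨u, rfl⟩ : ∃ u, w = u + 1 := ⟨w - 1, by omega⟩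
  have := pos_rot g (u + 1) u (by omega)
  rw [pos_succ, Nat.mod_self, this]

theorem CInj.rot {V : Type*} {n : ℕ} {φ : ℕ → V} (h : CInj n φ) (r : ℕ) :
    CInj n (fun k => φ (k + r)) := by
  intro i j
  rw [h]
  exact ⟨fun h => Nat.ModEq.add_right_cancel' r h, fun h => Nat.ModEq.add_right r h⟩

theorem CInj.rot_cyc {V : Type*} [DecidableEq V] {n : ℕ} {φ : ℕ → V} (h : CInj n φ) (hn : 1 ≤ n)
    (r : ℕ) : cycE n (fun k => φ (k + r)) = cycE n φ := by
  ext x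
  rw [mem_cycE_iff (h.rot r) hn, mem_cycE_iff h hn]
  constructor
  · rintro ⟨k, rfl⟩
    exact ⟨k + r, by rw [show k + 1 + r = k + r + 1 by omega]⟩
  · rintro ⟨k, rfl⟩
    refine ⟨k + (n - r % n), ?_⟩
    have h1 : ∀ l, φ (l + (n - r % n) + r) = φ l := by
      intro l
      rw [h]
      have h2 := Nat.mod_lt r (show n > 0 by omega)
      have h3 := Nat.div_add_mod r n
      rw [show l + (n - r % n) + r = l + n * (r / n + 1) by rw [Nat.mul_add]; omega]
      simp
    have h2 := h1 (k + 1)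
    rw [show k + 1 + (n - r % n) + r = k + (n - r % n) + 1 + r by omega] at h2
    rw [h1, h2]

theorem Rep.rot {V : Type*} [DecidableEq V] {S : Set V} {C : Finset (Sym2 V)} {n w : ℕ}
    {φ : ℕ → V} {g : ℕ → ℕ} (h : Rep S C n w φ g) :
    ∃ φ' g', Rep S C n w φ' g' ∧ ∀ x < w, φ' (pos g' x) = φ (pos g ((x + 1) % w)) := by
  have hn := h.hn
  have hq : ∀ x < w, φ (pos (fun i => g ((i + 1) % w)) x + g 0) =
      φ (pos g ((x + 1) % w)) := by
    intro x hx
    rw [pos_rot g w x hx, mod_succ' hx]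
    split_ifs with h1
    · rw [h1, h.hpos, pos_zero, h.inj]; simp
    · rfl
  refine ⟨fun k => φ (k + g 0), fun i => g ((i + 1) % w), ⟨hn, h.inj.rot _, h.hw, ?_, ?_, ?_, ?_⟩, hq⟩
  · intro i hi
    exact h.hg _ (Nat.mod_lt _ (by omega))
  · rw [pos_rot_w g w h.hw, h.hpos]
  · rw [h.inj.rot_cyc (by omega), h.cyc]
  · intro v
    rw [h.pts]
    constructor
    · rintro ⟨i, hi, rfl⟩
      refine ⟨(i + w - 1) % w, Nat.mod_lt _ (by omega), ?_⟩
      rw [hq _ (Nat.mod_lt _ (by omega))]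
      congr 2
      rw [mod_succ' (Nat.mod_lt _ (by omega)), mod_pred' hi]
      split_ifs <;> omega
    · rintro ⟨i, hi, rfl⟩
      rw [hq i hi]
      exact ⟨_, Nat.mod_lt _ (by omega), rfl⟩

theorem Rep.rots {V : Type*} [DecidableEq V] {S : Set V} {C : Finset (Sym2 V)} {n w : ℕ}
    {φ : ℕ → V} {g : ℕ → ℕ} (h : Rep S C n w φ g) (r : ℕ) :
    ∃ φ' g', Rep S C n w φ' g' ∧ ∀ x < w, φ' (pos g' x) = φ (pos g ((x + r) % w)) := by
  induction r with
  | zero =>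
    refine ⟨φ, g, h, fun x hx => ?_⟩
    rw [Nat.add_zero, Nat.mod_eq_of_lt hx]
  | succ r ih =>
    obtain ⟨φ', g', h', hq⟩ := ih
    obtain ⟨φ'', g'', h'', hq'⟩ := h'.rot
    refine ⟨φ'', g'', h'', fun x hx => ?_⟩
    rw [hq' x hx, hq _ (Nat.mod_lt _ (by omega)), Nat.mod_add_mod]
    congr 3
    omega

theorem pos_refl (g : ℕ → ℕ) (w x : ℕ) (hx : x ≤ w) :
    pos (fun i => g (w - 1 - i)) x + pos g (w - x) = pos g w := by
  induction x with
  | zero => simp [pos]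
  | succ x ih =>
    rw [pos_succ]
    have h1 := pos_succ g (w - (x + 1))
    rw [show w - (x + 1) + 1 = w - x by omega] at h1
    rw [← ih (by omega), h1, show w - 1 - x = w - (x + 1) by omega]
    omega

theorem refl_mod (n i : ℕ) (hn : 1 ≤ n) :
    (n - i % n) % n = if i % n = 0 then 0 else n - i % n := by
  have := Nat.mod_lt i (show n > 0 by omega)
  split_ifs with h
  · rw [h]; simp
  · exact Nat.mod_eq_of_lt (by omega)

theorem CInj.refl {V : Type*} {n : ℕ} {φ : ℕ → V} (h : CInj n φ) (hn : 1 ≤ n) :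
    CInj n (fun k => φ (n - k % n)) := by
  intro i j
  rw [h, refl_mod n i hn, refl_mod n j hn]
  have h1 := Nat.mod_lt i (show n > 0 by omega)
  have h2 := Nat.mod_lt j (show n > 0 by omega)
  split_ifs <;> omega

theorem CInj.refl_cyc {V : Type*} [DecidableEq V] {n : ℕ} {φ : ℕ → V} (h : CInj n φ)
    (hn : 1 ≤ n) : cycE n (fun k => φ (n - k % n)) = cycE n φ := by
  have key : ∀ k < n, s(φ (n - k % n), φ (n - (k + 1) % n)) = s(φ (n - 1 - k), φ (n - 1 - k + 1)) := by
    intro k hk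
    rw [Nat.mod_eq_of_lt hk, mod_succ' hk, Sym2.eq_swap]
    have h1 : n - 1 - k + 1 = n - k := by omega
    have h3 : φ (n - if k + 1 = n then 0 else k + 1) = φ (n - 1 - k) := by
      rw [h]
      split_ifs with h2
      · rw [show n - 1 - k = 0 by omega]; simp
      · rw [show n - (k + 1) = n - 1 - k by omega]
    rw [h1, h3]
  ext x
  simp only [cycE, Finset.mem_image, Finset.mem_range]
  constructor
  · rintro ⟨k, hk, rfl⟩
    exact ⟨n - 1 - k, by omega, (key k hk).symm⟩
  · rintro ⟨k, hk, rfl⟩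
    refine ⟨n - 1 - k, by omega, ?_⟩
    rw [key _ (by omega), show n - 1 - (n - 1 - k) = k by omega]

theorem Rep.refl {V : Type*} [DecidableEq V] {S : Set V} {C : Finset (Sym2 V)} {n w : ℕ}
    {φ : ℕ → V} {g : ℕ → ℕ} (h : Rep S C n w φ g) :
    ∃ φ' g', Rep S C n w φ' g' ∧ ∀ x < w, φ' (pos g' x) = φ (pos g ((w - x) % w)) := by
  have hn := h.hn
  have hw := h.hw
  have hq : ∀ x < w, φ (n - pos (fun i => g (w - 1 - i)) x % n) =
      φ (pos g ((w - x) % w)) := by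
    intro x hx
    have h1 := pos_refl g w x hx.le
    rw [h.hpos] at h1
    by_cases h0 : x = 0
    · subst h0
      rw [pos_zero, Nat.zero_mod, Nat.sub_zero, Nat.sub_zero, Nat.mod_self, pos_zero, h.inj]
      simp
    · have h2 := pos_strict g h.hg (show 0 < w - x by omega) (by omega)
      rw [pos_zero] at h2
      rw [Nat.mod_eq_of_lt (show w - x < w by omega), Nat.mod_eq_of_lt (by omega)]
      congr 1
      omega
  refine ⟨fun k => φ (n - k % n), fun i => g (w - 1 - i), ⟨hn, h.inj.refl (by omega), hw, ?_, ?_, ?_, ?_⟩, hq⟩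
  · intro i hi
    exact h.hg _ (by omega)
  · have := pos_refl g w w le_rfl
    rw [Nat.sub_self, pos_zero, h.hpos] at this
    omega
  · rw [h.inj.refl_cyc (by omega), h.cyc]
  · intro v
    rw [h.pts]
    constructor
    · rintro ⟨i, hi, rfl⟩
      refine ⟨(w - i) % w, Nat.mod_lt _ (by omega), ?_⟩
      rw [hq _ (Nat.mod_lt _ (by omega))]
      congr 2
      by_cases h0 : i = 0
      · subst h0; simp
      · rw [Nat.mod_eq_of_lt (show w - i < w by omega), Nat.mod_eq_of_lt (by omega)]
        omega
    · rintro ⟨i, hi, rfl⟩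
      rw [hq i hi]
      exact ⟨_, Nat.mod_lt _ (by omega), rfl⟩

theorem Rep.refls {V : Type*} [DecidableEq V] {S : Set V} {C : Finset (Sym2 V)} {n w : ℕ}
    {φ : ℕ → V} {g : ℕ → ℕ} (h : Rep S C n w φ g) (r : ℕ) :
    ∃ φ' g', Rep S C n w φ' g' ∧ ∀ x < w, φ' (pos g' x) = φ (pos g ((w + r - x) % w)) := by
  obtain ⟨φ', g', h', hq⟩ := h.rots r
  obtain ⟨φ'', g'', h'', hq'⟩ := h'.refl
  refine ⟨φ'', g'', h'', fun x hx => ?_⟩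
  rw [hq' x hx, hq _ (Nat.mod_lt _ (by omega)), Nat.mod_add_mod]
  congr 3
  omega

theorem sum_pairs (w : ℕ) (hw : w < 11) (h : ℕ → ℕ → ℕ) (hs : ∀ x y, h x y = h y x)
    (h0 : ∀ x, h x x = 0) : ∑ x ∈ Finset.range w, ∑ y ∈ Finset.range w, h x y =
      2 * ((pairs w).map (fun p => h p.1 p.2)).sum := by
  rw [← List.sum_toFinset _ (pairs_nodup w hw)]
  have h1 : (pairs w).toFinset =
      (Finset.range w ×ˢ Finset.range w).filter (fun p => p.1 < p.2) := by
    ext ⟨x, y⟩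
    simp only [List.mem_toFinset, Finset.mem_filter, Finset.mem_product, Finset.mem_range]
    constructor
    · intro hp
      have := pairs_lt w hw _ hp
      simp only at this
      omega
    · rintro ⟨⟨_, hy⟩, hxy⟩
      exact pairs_mem w hw x y hy hxy
  rw [h1, ← Finset.sum_product', ← Finset.sum_filter_add_sum_filter_not _ (fun p => p.1 < p.2), two_mul]
  congr 1
  rw [← Finset.sum_filter_add_sum_filter_not _ (fun p => p.2 < p.1)]
  refine Eq.trans (congrArg₂ _ rfl (Finset.sum_eq_zero ?_)) ?_
  rotate_left
  · rw [add_zero]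
    refine Finset.sum_nbij' Prod.swap Prod.swap ?_ ?_ ?_ ?_ ?_
    · rintro ⟨x, y⟩; simp; omega
    · rintro ⟨x, y⟩; simp; omega
    · rintro ⟨x, y⟩ _; rfl
    · rintro ⟨x, y⟩ _; rfl
    · rintro ⟨x, y⟩ _; exact hs x y
  · rintro ⟨x, y⟩
    simp only [Finset.mem_filter]
    rintro ⟨⟨_, h2⟩, h3⟩
    obtain rfl : x = y := by omega
    exact h0 x

theorem kk_symm (x y : ℕ) : kk x y = kk y x := by
  rcases lt_trichotomy x y with h | rfl | h
  · have h1 : Nat.ble x y = true := by rw [Nat.ble_eq]; exact h.le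
    have h2 : Nat.ble y x = false := by
      cases hb : Nat.ble y x with
      | false => rfl
      | true => rw [Nat.ble_eq] at hb; omega
    rw [kk, kk, h1, h2]; rfl
  · rfl
  · have h1 : Nat.ble y x = true := by rw [Nat.ble_eq]; exact h.le
    have h2 : Nat.ble x y = false := by
      cases hb : Nat.ble x y with
      | false => rfl
      | true => rw [Nat.ble_eq] at hb; omega
    rw [kk, kk, h1, h2]; rfl

/-- The list of chords. -/
noncomputable def chl (w : ℕ) (R : ℕ → ℕ → Prop) : List (ℕ × ℕ) :=
  open Classical in (pairs w).filter (fun p => decide (R p.1 p.2))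

theorem key_chl (w : ℕ) (hw : w < 11) (R : ℕ → ℕ → Prop) (hs : ∀ x y, R x y ↔ R y x)
    (h0 : ∀ x, ¬ R x x) (f : ℕ → ℕ) : 2 * key f (chl w R).reverse =
      open Classical in
      ∑ x ∈ Finset.range w, ∑ y ∈ Finset.range w, if R x y then kk (f x) (f y) else 0 := by
  classical
  rw [sum_pairs w hw (fun x y => if R x y then kk (f x) (f y) else 0)
    (fun x y => by simp only [hs x y, kk_symm]) (fun x => if_neg (h0 x)), key_eq,
    List.map_reverse, List.sum_reverse, chl]
  congr 1
  induction pairs w with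
  | nil => rfl
  | cons p l ih =>
    rw [List.filter_cons, List.map_cons, List.sum_cons]
    by_cases hp : R p.1 p.2
    · simp only [hp, decide_true, if_true, List.map_cons, List.sum_cons]
      rw [← ih]
    · simp only [hp, decide_false, if_false, zero_add, Bool.false_eq_true]
      rw [← ih]

theorem key_trans (w : ℕ) (hw : w < 11) (R R' : ℕ → ℕ → Prop) (hs : ∀ x y, R x y ↔ R y x)
    (h0 : ∀ x, ¬ R x x) (hs' : ∀ x y, R' x y ↔ R' y x) (h0' : ∀ x, ¬ R' x x) (f : ℕ → ℕ)
    (hf : ∀ x < w, f x < w) (hfi : ∀ x < w, ∀ y < w, f x = f y → x = y)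
    (hR : ∀ x < w, ∀ y < w, R x y ↔ R' (f x) (f y)) :
    key f (chl w R).reverse = key (fun x => x) (chl w R').reverse := by
  classical
  have h1 := key_chl w hw R hs h0 f
  have h2 := key_chl w hw R' hs' h0' (fun x => x)
  have hre : ∀ F : ℕ → ℕ, ∑ x ∈ Finset.range w, F (f x) = ∑ x ∈ Finset.range w, F x := by
    intro F
    have hm : Set.MapsTo f (Finset.range w) (Finset.range w) := by
      intro x hx; simp at hx ⊢; exact hf x hx
    have hi : Set.InjOn f (Finset.range w) := by
      intro x hx y hy; simp at hx hy; exact hfi x hx y hy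
    exact Finset.sum_nbij f hm hi (Finset.surjOn_of_injOn_of_card_le f hm hi le_rfl) (fun _ _ => rfl)
  have h3 : (∑ x ∈ Finset.range w, ∑ y ∈ Finset.range w, if R x y then kk (f x) (f y) else 0) =
      ∑ x ∈ Finset.range w, ∑ y ∈ Finset.range w, if R' x y then kk x y else 0 := by
    rw [← hre (fun x => ∑ y ∈ Finset.range w, if R' x y then kk x y else 0)]
    refine Finset.sum_congr rfl fun x hx => ?_
    rw [← hre (fun y => if R' (f x) y then kk (f x) y else 0)]
    refine Finset.sum_congr rfl fun y hy => ?_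
    simp only [Finset.mem_range] at hx hy
    simp only [hR x hx y hy]
  rw [h3] at h1
  omega

/-- The chord relation between the points. -/
def crel {V : Type*} (G : SimpleGraph V) (C : Finset (Sym2 V)) (φ : ℕ → V) (g : ℕ → ℕ)
    (x y : ℕ) : Prop := G.Adj (φ (pos g x)) (φ (pos g y)) ∧ s(φ (pos g x), φ (pos g y)) ∉ C

theorem crel_symm {V : Type*} (G : SimpleGraph V) (C : Finset (Sym2 V)) (φ : ℕ → V) (g : ℕ → ℕ)
    (x y : ℕ) : crel G C φ g x y ↔ crel G C φ g y x := by
  rw [crel, crel, G.adj_comm, Sym2.eq_swap]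

theorem crel_irrefl {V : Type*} (G : SimpleGraph V) (C : Finset (Sym2 V)) (φ : ℕ → V) (g : ℕ → ℕ)
    (x : ℕ) : ¬ crel G C φ g x x := fun h => G.irrefl h.1

theorem exists_canon {V : Type*} [DecidableEq V] (G : SimpleGraph V) {S : Set V}
    {C : Finset (Sym2 V)} {n w : ℕ} {φ : ℕ → V} {g : ℕ → ℕ} (h : Rep S C n w φ g) (hw : w < 11) :
    ∃ φ g, Rep S C n w φ g ∧ canon w (chl w (crel G C φ g)).reverse = true := by
  classical
  have hex : ∃ K φ g, Rep S C n w φ g ∧ key (fun x => x) (chl w (crel G C φ g)).reverse = K :=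
    ⟨_, φ, g, h, rfl⟩
  obtain ⟨φ, g, h, hK⟩ := Nat.find_spec hex
  have hmin : ∀ φ' g', Rep S C n w φ' g' → key (fun x => x) (chl w (crel G C φ g)).reverse ≤
      key (fun x => x) (chl w (crel G C φ' g')).reverse := by
    intro φ' g' h'
    rw [hK]
    exact Nat.find_min' hex ⟨φ', g', h', rfl⟩
  refine ⟨φ, g, h, canon_true w _ fun r hr => ⟨?_, ?_⟩⟩
  · obtain ⟨φ', g', h', hq⟩ := h.rots (w - r)
    rw [key_trans w hw _ (crel G C φ' g') (crel_symm _ _ _ _) (crel_irrefl _ _ _ _)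
      (crel_symm _ _ _ _) (crel_irrefl _ _ _ _) (fun x => (x + r) % w)]
    · exact hmin _ _ h'
    · intro x hx; exact Nat.mod_lt _ (by omega)
    · intro x hx y hy hxy
      have h1 : x % w = y % w := Nat.ModEq.add_right_cancel' r hxy
      rwa [Nat.mod_eq_of_lt hx, Nat.mod_eq_of_lt hy] at h1
    · have hq' : ∀ x < w, φ' (pos g' ((x + r) % w)) = φ (pos g x) := by
        intro x hx
        rw [hq _ (Nat.mod_lt _ (by omega)), Nat.mod_add_mod, show x + r + (w - r) = x + w by omega,
          Nat.add_mod_right, Nat.mod_eq_of_lt hx]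
      intro x hx y hy
      rw [crel, crel, hq' x hx, hq' y hy]
  · obtain ⟨φ', g', h', hq⟩ := h.refls r
    have hinv : ∀ x < w, (w + r - (w + r - x) % w) % w = x := by
      intro x hx
      by_cases hxr : x ≤ r
      · rw [show w + r - x = r - x + w by omega, Nat.add_mod_right, Nat.mod_eq_of_lt (show r - x < w by omega),
          show w + r - (r - x) = x + w by omega, Nat.add_mod_right, Nat.mod_eq_of_lt hx]
      · rw [Nat.mod_eq_of_lt (show w + r - x < w by omega), show w + r - (w + r - x) = x by omega,
          Nat.mod_eq_of_lt hx]
    rw [key_trans w hw _ (crel G C φ' g') (crel_symm _ _ _ _) (crel_irrefl _ _ _ _)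
      (crel_symm _ _ _ _) (crel_irrefl _ _ _ _) (fun x => (w + r - x) % w)]
    · exact hmin _ _ h'
    · intro x hx; exact Nat.mod_lt _ (by omega)
    · intro x hx y hy hxy
      rw [← hinv x hx, ← hinv y hy, hxy]
    · have hq' : ∀ x < w, φ' (pos g' ((w + r - x) % w)) = φ (pos g x) := by
        intro x hx
        rw [hq _ (Nat.mod_lt _ (by omega)), hinv x hx]
      intro x hx y hy
      rw [crel, crel, hq' x hx, hq' y hy]

end BP

set_option linter.unusedVariables false
namespace BP

theorem pos_congr {g g' : ℕ → ℕ} (w : ℕ) (h : ∀ i < w, g i = g' i) : pos g w = pos g' w := by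
  induction w with
  | zero => rfl
  | succ w ih => rw [pos_succ, pos_succ, ih (fun i hi => h i (by omega)), h w (by omega)]

/-- A set of positions containing `0` is described by gaps. -/
theorem exists_gaps (P : ℕ → Prop) (h0 : P 0) (n : ℕ) : ∃ w g, 1 ≤ w ∧ (∀ i < w, 1 ≤ g i) ∧
    pos g w = n + 1 ∧ ∀ k < n + 1, P k ↔ ∃ i < w, pos g i = k := by
  induction n with
  | zero =>
    refine ⟨1, fun _ => 1, le_rfl, fun _ _ => le_rfl, rfl, fun k hk => ?_⟩
    obtain rfl : k = 0 := by omega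
    exact ⟨fun _ => ⟨0, by omega, rfl⟩, fun _ => h0⟩
  | succ n ih =>
    obtain ⟨w, g, hw, hg, hp, hP⟩ := ih
    by_cases hn : P (n + 1)
    · have hc : ∀ i ≤ w, pos (fun i => if i = w then 1 else g i) i = pos g i := by
        intro i hi
        refine pos_congr i fun j hj => ?_
        rw [if_neg (by omega)]
      refine ⟨w + 1, fun i => if i = w then 1 else g i, by omega, ?_, ?_, ?_⟩
      · intro i hi
        dsimp only
        split_ifs with h
        · exact le_rfl
        · exact hg i (by omega)
      · rw [pos_succ, hc w le_rfl, hp, if_pos rfl]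
      · intro k hk
        by_cases hk' : k = n + 1
        · subst hk'
          exact ⟨fun _ => ⟨w, by omega, (hc w le_rfl).trans hp⟩, fun _ => hn⟩
        · rw [hP k (by omega)]
          constructor
          · rintro ⟨i, hi, h⟩
            exact ⟨i, by omega, (hc i hi.le).trans h⟩
          · rintro ⟨i, hi, h⟩
            rw [hc i (by omega)] at h
            refine ⟨i, ?_, h⟩
            by_contra hiw
            obtain rfl : i = w := by omega
            omega
    · have hc : ∀ i < w, pos (fun i => if i = w - 1 then g i + 1 else g i) i = pos g i := by
        intro i hi
        refine pos_congr i fun j hj => ?_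
        rw [if_neg (by omega)]
      refine ⟨w, fun i => if i = w - 1 then g i + 1 else g i, by omega, ?_, ?_, ?_⟩
      · intro i hi
        dsimp only
        have := hg i hi
        split_ifs <;> omega
      · obtain ⟨u, rfl⟩ : ∃ u, w = u + 1 := ⟨w - 1, by omega⟩
        rw [pos_succ, hc u (by omega), Nat.add_sub_cancel, if_pos rfl, ← hp, pos_succ]
        omega
      · intro k hk
        by_cases hk' : k = n + 1
        · subst hk'
          refine ⟨fun h => absurd h hn, ?_⟩
          rintro ⟨i, hi, h⟩
          rw [hc i hi] at h
          have := pos_strict g hg hi le_rfl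
          omega
        · rw [hP k (by omega)]
          constructor
          · rintro ⟨i, hi, h⟩
            exact ⟨i, hi, (hc i hi).trans h⟩
          · rintro ⟨i, hi, h⟩
            exact ⟨i, hi, (hc i hi).symm.trans h⟩

theorem Rep.pinj {V : Type*} [DecidableEq V] {S : Set V} {C : Finset (Sym2 V)} {n w : ℕ}
    {φ : ℕ → V} {g : ℕ → ℕ} (h : Rep S C n w φ g) {x y : ℕ} (hx : x < w) (hy : y < w)
    (hxy : φ (pos g x) = φ (pos g y)) : x = y := by
  have h1 := pos_strict g h.hg hx le_rfl
  have h2 := pos_strict g h.hg hy le_rfl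
  rw [h.hpos] at h1 h2
  rw [h.inj, Nat.mod_eq_of_lt h1, Nat.mod_eq_of_lt h2] at hxy
  rcases lt_trichotomy x y with h3 | h3 | h3
  · have := pos_strict g h.hg h3 hy.le; omega
  · exact h3
  · have := pos_strict g h.hg h3 hx.le; omega

theorem mem_chl {w : ℕ} {R : ℕ → ℕ → Prop} {p : ℕ × ℕ} :
    p ∈ chl w R ↔ p ∈ pairs w ∧ R p.1 p.2 := by
  classical
  simp [chl, List.mem_filter]

theorem Rep.data {V : Type*} [DecidableEq V] {G : SimpleGraph V} {S : Set V}
    {C : Finset (Sym2 V)} {n w : ℕ}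
    {φ : ℕ → V} {g : ℕ → ℕ} (h : Rep S C n w φ g) (hw : w < 11)
    (hS : ∀ v, v ∈ S ↔ ∃ u, G.Adj v u ∧ s(v, u) ∉ C) (hCG : ∀ e ∈ C, e ∈ G.edgeSet) :
    Data G n w φ g (chl w (crel G C φ g)).reverse := by
  classical
  have hD : ∀ p ∈ (chl w (crel G C φ g)).reverse, p.1 < p.2 ∧ p.2 < w := by
    intro p hp
    rw [List.mem_reverse, mem_chl] at hp
    exact pairs_lt w hw p hp.1
  have hR : ∀ p ∈ (chl w (crel G C φ g)).reverse, crel G C φ g p.1 p.2 := by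
    intro p hp
    rw [List.mem_reverse, mem_chl] at hp
    exact hp.2
  have hnd : (chl w (crel G C φ g)).reverse.Nodup := by
    rw [List.nodup_reverse]
    exact (pairs_nodup w hw).filter _
  have hmem : ∀ k < n, s(φ k, φ (k + 1)) ∈ C := by
    intro k hk
    rw [← h.cyc, cycE, Finset.mem_image]
    exact ⟨k, Finset.mem_range.2 hk, rfl⟩
  refine ⟨h.hn, h.inj, h.hw, hD, h.hg, h.hpos, ?_, ?_⟩
  · intro k hk l hl hkl
    by_cases hkn : k < n <;> by_cases hln : l < n
    · rw [edg_cyc hkn, edg_cyc hln] at hkl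
      exact h.inj.edge_inj h.hn k hkn l hln hkl
    · obtain ⟨j, rfl⟩ : ∃ j, l = n + j := ⟨l - n, by omega⟩
      rw [edg_cyc hkn, edg_chord] at hkl
      have := (hR _ (getD_mem (show j < _ by omega))).2
      rw [← hkl] at this
      exact absurd (hmem k hkn) this
    · obtain ⟨j, rfl⟩ : ∃ j, k = n + j := ⟨k - n, by omega⟩
      rw [edg_cyc hln, edg_chord] at hkl
      have := (hR _ (getD_mem (show j < _ by omega))).2
      rw [hkl] at this
      exact absurd (hmem l hln) this
    · obtain ⟨j, rfl⟩ : ∃ j, k = n + j := ⟨k - n, by omega⟩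
      obtain ⟨i, rfl⟩ : ∃ i, l = n + i := ⟨l - n, by omega⟩
      rw [edg_chord, edg_chord] at hkl
      have hj : j < (chl w (crel G C φ g)).reverse.length := by omega
      have hi : i < (chl w (crel G C φ g)).reverse.length := by omega
      have d1 := hD _ (getD_mem hj)
      have d2 := hD _ (getD_mem hi)
      have e : (chl w (crel G C φ g)).reverse.getD j (0, 0) =
          (chl w (crel G C φ g)).reverse.getD i (0, 0) := by
        rw [Sym2.eq_iff] at hkl
        rcases hkl with ⟨a, b⟩ | ⟨a, b⟩
        · exact Prod.ext (h.pinj (by omega) (by omega) a) (h.pinj (by omega) (by omega) b)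
        · have a' := h.pinj (by omega) (by omega) a
          have b' := h.pinj (by omega) (by omega) b
          omega
      rw [List.getD_eq_getElem _ _ hj, List.getD_eq_getElem _ _ hi] at e
      rw [(hnd.getElem_inj_iff).1 e]
  · intro x
    constructor
    · intro hx
      by_cases hxC : x ∈ C
      · rw [← h.cyc, cycE, Finset.mem_image] at hxC
        obtain ⟨k, hk, rfl⟩ := hxC
        rw [Finset.mem_range] at hk
        exact ⟨k, by omega, edg_cyc hk⟩
      · induction x using Sym2.ind with
        | _ a b =>
          rw [mem_edgeSet] at hx
          obtain ⟨i, hi, rfl⟩ := (h.pts a).1 ((hS a).2 ⟨b, hx, hxC⟩)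
          obtain ⟨j, hj, rfl⟩ := (h.pts b).1 ((hS b).2 ⟨_, hx.symm, by rwa [Sym2.eq_swap]⟩)
          have key : ∀ i < w, ∀ j < w, crel G C φ g i j → i < j →
              ∃ k < n + (chl w (crel G C φ g)).reverse.length,
                edg n φ g (chl w (crel G C φ g)).reverse k = s(φ (pos g i), φ (pos g j)) := by
            intro i hi j hj hij hlt
            have hm : (i, j) ∈ (chl w (crel G C φ g)).reverse := by
              rw [List.mem_reverse, mem_chl]
              exact ⟨pairs_mem w hw i j hj hlt, hij⟩
            obtain ⟨t, ht, he⟩ := List.getElem_of_mem hm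
            refine ⟨n + t, by omega, ?_⟩
            rw [edg_chord, List.getD_eq_getElem _ _ ht, he]
          have hij : crel G C φ g i j := ⟨hx, hxC⟩
          rcases lt_trichotomy i j with h3 | h3 | h3
          · exact key i hi j hj hij h3
          · subst h3; exact absurd hij (crel_irrefl _ _ _ _ _)
          · rw [Sym2.eq_swap]
            exact key j hj i hi ((crel_symm _ _ _ _ _ _).1 hij) h3
    · rintro ⟨k, hk, rfl⟩
      by_cases hkn : k < n
      · rw [edg_cyc hkn]; exact hCG _ (hmem k hkn)
      · obtain ⟨j, rfl⟩ : ∃ j, k = n + j := ⟨k - n, by omega⟩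
        rw [edg_chord]
        exact (hR _ (getD_mem (show j < _ by omega))).1

theorem Data.ncard {V : Type*} {G : SimpleGraph V} {n w : ℕ} {φ : ℕ → V} {g : ℕ → ℕ}
    {D : List (ℕ × ℕ)} (h : Data G n w φ g D) : G.edgeSet.ncard = n + D.length := by
  classical
  have h1 : G.edgeSet = ↑((Finset.range (n + D.length)).image (edg n φ g D)) := by
    ext x
    rw [h.eset]
    simp
  rw [h1, Set.ncard_coe_finset, Finset.card_image_of_injOn, Finset.card_range]
  intro k hk l hl hkl
  simp only [Finset.coe_range, Set.mem_Iio] at hk hl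
  exact h.einj k hk l hl hkl

theorem Rep.final {V : Type*} [DecidableEq V] [Fintype V] {G : SimpleGraph V} {S : Set V}
    {C : Finset (Sym2 V)} {n w : ℕ}
    {φ : ℕ → V} {g : ℕ → ℕ} (h : Rep S C n w φ g) (hw : w < 11)
    (hS : ∀ v, v ∈ S ↔ ∃ u, G.Adj v u ∧ s(v, u) ∉ C) (hCG : ∀ e ∈ C, e ∈ G.edgeSet)
    (hcan : canon w (chl w (crel G C φ g)).reverse = true)
    (hcard : Fintype.card V = n) (he : G.edgeSet.ncard ≤ n + 5) (hev : Even n) (col : V → ZMod 2)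
    (hcol : ∀ a b, G.Adj a b → col b = col a + 1)
    (hcyc : ∀ k, 4 ≤ k → k ≤ n → Even k → cycleCount G k = 2) : n = 14 ∨ n = 22 := by
  classical
  have hd := h.data hw hS hCG
  have hlen := hd.ncard
  rw [List.length_reverse] at hlen
  obtain ⟨t1, t2⟩ := hd.tail_count (by rw [List.length_reverse]; omega) hcard hev col hcol hcyc
  have hmem : ∀ k, s(φ k, φ (k + 1)) ∈ C := by
    intro k
    rw [← h.cyc, mem_cycE_iff h.inj (by have := h.hn; omega)]
    exact ⟨k, rfl⟩
  have hck : ∀ k : ℕ, col (φ k) = col (φ 0) + k := by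
    intro k
    induction k with
    | zero => simp
    | succ k ih =>
      rw [hcol _ _ (hCG _ (hmem k)), ih]
      push_cast; ring
  have hcov : ∀ i < w, ∃ p ∈ chl w (crel G C φ g), p.1 = i ∨ p.2 = i := by
    intro i hi
    obtain ⟨u, hu, huC⟩ := (hS _).1 ((h.pts _).2 ⟨i, hi, rfl⟩)
    obtain ⟨j, hj, rfl⟩ := (h.pts u).1 ((hS u).2 ⟨_, hu.symm, by rwa [Sym2.eq_swap]⟩)
    have hij : crel G C φ g i j := ⟨hu, huC⟩
    rcases lt_trichotomy i j with h3 | h3 | h3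
    · exact ⟨(i, j), mem_chl.2 ⟨pairs_mem w hw i j hj h3, hij⟩, Or.inl rfl⟩
    · subst h3; exact absurd hij (crel_irrefl _ _ _ _ _)
    · exact ⟨(j, i), mem_chl.2 ⟨pairs_mem w hw j i hi h3, (crel_symm _ _ _ _ _ _).1 hij⟩,
        Or.inr rfl⟩
  have hw2 : 2 ≤ w := by
    obtain ⟨p, hp, _⟩ := hcov 0 h.hw
    have := pairs_lt w hw p (mem_chl.1 hp).1
    omega
  refine comp_final w (chl w (crel G C φ g)) List.filter_sublist hw2 (by omega) hcov hcan g n t1 hev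
    h.hpos h.hg ?_ ?_ (by simpa only [List.length_reverse] using t2)
  · intro p hp hpp
    have h1 := hcol _ _ (mem_chl.1 hp).2.1
    rw [hck, hck (pos g p.1)] at h1
    have h2 : ((pos g p.1 : ℕ) : ZMod 2) = (pos g p.2 : ℕ) := by
      rw [ZMod.natCast_eq_natCast_iff]; exact hpp
    rw [h2] at h1
    have h3 : ∀ x : ZMod 2, x ≠ x + 1 := by decide
    exact h3 _ h1
  · intro i hi hor hgi
    have h1 : pos g (i + 1) = pos g i + 1 := by rw [pos_succ, hgi]
    rcases hor with hor | ⟨hor, hiw⟩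
    · have h2 := (mem_chl.1 hor).2.2
      simp only [h1] at h2
      exact h2 (hmem _)
    · have h2 := (mem_chl.1 hor).2.2
      rw [hiw, h.hpos] at h1
      have h3 : φ (pos g 0) = φ n := by rw [pos_zero, h.inj]; simp
      simp only [h3, h1] at h2
      rw [Sym2.eq_swap] at h2
      exact h2 (hmem _)

theorem main {V : Type*} [DecidableEq V] [Fintype V] (G : SimpleGraph V) (n : ℕ)
    (hcard : Fintype.card V = n) (hn : 4 ≤ n) (he : G.edgeSet.ncard ≤ n + 5) (hev : Even n)
    (col : V → ZMod 2) (hcol : ∀ a b, G.Adj a b → col b = col a + 1)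
    (hcyc : ∀ k, 4 ≤ k → k ≤ n → Even k → cycleCount G k = 2) : n = 14 ∨ n = 22 := by
  classical
  have h2 := hcyc n hn le_rfl hev
  have hne : {H : G.Subgraph | Nonempty (H.coe ≃g cycleGraph n)}.Nonempty := by
    rw [Set.nonempty_iff_ne_empty]
    intro h0
    rw [cycleCount, h0, Set.ncard_empty] at h2
    omega
  obtain ⟨H, ⟨f⟩⟩ := hne
  obtain ⟨φ, hφ, hHe, -⟩ := cinj_of_iso G n (by omega) H f
  have hCG : ∀ e ∈ cycE n φ, e ∈ G.edgeSet := by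
    intro e hec
    apply H.edgeSet_subset
    rw [hHe]; exact hec
  have hsurj : ∀ v, ∃ k < n, φ k = v := by
    have h1 : (Finset.range n).image φ = Finset.univ := by
      apply Finset.eq_univ_of_card
      rw [Finset.card_image_of_injOn, Finset.card_range, hcard]
      intro a ha b hb hab
      simp only [Finset.coe_range, Set.mem_Iio] at ha hb
      rwa [hφ, Nat.mod_eq_of_lt ha, Nat.mod_eq_of_lt hb] at hab
    intro v
    have := Finset.mem_univ v
    rw [← h1] at this
    simpa using this
  by_cases hch : ∃ v, ∃ u, G.Adj v u ∧ s(v, u) ∉ cycE n φ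
  · obtain ⟨v0, hv0⟩ := hch
    obtain ⟨r, hr, rfl⟩ := hsurj v0
    have hψ : CInj n (fun k => φ (k + r)) := hφ.rot r
    have hψc : cycE n (fun k => φ (k + r)) = cycE n φ := hφ.rot_cyc (by omega) r
    have hSd : ∀ v, v ∈ {v | ∃ u, G.Adj v u ∧ s(v, u) ∉ cycE n φ} ↔
      ∃ u, G.Adj v u ∧ s(v, u) ∉ cycE n φ := fun v => Iff.rfl
    generalize {v | ∃ u, G.Adj v u ∧ s(v, u) ∉ cycE n φ} = S at hSd
    obtain ⟨w, g, hw, hg, hp, hP⟩ := exists_gaps (fun k => φ (k + r) ∈ S)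
      (by rw [hSd, Nat.zero_add]; exact hv0) (n - 1)
    rw [Nat.sub_add_cancel (by omega)] at hp hP
    have hrep : Rep S (cycE n φ) n w (fun k => φ (k + r)) g := by
      refine ⟨by omega, hψ, hw, hg, hp, hψc, fun v => ?_⟩
      constructor
      · intro hv
        obtain ⟨k, hk, rfl⟩ := hsurj v
        have h3 : φ ((k + (n - r)) % n + r) = φ k := by
          rw [hφ, Nat.mod_add_mod, show k + (n - r) + r = k + n by omega, Nat.add_mod_right]
        obtain ⟨i, hi, hik⟩ := (hP ((k + (n - r)) % n) (Nat.mod_lt _ (by omega))).1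
          (by rw [h3]; exact hv)
        refine ⟨i, hi, ?_⟩
        rw [hik, h3]
      · rintro ⟨i, hi, rfl⟩
        have h3 := pos_strict g hg hi le_rfl
        exact (hP (pos g i) (by omega)).2 ⟨i, hi, rfl⟩
    have hw11 : w < 11 := by
      let CE : Finset (Sym2 V) := G.edgeFinset \ cycE n φ
      have hCE : CE.card ≤ 5 := by
        have h4 : cycE n φ ⊆ G.edgeFinset := by
          intro e hec
          rw [mem_edgeFinset]; exact hCG e hec
        have h5 := Finset.card_sdiff_add_card_eq_card h4
        rw [hφ.card (by omega)] at h5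
        have h6 : G.edgeSet.ncard = G.edgeFinset.card := by
          rw [← coe_edgeFinset, Set.ncard_coe_finset]
        show (G.edgeFinset \ cycE n φ).card ≤ 5
        omega
      have h7 : (Finset.range w).image (fun i => φ (pos g i + r)) ⊆
          CE.biUnion (fun e => e.toFinset) := by
        intro v hv
        simp only [Finset.mem_image, Finset.mem_range] at hv
        obtain ⟨u, hu, huC⟩ := (hSd v).1 ((hrep.pts v).2 hv)
        rw [Finset.mem_biUnion]
        refine ⟨s(v, u), ?_, by simp⟩
        rw [Finset.mem_sdiff, mem_edgeFinset]
        exact ⟨hu, huC⟩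
      have h8 := Finset.card_le_card h7
      rw [Finset.card_image_of_injOn, Finset.card_range] at h8
      · have h9 : (CE.biUnion (fun e => e.toFinset)).card ≤ CE.card * 2 := by
          apply Finset.card_biUnion_le_card_mul
          intro e _
          rw [Sym2.card_toFinset]
          split_ifs <;> omega
        omega
      · intro a ha b hb hab
        simp only [Finset.coe_range, Set.mem_Iio] at ha hb
        exact hrep.pinj ha hb hab
    obtain ⟨φ', g', hrep', hcan⟩ := exists_canon G hrep hw11
    exact hrep'.final hw11 hSd hCG hcan hcard he hev col hcol hcyc
  · exfalso
    push Not at hch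
    have hd : Data G n 1 φ (fun _ => n) [] := by
      refine ⟨by omega, hφ, le_rfl, by simp, fun _ _ => by omega, by simp [pos], ?_, ?_⟩
      · intro k hk l hl hkl
        simp only [List.length_nil, Nat.add_zero] at hk hl
        rw [edg_cyc hk, edg_cyc hl] at hkl
        exact hφ.edge_inj (by omega) k hk l hl hkl
      · intro x
        constructor
        · intro hx
          have hxC : x ∈ cycE n φ := by
            induction x using Sym2.ind with
            | _ a b => exact hch a b hx
          rw [cycE, Finset.mem_image] at hxC
          obtain ⟨k, hk, rfl⟩ := hxC
          rw [Finset.mem_range] at hk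
          exact ⟨k, by simpa using hk, edg_cyc hk⟩
        · rintro ⟨k, hk, rfl⟩
          simp only [List.length_nil, Nat.add_zero] at hk
          rw [edg_cyc hk]
          apply hCG
          rw [cycE, Finset.mem_image]
          exact ⟨k, Finset.mem_range.2 hk, rfl⟩
    have h3 := (hd.tail_count (by simp) hcard hev col hcol hcyc).1
    have h4 : (mins 1 []).length = 1 := by decide +kernel
    omega

end BP

theorem two_bipancyclic_orders {V : Type*} [Fintype V] (G : SimpleGraph V)
    (hG : IsRBipancyclic G 2) (he : G.edgeSet.ncard ≤ Fintype.card V + 5) :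
    Fintype.card V ∈ ({14, 22} : Set ℕ) := by
  classical
  obtain ⟨⟨c⟩, hev, h4, hcyc⟩ := hG
  have h := BP.main G _ rfl h4 he hev (fun v => ((c v : Fin 2).val : ZMod 2)) (fun a b hab => by
    have h1 : ∀ x y : Fin 2, x ≠ y → ((y.val : ℕ) : ZMod 2) = (x.val : ℕ) + 1 := by decide
    exact h1 _ _ (c.valid hab)) hcyc
  simpa using h
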